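/- Let ρ ∈ (0, 1). There exists a constant c_ρ > 0 depending only on ρ such that: for each n, if the martingale differences (X_i)_{1≤i≤n} satisfy conditions (A1), (A2) (with exponent ρ), and (A4) (with the same ρ), and (x_n) is a sequence with x_n ≥ 0 and x_n γ_n → 0 (i.e. x_n = o(γ_n^{-1})), then for all sufficiently large n, P(W_n ≥ x_n)/(1 − Φ(x_n)) ≥ exp{ −c_ρ ( x_n^{2+ρ} ε_n^ρ + x_n² δ_n² + (1 + x_n)( x_n^ρ γ_n^ρ + γ_n^ρ + δ_n ) ) }. The same lower bound holds with P(W_n ≥ x_n)/(1 − Φ(x_n)) replaced by P(W_n ≤ −x_n)/Φ(−x_n). -/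

import Mathlib

open MeasureTheory Filter
open scoped Topology ENNReal

noncomputable def stdNormalCDF (x : ℝ) : ℝ :=
  (Real.sqrt (2 * Real.pi))⁻¹ * ∫ t in Set.Iic x, Real.exp (-(t ^ 2) / 2)

/-- A finite sequence of square-integrable martingale differences
`X 1, ..., X n` adapted to a filtration `F 0 ⊆ F 1 ⊆ ... ⊆ F n`, with
`F 0` trivial, `E[X i | F (i-1)] = 0` and `0 < E[(X i)^2] < ∞`. -/
structure MDS (Ω : Type) [mΩ : MeasurableSpace Ω] (P : Measure Ω) where
  n : ℕ
  npos : 0 < n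
  F : ℕ → MeasurableSpace Ω
  F_mono : Monotone F
  F_le : ∀ i, F i ≤ mΩ
  F_zero : F 0 = ⊥
  X : ℕ → Ω → ℝ
  meas : ∀ i, 1 ≤ i → i ≤ n → StronglyMeasurable[F i] (X i)
  sq_int : ∀ i, 1 ≤ i → i ≤ n → Integrable (fun ω => (X i ω) ^ 2) P
  mean_zero : ∀ i, 1 ≤ i → i ≤ n → P[X i|F (i - 1)] =ᵐ[P] 0
  var_pos : ∀ i, 1 ≤ i → i ≤ n → 0 < ∫ ω, (X i ω) ^ 2 ∂P

namespace MDS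

variable {Ω : Type} [mΩ : MeasurableSpace Ω] {P : Measure Ω}

/-- `S_n = ∑_{i=1}^n X_i`. -/
noncomputable def S (A : MDS Ω P) : Ω → ℝ := fun ω => ∑ i ∈ Finset.Icc 1 A.n, A.X i ω

/-- `B_n² = ∑_{i=1}^n E[X_i²]`. -/
noncomputable def Bsq (A : MDS Ω P) : ℝ := ∑ i ∈ Finset.Icc 1 A.n, ∫ ω, (A.X i ω) ^ 2 ∂P

/-- `[S]_n = ∑_{i=1}^n X_i²`. -/
noncomputable def QV (A : MDS Ω P) : Ω → ℝ := fun ω => ∑ i ∈ Finset.Icc 1 A.n, (A.X i ω) ^ 2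

/-- `⟨S⟩_n = ∑_{i=1}^n E[X_i² | F_{i-1}]`. -/
noncomputable def CV (A : MDS Ω P) : Ω → ℝ :=
  fun ω => ∑ i ∈ Finset.Icc 1 A.n, (P[fun ω' => (A.X i ω') ^ 2|A.F (i - 1)]) ω

/-- `W_n = S_n / √[S]_n`. -/
noncomputable def W (A : MDS Ω P) : Ω → ℝ := fun ω => A.S ω / Real.sqrt (A.QV ω)

/-- Condition (A1): `|⟨S⟩_n − B_n²| ≤ δ² B_n²` a.s., with `δ ∈ [0, 1/4]`. -/
def CondA1 (A : MDS Ω P) (δ : ℝ) : Prop :=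
  0 ≤ δ ∧ δ ≤ 1 / 4 ∧ ∀ᵐ ω ∂P, |A.CV ω - A.Bsq| ≤ δ ^ 2 * A.Bsq

/-- Condition (A2): `∑_{i=1}^n E[|X_i|^{2+ρ} | F_{i-1}] ≤ ε^ρ B_n^{2+ρ}` a.s.,
with `ε ∈ (0, 1/4]`. -/
def CondA2 (A : MDS Ω P) (ρ ε : ℝ) : Prop :=
  0 < ε ∧ ε ≤ 1 / 4 ∧
    (∀ i, 1 ≤ i → i ≤ A.n → Integrable (fun ω => |A.X i ω| ^ (2 + ρ)) P) ∧
    ∀ᵐ ω ∂P,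
      ∑ i ∈ Finset.Icc 1 A.n, (P[fun ω' => |A.X i ω'| ^ (2 + ρ)|A.F (i - 1)]) ω ≤
        ε ^ ρ * A.Bsq ^ ((2 + ρ) / 2)

/-- Condition (A3): `E[X_i² | F_{i-1}] ≤ κ² B_n²` a.s. for each `i`, with `κ ∈ (0, 1/4]`. -/
def CondA3 (A : MDS Ω P) (κ : ℝ) : Prop :=
  0 < κ ∧ κ ≤ 1 / 4 ∧
    ∀ i, 1 ≤ i → i ≤ A.n →
      ∀ᵐ ω ∂P, (P[fun ω' => (A.X i ω') ^ 2|A.F (i - 1)]) ω ≤ κ ^ 2 * A.Bsq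

/-- Condition (A4): `E[|X_i|^{2+ρ} | F_{i-1}] ≤ (γ B_n)^ρ E[X_i² | F_{i-1}]` a.s.
for each `i`, with `γ ∈ (0, 1/4]`. -/
def CondA4 (A : MDS Ω P) (ρ γ : ℝ) : Prop :=
  0 < γ ∧ γ ≤ 1 / 4 ∧
    (∀ i, 1 ≤ i → i ≤ A.n → Integrable (fun ω => |A.X i ω| ^ (2 + ρ)) P) ∧
    ∀ i, 1 ≤ i → i ≤ A.n →
      ∀ᵐ ω ∂P,
        (P[fun ω' => |A.X i ω'| ^ (2 + ρ)|A.F (i - 1)]) ω ≤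
          (γ * Real.sqrt A.Bsq) ^ ρ * (P[fun ω' => (A.X i ω') ^ 2|A.F (i - 1)]) ω

end MDS


namespace SNM

noncomputable def gphi (y : ℝ) : ℝ := (Real.sqrt (2 * Real.pi))⁻¹ * Real.exp (-(y ^ 2) / 2)

lemma exp_int : Integrable (fun t : ℝ => Real.exp (-(t ^ 2) / 2)) := by
  have := integrable_exp_neg_mul_sq (b := 1/2) (by norm_num)
  refine this.congr (Eventually.of_forall fun t => ?_)
  simp only; congr 1; ring

lemma exp_full : ∫ t : ℝ, Real.exp (-(t ^ 2) / 2) = Real.sqrt (2 * Real.pi) := by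
  have := integral_gaussian (1/2)
  rw [show Real.pi / (1/2) = 2 * Real.pi by ring] at this
  rw [← this]; congr 1; ext t; congr 1; ring

lemma sq2pi_pos : 0 < Real.sqrt (2 * Real.pi) := Real.sqrt_pos.2 (by positivity)

lemma cdf_compl (x : ℝ) : 1 - stdNormalCDF x
    = (Real.sqrt (2 * Real.pi))⁻¹ * ∫ t in Set.Ioi x, Real.exp (-(t ^ 2) / 2) := by
  have h := intervalIntegral.integral_Iic_add_Ioi (b := x) exp_int.integrableOn exp_int.integrableOn
  rw [exp_full] at h
  unfold stdNormalCDF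
  have : (∫ t in Set.Ioi x, Real.exp (-(t ^ 2) / 2)) = Real.sqrt (2 * Real.pi) - ∫ t in Set.Iic x, Real.exp (-(t ^ 2) / 2) := by linarith
  rw [this]
  have := sq2pi_pos
  field_simp

lemma cdf_neg (x : ℝ) : stdNormalCDF (-x) = 1 - stdNormalCDF x := by
  rw [cdf_compl]
  unfold stdNormalCDF
  congr 1
  have := integral_comp_neg_Iic (-x) (fun t : ℝ => Real.exp (-(t ^ 2) / 2))
  simpa using this

lemma cdf_nonneg (x : ℝ) : 0 ≤ stdNormalCDF x := by
  unfold stdNormalCDF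
  have : 0 ≤ ∫ t in Set.Iic x, Real.exp (-(t ^ 2) / 2) := integral_nonneg fun t => (Real.exp_pos _).le
  have := sq2pi_pos
  positivity

lemma cdf_le_one (x : ℝ) : stdNormalCDF x ≤ 1 := by
  have := cdf_nonneg (-x)
  rw [cdf_neg] at this; linarith

lemma cdf_hasDeriv (y : ℝ) : HasDerivAt stdNormalCDF (gphi y) y := by
  have hc : Continuous (fun t : ℝ => Real.exp (-(t ^ 2) / 2)) := by fun_prop
  have h1 : ∀ x, stdNormalCDF x = (Real.sqrt (2 * Real.pi))⁻¹ *
      ((∫ t in Set.Iic (0:ℝ), Real.exp (-(t ^ 2) / 2)) + ∫ t in (0:ℝ)..x, Real.exp (-(t ^ 2) / 2)) := by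
    intro x
    unfold stdNormalCDF
    rw [intervalIntegral.integral_Iic_sub_Iic exp_int.integrableOn exp_int.integrableOn |>.symm]
    ring
  have h2 : stdNormalCDF = fun x => (Real.sqrt (2 * Real.pi))⁻¹ *
      ((∫ t in Set.Iic (0:ℝ), Real.exp (-(t ^ 2) / 2)) + ∫ t in (0:ℝ)..x, Real.exp (-(t ^ 2) / 2)) := funext h1
  rw [h2]
  have h3 := intervalIntegral.integral_hasDerivAt_right (hc.intervalIntegrable 0 y)
    (hc.stronglyMeasurableAtFilter _ _) hc.continuousAt
  exact (h3.const_add _).const_mul _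

noncomputable def mills (x : ℝ) : ℝ :=
  (Real.sqrt (2 * Real.pi))⁻¹ * ∫ t in Set.Ioi (0:ℝ), Real.exp (-(x * t) - t ^ 2 / 2)

lemma mills_int (x : ℝ) : Integrable (fun t : ℝ => Real.exp (-(x * t) - t ^ 2 / 2)) := by
  have h := (exp_int.comp_add_right x).const_mul (Real.exp (x^2/2))
  refine h.congr (Eventually.of_forall fun t => ?_)
  simp only
  rw [← Real.exp_add]; congr 1; ring

lemma cdf_compl_mills (x : ℝ) : 1 - stdNormalCDF x = Real.exp (-(x^2)/2) * mills x := by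
  rw [cdf_compl]
  unfold mills
  have h : ∫ t in Set.Ioi (0:ℝ), Real.exp (-((t + x) ^ 2) / 2) = ∫ t in Set.Ioi x, Real.exp (-(t ^ 2) / 2) := by
    have hm : MeasurePreserving (fun t : ℝ => t + x) volume volume := measurePreserving_add_right volume x
    have he : MeasurableEmbedding (fun t : ℝ => t + x) := (MeasurableEquiv.addRight x).measurableEmbedding
    have := hm.setIntegral_preimage_emb he (fun t : ℝ => Real.exp (-(t ^ 2) / 2)) (Set.Ioi x)
    rw [← this]
    simp
  have h5 : ∫ t in Set.Ioi (0:ℝ), Real.exp (-((t + x) ^ 2) / 2)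
      = Real.exp (-(x^2)/2) * ∫ t in Set.Ioi (0:ℝ), Real.exp (-(x * t) - t ^ 2 / 2) := by
    rw [← integral_const_mul]
    refine integral_congr_ae (Eventually.of_forall fun t => ?_)
    simp only
    rw [← Real.exp_add]; congr 1; ring
  rw [← h, h5, mul_left_comm]

lemma mills_zero : mills 0 = 1/2 := by
  unfold mills
  have := integral_gaussian_Ioi (1/2)
  rw [show Real.pi / (1/2) = 2 * Real.pi by ring] at this
  have h2 : (∫ t in Set.Ioi (0:ℝ), Real.exp (-(0 * t) - t ^ 2 / 2)) = Real.sqrt (2 * Real.pi) / 2 := by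
    rw [← this]; congr 1; ext t; congr 1; ring
  rw [h2]
  have := sq2pi_pos
  field_simp

lemma mills_anti {x y : ℝ} (h : x ≤ y) : mills y ≤ mills x := by
  unfold mills
  have := sq2pi_pos
  refine mul_le_mul_of_nonneg_left ?_ (by positivity)
  refine setIntegral_mono_on (mills_int y).integrableOn (mills_int x).integrableOn measurableSet_Ioi ?_
  intro t ht
  have ht : 0 < t := ht
  refine Real.exp_le_exp.2 ?_
  nlinarith

lemma cdf_zero : stdNormalCDF 0 = 1/2 := by
  have := cdf_neg 0
  simp at this; linarith

lemma cdf_tail {u : ℝ} (hu : 0 ≤ u) : stdNormalCDF (-u) ≤ 1/2 * Real.exp (-(u^2)/2) := by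
  rw [cdf_neg, cdf_compl_mills]
  have := mills_anti hu
  rw [mills_zero] at this
  nlinarith [Real.exp_pos (-(u^2)/2)]

lemma first_moment : ∫ t in Set.Ioi (0:ℝ), t * Real.exp (-(t^2)/2) = 1 ∧
    IntegrableOn (fun t : ℝ => t * Real.exp (-(t^2)/2)) (Set.Ioi 0) := by
  have hd : ∀ t ∈ Set.Ici (0:ℝ), HasDerivAt (fun t : ℝ => - Real.exp (-(t^2)/2)) (t * Real.exp (-(t^2)/2)) t := by
    intro t _
    have h1 : HasDerivAt (fun t : ℝ => -(t^2)/2) (-t) t := by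
      have : HasDerivAt (fun t : ℝ => -(t^2)/2) _ t := ((hasDerivAt_pow 2 t).neg).div_const 2
      exact this.congr_deriv (by norm_num; ring)
    have : HasDerivAt (fun t : ℝ => - Real.exp (-(t^2)/2)) _ t := h1.exp.neg
    exact this.congr_deriv (by ring)
  have hl : Tendsto (fun t : ℝ => - Real.exp (-(t^2)/2)) atTop (𝓝 0) := by
    rw [show (0:ℝ) = -0 by simp]
    refine Tendsto.neg (Real.tendsto_exp_atBot.comp ?_)
    have : Tendsto (fun t : ℝ => t^2/2) atTop atTop :=
      (tendsto_pow_atTop (by norm_num)).atTop_div_const (by norm_num)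
    refine (tendsto_neg_atTop_atBot.comp this).congr fun t => ?_
    simp only [Function.comp]; ring
  have hp : ∀ t ∈ Set.Ioi (0:ℝ), 0 ≤ t * Real.exp (-(t^2)/2) := by
    intro t ht; have : 0 < t := ht; positivity
  constructor
  · rw [integral_Ioi_of_hasDerivAt_of_nonneg' hd hp hl]; simp
  · exact integrableOn_Ioi_deriv_of_nonneg' hd hp hl

lemma mills_pos (x : ℝ) : 0 < mills x := by
  unfold mills
  have := sq2pi_pos
  have : 0 < ∫ t in Set.Ioi (0:ℝ), Real.exp (-(x * t) - t ^ 2 / 2) := by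
    refine (setIntegral_pos_iff_support_of_nonneg_ae ?_ (mills_int x).integrableOn).2 ?_
    · exact Eventually.of_forall fun t => (Real.exp_pos _).le
    · have : Function.support (fun t : ℝ => Real.exp (-(x * t) - t ^ 2 / 2)) = Set.univ := by
        ext t; simp
      rw [this]; simp
  positivity

lemma mills_shift {x h : ℝ} (hx : 0 ≤ x) (hh : 0 ≤ h) : Real.exp (-h) * mills x ≤ mills (x + h) := by
  unfold mills
  have := sq2pi_pos
  rw [mul_left_comm]
  refine mul_le_mul_of_nonneg_left ?_ (by positivity)
  rw [← integral_const_mul]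
  have i1 : Integrable (fun t : ℝ => Real.exp (-((x+h) * t) - t ^ 2 / 2)) (volume.restrict (Set.Ioi 0)) := (mills_int (x+h)).integrableOn
  have i2 : Integrable (fun t : ℝ => Real.exp (-h) * Real.exp (-(x * t) - t ^ 2 / 2)) (volume.restrict (Set.Ioi 0)) := ((mills_int x).const_mul _).integrableOn
  have i3 : Integrable (fun t : ℝ => Real.exp (-(t^2)/2)) (volume.restrict (Set.Ioi 0)) := exp_int.integrableOn
  have i4 : Integrable (fun t : ℝ => t * Real.exp (-(t^2)/2)) (volume.restrict (Set.Ioi 0)) := first_moment.2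
  have i5 : Integrable (fun t : ℝ => Real.exp (-(t^2)/2) - t * Real.exp (-(t^2)/2)) (volume.restrict (Set.Ioi 0)) := i3.sub i4
  have e5 : 0 ≤ ∫ t in Set.Ioi (0:ℝ), (Real.exp (-(t^2)/2) - t * Real.exp (-(t^2)/2)) := by
    rw [integral_sub i3 i4, first_moment.1]
    have h0 := mills_zero
    unfold mills at h0
    have h2 : (∫ t in Set.Ioi (0:ℝ), Real.exp (-(0 * t) - t ^ 2 / 2)) = ∫ t in Set.Ioi (0:ℝ), Real.exp (-(t^2)/2) := by
      congr 1; ext t; congr 1; ring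
    rw [h2] at h0
    have h3 : (∫ t in Set.Ioi (0:ℝ), Real.exp (-(t^2)/2)) = Real.sqrt (2*Real.pi)/2 := by
      rw [inv_mul_eq_div, div_eq_iff this.ne'] at h0
      linarith
    rw [h3]
    have : (2:ℝ) ≤ Real.sqrt (2 * Real.pi) := by
      apply Real.le_sqrt_of_sq_le
      nlinarith [Real.pi_gt_three]
    linarith
  have key : (∫ t in Set.Ioi (0:ℝ), (Real.exp (-h-x) * h) * (Real.exp (-(t^2)/2) - t * Real.exp (-(t^2)/2)))
      ≤ ∫ t in Set.Ioi (0:ℝ), (Real.exp (-((x+h) * t) - t ^ 2 / 2) - Real.exp (-h) * Real.exp (-(x * t) - t ^ 2 / 2)) := by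
    refine setIntegral_mono_on (i5.const_mul _) (i1.sub i2) measurableSet_Ioi ?_
    intro t ht
    have e1 : Real.exp (-((x+h) * t) - t ^ 2 / 2) = Real.exp (-h) * Real.exp (-x) * Real.exp (-(t^2)/2) * (Real.exp (h*(1-t)) * Real.exp (x*(1-t))) := by
      simp only [← Real.exp_add]; congr 1; ring
    have e2 : Real.exp (-h) * Real.exp (-(x * t) - t ^ 2 / 2) = Real.exp (-h) * Real.exp (-x) * Real.exp (-(t^2)/2) * (Real.exp (x*(1-t))) := by
      simp only [← Real.exp_add]; congr 1; ring
    have e3 : Real.exp (-h-x) = Real.exp (-h) * Real.exp (-x) := by rw [← Real.exp_add]; congr 1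
    rw [e1, e2, e3]
    have hA : 0 < Real.exp (-h) * Real.exp (-x) * Real.exp (-(t^2)/2) := by positivity
    set A := Real.exp (-h) * Real.exp (-x) * Real.exp (-(t^2)/2) with hAdef
    have : h * (1-t) ≤ Real.exp (h*(1-t)) * Real.exp (x*(1-t)) - Real.exp (x*(1-t)) := by
      have a1 := Real.add_one_le_exp (h*(1-t))
      have a2 := Real.add_one_le_exp (x*(1-t))
      have a3 := Real.exp_pos (x*(1-t))
      rcases le_total 0 (1-t) with h1 | h1
      · nlinarith [mul_nonneg hh h1, mul_nonneg hx h1]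
      · have a4 : Real.exp (x*(1-t)) ≤ 1 := Real.exp_le_one_iff.2 (mul_nonpos_of_nonneg_of_nonpos hx h1)
        nlinarith [mul_nonpos_of_nonneg_of_nonpos hh h1]
    calc Real.exp (-h) * Real.exp (-x) * h * (Real.exp (-(t^2)/2) - t * Real.exp (-(t^2)/2)) = A * (h * (1-t)) := by rw [hAdef]; ring
      _ ≤ A * (Real.exp (h*(1-t)) * Real.exp (x*(1-t)) - Real.exp (x*(1-t))) := mul_le_mul_of_nonneg_left this hA.le
      _ = _ := by ring
  rw [integral_sub i1 i2, integral_const_mul] at key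
  have : 0 ≤ Real.exp (-h-x) * h * ∫ t in Set.Ioi (0:ℝ), (Real.exp (-(t^2)/2) - t * Real.exp (-(t^2)/2)) := by positivity
  linarith

end SNM

namespace SNM

noncomputable def qq (y : ℝ) : ℝ := (1 + y^2)⁻¹

lemma qq_pos (y : ℝ) : 0 < qq y := by unfold qq; positivity
lemma qq_le_one (y : ℝ) : qq y ≤ 1 := by
  unfold qq; exact inv_le_one_of_one_le₀ (by nlinarith [sq_nonneg y])

/-- `g0` with its first three derivatives, all controlled by `qq`. -/
structure Nice (α C : ℝ) (g0 g1 g2 g3 : ℝ → ℝ) : Prop where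
  d0 : ∀ y, HasDerivAt g0 (g1 y) y
  d1 : ∀ y, HasDerivAt g1 (g2 y) y
  d2 : ∀ y, HasDerivAt g2 (g3 y) y
  C_nonneg : 0 ≤ C
  b0 : ∀ y, |g0 y| ≤ C
  b0' : ∀ y, |α * g0 y| ≤ C * qq y
  b1 : ∀ y, |g1 y| ≤ C * qq y
  b2 : ∀ y, |g2 y| ≤ C * qq y
  b3 : ∀ y, |g3 y| ≤ C * qq y
  c1 : ∀ y, |y * g1 y| ≤ C * qq y
  c2 : ∀ y, |y^2 * g2 y| ≤ C * qq y

lemma mvt {f f' : ℝ → ℝ} {a b K : ℝ} (hd : ∀ x ∈ Set.uIcc a b, HasDerivAt f (f' x) x)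
    (hb : ∀ x ∈ Set.uIcc a b, |f' x| ≤ K) : |f b - f a| ≤ K * |b - a| := by
  have := Convex.norm_image_sub_le_of_norm_hasDerivWithin_le (f := f) (f' := f') (s := Set.uIcc a b)
    (x := a) (y := b) (C := K) (fun x hx => (hd x hx).hasDerivWithinAt) (fun x hx => hb x hx)
    (convex_uIcc a b) Set.left_mem_uIcc Set.right_mem_uIcc
  simpa using this

lemma abs_le_of_uIcc {x h : ℝ} (hx : x ∈ Set.uIcc 0 h) : |x| ≤ |h| := by
  have := Set.abs_sub_left_of_mem_uIcc hx
  simpa using this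

lemma qq_near {y θ : ℝ} (h : |θ| ≤ 1) : qq (y + θ) ≤ 3 * qq y := by
  unfold qq
  rw [← div_eq_mul_inv, inv_eq_one_div, div_le_div_iff₀ (by positivity) (by positivity)]
  have := abs_le.1 h
  nlinarith [sq_nonneg (2*θ + y), sq_nonneg θ, sq_nonneg (y+2*θ)]

lemma taylor_space {α C : ℝ} {g0 g1 g2 g3 : ℝ → ℝ} (H : Nice α C g0 g1 g2 g3) {ρ : ℝ} (h0 : 0 < ρ)
    (h1 : ρ < 1) (y h : ℝ) :
    |g0 (y+h) - g0 y - g1 y * h - g2 y * h^2/2| ≤ 20 * C * qq y * |h|^(2+ρ) := by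
  have hC := H.C_nonneg
  have hq := qq_pos y
  rcases le_or_gt |h| 1 with hh | hh
  · -- small h
    have key2 : ∀ θ ∈ Set.uIcc 0 h, |g2 (y+θ) - g2 y| ≤ 3*C*qq y * |h| := by
      intro θ hθ
      have ht := abs_le_of_uIcc hθ
      have := mvt (f := fun t => g2 (y+t)) (f' := fun t => g3 (y+t)) (a := 0) (b := θ) (K := 3*C*qq y)
        (fun x _ => (H.d2 (y+x)).comp_const_add y x)
        (fun x hx => by
          have hx' := abs_le_of_uIcc hx
          have := H.b3 (y+x)
          have h5 := qq_near (y := y) (θ := x) (by linarith)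
          nlinarith)
      simp only [add_zero, sub_zero] at this
      refine this.trans ?_
      have : 0 ≤ 3*C*qq y := by positivity
      nlinarith
    have key1 : ∀ θ ∈ Set.uIcc 0 h, |g1 (y+θ) - g1 y - g2 y * θ| ≤ 3*C*qq y * |h| * |h| := by
      intro θ hθ
      have ht := abs_le_of_uIcc hθ
      have := mvt (f := fun t => g1 (y+t) - g2 y * t) (f' := fun t => g2 (y+t) - g2 y) (a := 0) (b := θ)
        (K := 3*C*qq y*|h|)
        (fun x _ => by
          have := ((H.d1 (y+x)).comp_const_add y x).sub ((hasDerivAt_id x).const_mul (g2 y))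
          exact this.congr_deriv (by simp))
        (fun x hx => key2 x (Set.uIcc_subset_uIcc_left hθ hx))
      simp only [add_zero, sub_zero, mul_zero] at this
      have e : g1 (y + θ) - g2 y * θ - g1 y = g1 (y+θ) - g1 y - g2 y * θ := by ring
      rw [e] at this
      refine this.trans ?_
      have : 0 ≤ 3*C*qq y*|h| := by positivity
      nlinarith
    have := mvt (f := fun t => g0 (y+t) - g1 y * t - g2 y * t^2/2) (f' := fun t => g1 (y+t) - g1 y - g2 y * t) (a := 0) (b := h)
        (K := 3*C*qq y * |h| * |h|)
        (fun x _ => by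
          have := (((H.d0 (y+x)).comp_const_add y x).sub ((hasDerivAt_id x).const_mul (g1 y))).sub
            (((hasDerivAt_pow 2 x).const_mul (g2 y)).div_const 2)
          exact this.congr_deriv (by simp; ring))
        key1
    simp only [add_zero, sub_zero, mul_zero] at this
    have e : g0 (y + h) - g1 y * h - g2 y * h^2/2 - (g0 y - g2 y * 0^2/2) = g0 (y+h) - g0 y - g1 y * h - g2 y * h^2/2 := by ring
    rw [e] at this
    refine this.trans ?_
    have h3 : |h| * |h| * |h| ≤ |h|^(2+ρ) := by
      rcases eq_or_lt_of_le (abs_nonneg h) with h0' | h0'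
      · rw [← h0']; simp; positivity
      · have : |h| * |h| * |h| = |h|^(3:ℝ) := by
          rw [show (3:ℝ) = ((3:ℕ):ℝ) by norm_num, Real.rpow_natCast]; ring
        rw [this]
        exact Real.rpow_le_rpow_of_exponent_ge h0' hh (by linarith)
    have : 0 ≤ C * qq y := by positivity
    have h4 : 0 ≤ |h|^(2+ρ) := by positivity
    nlinarith [mul_le_mul_of_nonneg_left h3 this, mul_nonneg this h4]
  · have hp : h^2 ≤ |h|^(2+ρ) := by
      have : h^2 = |h|^(2:ℝ) := by rw [show (2:ℝ) = ((2:ℕ):ℝ) by norm_num, Real.rpow_natCast]; simp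
      rw [this]
      exact Real.rpow_le_rpow_of_exponent_le hh.le (by linarith)
    have hsq : |h| ≤ h^2 := by rw [← sq_abs]; nlinarith
    have hd : |g0 (y+h) - g0 y| ≤ 10 * C * qq y * h^2 := by
      rcases le_or_gt (2*|h|) |y| with h2 | h2
      · have := mvt (f := fun t => g0 (y+t)) (f' := fun t => g1 (y+t)) (a := 0) (b := h) (K := 4*C*qq y)
          (fun x _ => (H.d0 (y+x)).comp_const_add y x)
          (fun x hx => by
            have hx' := abs_le_of_uIcc hx
            have hb := H.b1 (y+x)
            have : qq (y+x) ≤ 4 * qq y := by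
              unfold qq
              rw [← div_eq_mul_inv, inv_eq_one_div, div_le_div_iff₀ (by positivity) (by positivity)]
              have h6 : |y| / 2 ≤ |y + x| := by
                have := abs_sub_abs_le_abs_sub y (-x)
                rw [sub_neg_eq_add, abs_neg] at this
                linarith
              have h7 : (|y|/2)^2 ≤ |y+x|^2 := by
                have := abs_nonneg y
                gcongr
              rw [div_pow, sq_abs, sq_abs] at h7
              linarith
            nlinarith)
        simp only [add_zero, sub_zero] at this
        refine this.trans ?_
        have : 0 ≤ C*qq y := by positivity
        nlinarith [mul_le_mul_of_nonneg_left hsq this, abs_nonneg h]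
      · have h5 : 1 ≤ 5 * qq y * h^2 := by
          unfold qq
          rw [mul_comm, ← mul_assoc, ← div_eq_mul_inv, le_div_iff₀ (by positivity)]
          have : y^2 ≤ 4 * h^2 := by
            rw [← sq_abs y, ← sq_abs h]
            nlinarith [abs_nonneg y, abs_nonneg h]
          have : 1 ≤ h^2 := by linarith
          linarith
        have := abs_sub (g0 (y+h)) (g0 y)
        have h6 := H.b0 (y+h)
        have h7 := H.b0 y
        nlinarith
    have e : g0 (y+h) - g0 y - g1 y * h - g2 y * h^2/2 = (g0 (y+h) - g0 y) + (-(g1 y * h)) + (-(g2 y * h^2/2)) := by ring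
    rw [e]
    refine (abs_add_three _ _ _).trans ?_
    rw [abs_neg, abs_neg, abs_mul (g1 y), abs_div, abs_mul (g2 y), abs_of_nonneg (sq_nonneg h), abs_of_pos (two_pos : (0:ℝ) < 2)]
    have a1 := H.b1 y
    have a2 := H.b2 y
    have : 0 ≤ C * qq y := by positivity
    have a3 : |g1 y| * |h| ≤ C * qq y * h^2 := by
      calc |g1 y| * |h| ≤ C * qq y * |h| := by gcongr
        _ ≤ _ := by gcongr
    have a4 : |g2 y| * h^2 ≤ C * qq y * h^2 := by gcongr
    have a5 : C * qq y * h^2 ≤ C * qq y * |h|^(2+ρ) := by gcongr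
    have a6 : 0 ≤ C * qq y * h^2 := by positivity
    linarith

noncomputable def comp (α : ℝ) (g : ℝ → ℝ) (z r : ℝ) : ℝ := r^(-α/2) * g (z / Real.sqrt r)

lemma comp_deriv (α : ℝ) {g0 g1 : ℝ → ℝ} (hd : ∀ y, HasDerivAt g0 (g1 y) y) (z : ℝ) {r : ℝ} (hr : 0 < r) :
    HasDerivAt (fun r => comp α g0 z r) (-(1/2) * comp (α+2) (fun y => α * g0 y + y * g1 y) z r) r := by
  unfold comp
  have hs : 0 < Real.sqrt r := Real.sqrt_pos.2 hr
  have e1 : HasDerivAt (fun r : ℝ => r^(-α/2)) ((-α/2) * r^(-α/2-1)) r := Real.hasDerivAt_rpow_const (Or.inl hr.ne')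
  have e2 : HasDerivAt (fun r : ℝ => z / Real.sqrt r) (-(z * (1/(2*Real.sqrt r)))/ (Real.sqrt r)^2) r := by
    have := (hasDerivAt_const r z).div (Real.hasDerivAt_sqrt hr.ne') hs.ne'
    exact this.congr_deriv (by simp)
  have e3 := e1.mul ((hd (z / Real.sqrt r)).comp r e2)
  refine e3.congr_deriv ?_
  have e4 : r^(-(α+2)/2) = r^(-α/2-1) := by congr 1; ring
  have e5 : r^(-α/2) = r^(-α/2-1) * r := by
    rw [Real.rpow_sub_one hr.ne']; field_simp
  rw [e4]
  simp only [Function.comp]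
  rw [e5, Real.sq_sqrt hr.le]
  field_simp
  ring

lemma qq_time {z r r' : ℝ} (hr : 0 < r) (h1 : r ≤ r') (h2 : r' ≤ 2 * r) :
    qq (z / Real.sqrt r') ≤ 2 * qq (z / Real.sqrt r) := by
  unfold qq
  have hr' : 0 < r' := by linarith
  rw [div_pow, div_pow, Real.sq_sqrt hr.le, Real.sq_sqrt hr'.le]
  rw [← div_eq_mul_inv, inv_eq_one_div, div_le_div_iff₀ (by positivity) (by positivity)]
  have : z^2/r ≤ 2 * (z^2/r') := by
    rw [div_le_iff₀ hr, ← mul_div_assoc, div_mul_eq_mul_div, le_div_iff₀ hr']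
    nlinarith [sq_nonneg z]
  linarith

lemma taylor_time {α C : ℝ} {g0 g1 g2 g3 : ℝ → ℝ} (H : Nice α C g0 g1 g2 g3) (ha : 0 ≤ α) (ha' : α ≤ 1)
    (z : ℝ) {r d : ℝ} (hr : 0 < r) (hd : 0 ≤ d) (hdr : d ≤ r) :
    |comp α g0 z (r+d) - comp α g0 z r + d * (1/2) * comp (α+2) (fun y => α * g0 y + y * g1 y) z r|
      ≤ 5 * C * comp (α+4) qq z r * d^2 := by
  have hC := H.C_nonneg
  set K := 5 * C * comp (α+4) qq z r with hK
  have hK0 : 0 ≤ K := by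
    rw [hK]; unfold comp; have := qq_pos (z / Real.sqrt r); positivity
  have hdk : ∀ y, HasDerivAt (fun y => α * g0 y + y * g1 y) (α * g1 y + (g1 y + y * g2 y)) y := by
    intro y
    have := ((H.d0 y).const_mul α).add ((hasDerivAt_id y).mul (H.d1 y))
    exact this.congr_deriv (by simp)
  have key : ∀ t ∈ Set.uIcc 0 d, |-(1/2) * comp (α+2) (fun y => α * g0 y + y * g1 y) z (r+t) - -(1/2) * comp (α+2) (fun y => α * g0 y + y * g1 y) z r| ≤ K * d := by
    intro θ hθ
    rw [Set.uIcc_of_le hd] at hθ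
    have := mvt (f := fun t => -(1/2) * comp (α+2) (fun y => α * g0 y + y * g1 y) z (r+t))
      (f' := fun t => -(1/2) * (-(1/2) * comp (α+2+2) (fun y => (α+2) * (α * g0 y + y * g1 y) + y * (α * g1 y + (g1 y + y * g2 y))) z (r+t)))
      (a := 0) (b := θ) (K := K)
      (fun x hx => by
        rw [Set.uIcc_of_le hθ.1] at hx
        have := (comp_deriv (α+2) hdk z (r := r+x) (by linarith [hx.1]))
        exact (this.comp_const_add r x).const_mul _)
      (fun x hx => by
        rw [Set.uIcc_of_le hθ.1] at hx
        unfold comp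
        set y := z / Real.sqrt (r+x) with hy
        have hb : |(α+2) * (α * g0 y + y * g1 y) + y * (α * g1 y + (g1 y + y * g2 y))| ≤ 9 * (C * qq y) := by
          have e : (α+2) * (α * g0 y + y * g1 y) + y * (α * g1 y + (g1 y + y * g2 y)) = (α+2) * (α * g0 y) + (2*α+3) * (y * g1 y) + y^2 * g2 y := by ring
          rw [e]
          refine (abs_add_three _ _ _).trans ?_
          rw [abs_mul, abs_mul (2*α+3), abs_of_nonneg (by linarith : 0 ≤ α+2), abs_of_nonneg (by linarith : 0 ≤ 2*α+3)]
          have a1 := H.b0' y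
          have a2 := H.c1 y
          have a3 := H.c2 y
          have : (α+2) * |α * g0 y| ≤ 3 * (C * qq y) := by
            apply mul_le_mul (by linarith) a1 (abs_nonneg _) (by norm_num)
          have : (2*α+3) * |y * g1 y| ≤ 5 * (C * qq y) := by
            apply mul_le_mul (by linarith) a2 (abs_nonneg _) (by norm_num)
          linarith
        have h2 : qq y ≤ 2 * qq (z / Real.sqrt r) := qq_time hr (by linarith [hx.1]) (by linarith [hx.2, hθ.2])
        have h3 : (r+x)^(-(α+2+2)/2) ≤ r^(-(α+4)/2) := by
          rw [show α+2+2 = α+4 by ring]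
          exact Real.rpow_le_rpow_of_nonpos hr (by linarith [hx.1]) (by linarith)
        have h4 : 0 ≤ (r+x)^(-(α+2+2)/2) := Real.rpow_nonneg (by linarith [hx.1]) _
        rw [abs_mul, abs_mul, abs_mul, abs_of_nonneg h4, hK]
        unfold comp
        have h5 : C * qq y ≤ 2 * (C * qq (z / Real.sqrt r)) := by nlinarith
        have h6 : 0 ≤ C * qq (z / Real.sqrt r) := mul_nonneg hC (qq_pos _).le
        have h7 : (r+x)^(-(α+2+2)/2) * |(α+2) * (α * g0 y + y * g1 y) + y * (α * g1 y + (g1 y + y * g2 y))| ≤ r^(-(α+4)/2) * (18 * (C * qq (z / Real.sqrt r))) :=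
          mul_le_mul h3 (by linarith) (abs_nonneg _) (h4.trans h3)
        have h8 : 0 ≤ r^(-(α+4)/2) * (C * qq (z / Real.sqrt r)) := mul_nonneg (h4.trans h3) h6
        have : |(-(1/2):ℝ)| = 1/2 := by rw [abs_neg]; norm_num
        rw [this]
        linarith)
    simp only [add_zero, sub_zero] at this
    refine this.trans ?_
    rw [abs_of_nonneg hθ.1]
    exact mul_le_mul_of_nonneg_left hθ.2 hK0
  have := mvt (f := fun t => comp α g0 z (r+t) - t * (-(1/2) * comp (α+2) (fun y => α * g0 y + y * g1 y) z r))
    (f' := fun t => -(1/2) * comp (α+2) (fun y => α * g0 y + y * g1 y) z (r+t) - -(1/2) * comp (α+2) (fun y => α * g0 y + y * g1 y) z r)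
    (a := 0) (b := d) (K := K * d)
    (fun x hx => by
        rw [Set.uIcc_of_le hd] at hx
        have := (comp_deriv α H.d0 z (r := r+x) (by linarith [hx.1]))
        have := (this.comp_const_add r x).sub ((hasDerivAt_id x).mul_const (-(1/2) * comp (α+2) (fun y => α * g0 y + y * g1 y) z r))
        exact this.congr_deriv (by simp)) key
  simp only [add_zero, sub_zero, zero_mul] at this
  rw [abs_of_nonneg hd] at this
  calc _ = |comp α g0 z (r + d) - d * (-(1 / 2) * comp (α + 2) (fun y => α * g0 y + y * g1 y) z r) - comp α g0 z r| := by
        congr 1; ring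
    _ ≤ K * d * d := this
    _ = K * d^2 := by ring

/-- one-step expansion of a component -/
lemma one_step {α C : ℝ} {g0 g1 g2 g3 : ℝ → ℝ} (H : Nice α C g0 g1 g2 g3) (ha : 0 ≤ α) (ha' : α ≤ 1)
    {ρ : ℝ} (h0 : 0 < ρ) (h1 : ρ < 1) (z h : ℝ) {R d : ℝ} (hr : 0 < R) (hd : 0 ≤ d) (hdr : d ≤ R) :
    |comp α g0 (z+h) R - comp α g0 z (R+d) - h * (comp α g1 z R / Real.sqrt R) - h^2/2 * (comp α g2 z R / R)
       - d * (1/2) * (comp α (fun y => α * g0 y + y * g1 y) z R / R)|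
      ≤ 20 * C * comp α qq z R * ((|h|/Real.sqrt R)^(2+ρ) + (d/R)^2) := by
  have hC := H.C_nonneg
  have hs : 0 < Real.sqrt R := Real.sqrt_pos.2 hr
  have ht := taylor_time H ha ha' z hr hd hdr
  have hsp := taylor_space H h0 h1 (z/Real.sqrt R) (h / Real.sqrt R)
  have e1 : ∀ g : ℝ → ℝ, comp (α+2) g z R = comp α g z R / R := by
    intro g; unfold comp
    rw [show -(α+2)/2 = -α/2 - 1 by ring, Real.rpow_sub_one hr.ne']; ring
  have e2 : comp (α+4) qq z R = comp α qq z R / R^2 := by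
    unfold comp
    rw [show -(α+4)/2 = -α/2 - 1 - 1 by ring, Real.rpow_sub_one hr.ne', Real.rpow_sub_one hr.ne']
    field_simp
  rw [e1, e2] at ht
  have hp : 0 < R^(-α/2) := Real.rpow_pos_of_pos hr _
  have h3 : |comp α g0 (z+h) R - comp α g0 z R - h * (comp α g1 z R / Real.sqrt R) - h^2/2 * (comp α g2 z R / R)| ≤ 20 * C * comp α qq z R * (|h|/Real.sqrt R)^(2+ρ) := by
    unfold comp
    have e : R^(-α/2) * g0 ((z+h)/Real.sqrt R) - R^(-α/2) * g0 (z/Real.sqrt R) - h * (R^(-α/2) * g1 (z/Real.sqrt R) / Real.sqrt R) - h^2/2 * (R^(-α/2) * g2 (z/Real.sqrt R) / R)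
       = R^(-α/2) * (g0 (z / √R + h / √R) - g0 (z / √R) - g1 (z / √R) * (h / √R) - g2 (z / √R) * (h / √R) ^ 2 / 2) := by
      rw [← add_div, div_pow, Real.sq_sqrt hr.le]; ring
    rw [e, abs_mul, abs_of_pos hp]
    rw [abs_div, abs_of_pos hs] at hsp
    calc _ ≤ R^(-α/2) * (20 * C * qq (z / √R) * (|h| / √R) ^ (2 + ρ)) := by gcongr
      _ = _ := by ring
  have e4 : comp α g0 (z+h) R - comp α g0 z (R+d) - h * (comp α g1 z R / Real.sqrt R) - h^2/2 * (comp α g2 z R / R)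
       - d * (1/2) * (comp α (fun y => α * g0 y + y * g1 y) z R / R)
     = (comp α g0 (z+h) R - comp α g0 z R - h * (comp α g1 z R / Real.sqrt R) - h^2/2 * (comp α g2 z R / R))
      - (comp α g0 z (R + d) - comp α g0 z R + d * (1 / 2) * (comp α (fun y => α * g0 y + y * g1 y) z R / R)) := by ring
  rw [e4]
  refine (abs_sub _ _).trans ?_
  have h5 : 0 ≤ C * comp α qq z R * (d/R)^2 := by
    unfold comp; have := qq_pos (z / Real.sqrt R); positivity
  have e5 : 5 * C * (comp α qq z R / R ^ 2) * d ^ 2 = 5 * (C * comp α qq z R * (d/R)^2) := by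
    rw [div_pow]; ring
  rw [e5] at ht
  linarith

end SNM

namespace SNM

noncomputable def ge (y : ℝ) : ℝ := Real.exp (-(y^2)/2)

lemma ge_pos (y : ℝ) : 0 < ge y := Real.exp_pos _
lemma ge_le_one (y : ℝ) : ge y ≤ 1 := by
  unfold ge; apply Real.exp_le_one_iff.2; nlinarith [sq_nonneg y]

lemma ge_deriv (y : ℝ) : HasDerivAt ge (-(y * ge y)) y := by
  unfold ge
  have : HasDerivAt (fun y : ℝ => -(y^2)/2) (-y) y := by
    have := ((hasDerivAt_pow 2 y).neg).div_const 2
    exact this.congr_deriv (by simp; ring)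
  exact this.exp.congr_deriv (by ring)

lemma ge_qq (y : ℝ) : (1+y^2)^4 * ge y ≤ 4096 := by
  have h1 : 1 + y^2/8 ≤ Real.exp (y^2/8) := by linarith [Real.add_one_le_exp (y^2/8)]
  have h2 : (1+y^2/8)^4 ≤ Real.exp (y^2/8)^4 := by gcongr
  have h3 : Real.exp (y^2/8)^4 * ge y = 1 := by
    unfold ge; rw [← Real.exp_nat_mul, ← Real.exp_add]; simp; ring
  have h4 : 1 + y^2 ≤ 8 * (1+y^2/8) := by linarith
  have h5 : (1+y^2)^4 ≤ (8*(1+y^2/8))^4 := by gcongr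
  have := ge_pos y
  calc (1+y^2)^4 * ge y ≤ (8*(1+y^2/8))^4 * ge y := by gcongr
    _ = 4096 * ((1+y^2/8)^4 * ge y) := by ring
    _ ≤ 4096 * (Real.exp (y^2/8)^4 * ge y) := by gcongr
    _ = 4096 := by rw [h3]; ring

/-- generic polynomial bound -/
lemma ge_poly {y p k : ℝ} (hk : 0 ≤ k) (hp : |p| ≤ k * (1+y^2)^3) : |p * ge y| ≤ k * 4096 * qq y := by
  have h := ge_qq y
  have hg := ge_pos y
  have h1 : 0 < 1 + y^2 := by positivity
  rw [abs_mul, abs_of_pos hg]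
  unfold qq
  rw [← div_eq_mul_inv, le_div_iff₀ h1]
  calc |p| * ge y * (1+y^2) ≤ k * (1+y^2)^3 * ge y * (1+y^2) := by gcongr
    _ = k * ((1+y^2)^4 * ge y) := by ring
    _ ≤ k * 4096 := by gcongr

lemma abs_y_le (y : ℝ) : |y| ≤ 1 + y^2 := by
  rw [← sq_abs]; nlinarith [sq_nonneg (|y| - 1), abs_nonneg y]

lemma gpoly1 (y : ℝ) : |(1:ℝ)| ≤ 1 * (1+y^2)^3 := by
  rw [abs_one, one_mul]; exact one_le_pow₀ (by nlinarith [sq_nonneg y])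
lemma gpoly2 (y : ℝ) : |y| ≤ 1 * (1+y^2)^3 := by
  rw [one_mul]
  calc |y| ≤ 1+y^2 := abs_y_le y
    _ ≤ _ := le_self_pow₀ (by nlinarith [sq_nonneg y]) (by norm_num)
lemma gpoly3 (y : ℝ) : |y^2-1| ≤ 1 * (1+y^2)^3 := by
  rw [one_mul]
  calc |y^2-1| ≤ 1+y^2 := by rw [abs_le]; constructor <;> nlinarith [sq_nonneg y]
    _ ≤ _ := le_self_pow₀ (by nlinarith [sq_nonneg y]) (by norm_num)
lemma gpoly4 (y : ℝ) : |y*(3-y^2)| ≤ 3 * (1+y^2)^3 := by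
  rw [abs_mul]
  have h1 := abs_y_le y
  have h2 : |3-y^2| ≤ 3 * (1+y^2) := by rw [abs_le]; constructor <;> nlinarith [sq_nonneg y]
  calc |y| * |3-y^2| ≤ (1+y^2) * (3 * (1+y^2)) := by gcongr
    _ = 3 * (1+y^2)^2 := by ring
    _ ≤ _ := by
      gcongr
      · nlinarith [sq_nonneg y]
      · norm_num
lemma gpoly5 (y : ℝ) : |y^2| ≤ 1 * (1+y^2)^3 := by
  rw [one_mul, abs_of_nonneg (sq_nonneg y)]
  calc y^2 ≤ 1+y^2 := by linarith
    _ ≤ _ := le_self_pow₀ (by nlinarith [sq_nonneg y]) (by norm_num)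
lemma gpoly6 (y : ℝ) : |y^2*(y^2-1)| ≤ 1 * (1+y^2)^3 := by
  rw [abs_mul, one_mul]
  have h2 : |y^2-1| ≤ (1+y^2) := by rw [abs_le]; constructor <;> nlinarith [sq_nonneg y]
  have h1 : |y^2| ≤ (1+y^2) := by rw [abs_of_nonneg (sq_nonneg y)]; linarith
  calc |y^2| * |y^2-1| ≤ (1+y^2) * (1+y^2) := by gcongr
    _ = (1+y^2)^2 := by ring
    _ ≤ _ := pow_le_pow_right₀ (by nlinarith [sq_nonneg y]) (by norm_num)
lemma gpoly7 (y : ℝ) : |y^3| ≤ 1 * (1+y^2)^3 := by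
  rw [one_mul, abs_pow]
  have := abs_y_le y
  gcongr

def CG : ℝ := 12288

lemma CGle {y p k : ℝ} (hk : 0 ≤ k) (hk3 : k ≤ 3) (hp : |p| ≤ k * (1+y^2)^3) : |p * ge y| ≤ CG * qq y := by
  refine (ge_poly hk hp).trans ?_
  have := qq_pos y
  gcongr
  unfold CG; linarith

lemma nice_gauss {α : ℝ} (ha : 0 ≤ α) (ha' : α ≤ 1) : Nice α CG ge (fun y => -(y * ge y)) (fun y => (y^2-1) * ge y)
    (fun y => (y*(3-y^2)) * ge y) where
  d0 := ge_deriv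
  d1 := fun y => by
    have := ((hasDerivAt_id y).mul (ge_deriv y)).neg
    exact this.congr_deriv (by simp; ring)
  d2 := fun y => by
    have := ((hasDerivAt_pow 2 y).sub_const 1).mul (ge_deriv y)
    exact this.congr_deriv (by simp; ring)
  C_nonneg := by norm_num [CG]
  b0 := fun y => by
    rw [abs_of_pos (ge_pos y)]; have := ge_le_one y; unfold CG; linarith
  b0' := fun y => by
    have h1 := CGle (y := y) (p := 1) (by norm_num) (by norm_num) (gpoly1 y)
    rw [one_mul] at h1
    rw [abs_mul, abs_of_nonneg ha]
    nlinarith [abs_nonneg (ge y)]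
  b1 := fun y => by
    rw [abs_neg]
    exact CGle (by norm_num) (by norm_num) (gpoly2 y)
  b2 := fun y => CGle (by norm_num) (by norm_num) (gpoly3 y)
  b3 := fun y => CGle (by norm_num) (by norm_num) (gpoly4 y)
  c1 := fun y => by
    rw [show y * -(y * ge y) = -(y^2 * ge y) by ring, abs_neg]
    exact CGle (by norm_num) (by norm_num) (gpoly5 y)
  c2 := fun y => by
    rw [← mul_assoc]
    exact CGle (by norm_num) (by norm_num) (gpoly6 y)

lemma is2pi_le : (Real.sqrt (2*Real.pi))⁻¹ ≤ 1 := by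
  apply inv_le_one_of_one_le₀
  rw [Real.one_le_sqrt]
  nlinarith [Real.pi_gt_three]

lemma is2pi_nonneg : 0 ≤ (Real.sqrt (2*Real.pi))⁻¹ := by positivity

lemma gphi_eq (y : ℝ) : gphi y = (Real.sqrt (2*Real.pi))⁻¹ * ge y := rfl

lemma k_le {k a b : ℝ} (h0 : 0 ≤ k) (h1 : k ≤ 1) (h : |a| ≤ b) : |k * a| ≤ b := by
  rw [abs_mul, abs_of_nonneg h0]; nlinarith [abs_nonneg a]

lemma nice_cdf : Nice 0 CG stdNormalCDF gphi (fun y => -(y * gphi y)) (fun y => (y^2-1) * gphi y) where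
  d0 := fun y => cdf_hasDeriv y
  d1 := fun y => by
    have := (ge_deriv y).const_mul (Real.sqrt (2*Real.pi))⁻¹
    exact this.congr_deriv (by rw [gphi_eq]; ring)
  d2 := fun y => by
    have h : HasDerivAt gphi (-(y * gphi y)) y := by
      have := (ge_deriv y).const_mul (Real.sqrt (2*Real.pi))⁻¹
      exact this.congr_deriv (by rw [gphi_eq]; ring)
    have := ((hasDerivAt_id y).mul h).neg
    exact this.congr_deriv (by simp; ring)
  C_nonneg := by norm_num [CG]
  b0 := fun y => by
    rw [abs_of_nonneg (cdf_nonneg y)]; have := cdf_le_one y; unfold CG; linarith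
  b0' := fun y => by
    have := qq_pos y; simp; unfold CG; positivity
  b1 := fun y => by
    rw [gphi_eq]
    have := CGle (y := y) (p := 1) (by norm_num) (by norm_num) (gpoly1 y)
    rw [one_mul] at this
    exact k_le is2pi_nonneg is2pi_le this
  b2 := fun y => by
    rw [abs_neg, gphi_eq, mul_left_comm]
    exact k_le is2pi_nonneg is2pi_le (CGle (by norm_num) (by norm_num) (gpoly2 y))
  b3 := fun y => by
    rw [gphi_eq, mul_left_comm]
    exact k_le is2pi_nonneg is2pi_le (CGle (by norm_num) (by norm_num) (gpoly3 y))
  c1 := fun y => by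
    rw [gphi_eq, mul_left_comm]
    exact k_le is2pi_nonneg is2pi_le (CGle (by norm_num) (by norm_num) (gpoly2 y))
  c2 := fun y => by
    rw [gphi_eq, show y^2 * -(y * ((Real.sqrt (2*Real.pi))⁻¹ * ge y)) = -((Real.sqrt (2*Real.pi))⁻¹ * (y^3 * ge y)) by ring, abs_neg]
    exact k_le is2pi_nonneg is2pi_le (CGle (by norm_num) (by norm_num) (gpoly7 y))

lemma qq_deriv (y : ℝ) : HasDerivAt qq (-(2*y*qq y^2)) y := by
  unfold qq
  have h : HasDerivAt (fun y : ℝ => 1 + y^2) (2*y) y := by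
    have := (hasDerivAt_pow 2 y).const_add 1
    exact this.congr_deriv (by simp)
  have := h.inv (by positivity)
  exact this.congr_deriv (by field_simp)

lemma qq_id (y : ℝ) : y^2 * qq y = 1 - qq y := by
  unfold qq; field_simp; ring

lemma y_qq (y : ℝ) : |y| * qq y ≤ 1 := by
  unfold qq; rw [← div_eq_mul_inv, div_le_one (by positivity)]; exact abs_y_le y

lemma nice_qq {α : ℝ} (ha : 0 ≤ α) (ha' : α ≤ 1) : Nice α 100 qq (fun y => -(2*y*qq y^2)) (fun y => 6*qq y^2 - 8*qq y^3)
    (fun y => (12*qq y - 24*qq y^2) * (-(2*y*qq y^2))) where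
  d0 := qq_deriv
  d1 := fun y => by
    have := (((hasDerivAt_id y).const_mul 2).mul ((qq_deriv y).pow 2)).neg
    refine this.congr_deriv ?_
    simp
    have := qq_id y
    linear_combination 8 * qq y^2 * this
  d2 := fun y => by
    have := (((qq_deriv y).pow 2).const_mul 6).sub (((qq_deriv y).pow 3).const_mul 8)
    refine this.congr_deriv ?_
    simp; ring
  C_nonneg := by norm_num
  b0 := fun y => by
    have h := qq_pos y
    rw [abs_of_pos h]; have := qq_le_one y; linarith
  b0' := fun y => by
    have h := qq_pos y
    rw [abs_mul, abs_of_nonneg ha, abs_of_pos h]; nlinarith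
  b1 := fun y => by
    have h := qq_pos y
    have h1 := y_qq y
    have h2 : |-(2*y*qq y^2)| = 2 * (|y| * qq y) * qq y := by
      rw [abs_neg, abs_mul, abs_mul, abs_of_pos (two_pos : (0:ℝ)<2), abs_of_pos (by positivity : 0 < qq y^2)]; ring
    rw [h2]; nlinarith
  b2 := fun y => by
    have h := qq_pos y
    have h1 := qq_le_one y
    have e : 6*qq y^2 - 8*qq y^3 = (6*qq y - 8*qq y^2) * qq y := by ring
    rw [e, abs_mul, abs_of_pos h]
    have : |6*qq y - 8*qq y^2| ≤ 100 := by rw [abs_le]; constructor <;> nlinarith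
    gcongr
  b3 := fun y => by
    have h := qq_pos y
    have h0 := qq_le_one y
    have h1 := y_qq y
    have h2 : |-(2*y*qq y^2)| = 2 * (|y| * qq y) * qq y := by
      rw [abs_neg, abs_mul, abs_mul, abs_of_pos (two_pos : (0:ℝ)<2), abs_of_pos (by positivity : 0 < qq y^2)]; ring
    rw [abs_mul, h2]
    have h3 : |12*qq y - 24*qq y^2| ≤ 36 := by rw [abs_le]; constructor <;> nlinarith
    calc _ ≤ 36 * (2 * 1 * qq y) := by gcongr
      _ ≤ _ := by linarith
  c1 := fun y => by
    have h := qq_pos y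
    have h0 := qq_le_one y
    rw [show y * -(2*y*qq y^2) = -(2*(y^2*qq y)*qq y) by ring, qq_id, abs_neg, abs_mul, abs_of_pos h]
    have h3 : |2*(1-qq y)| ≤ 100 := by rw [abs_le]; constructor <;> nlinarith
    gcongr
  c2 := fun y => by
    have h := qq_pos y
    have h0 := qq_le_one y
    rw [show y^2 * (6*qq y^2 - 8*qq y^3) = ((y^2*qq y)*(6-8*qq y))*qq y by ring, qq_id, abs_mul, abs_of_pos h]
    have h3 : |(1-qq y)*(6-8*qq y)| ≤ 100 := by rw [abs_le]; constructor <;> nlinarith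
    gcongr

lemma Nice.lin {α C C' k : ℝ} {f0 f1 f2 f3 g0 g1 g2 g3 : ℝ → ℝ} (hf : Nice α C f0 f1 f2 f3) (hg : Nice α C' g0 g1 g2 g3)
    (hk : 0 ≤ k) (hk1 : k ≤ 1) : Nice α (C + C') (fun y => f0 y + k * g0 y) (fun y => f1 y + k * g1 y) (fun y => f2 y + k * g2 y)
      (fun y => f3 y + k * g3 y) := by
  have key : ∀ {a b A B q : ℝ}, |a| ≤ A * q → |b| ≤ B * q → |a + k * b| ≤ (A+B) * q := by
    intro a b A B q h1 h2
    have := abs_add_le a (k*b)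
    have h3 := k_le hk hk1 h2
    linarith
  refine ⟨fun y => (hf.d0 y).add ((hg.d0 y).const_mul k), fun y => (hf.d1 y).add ((hg.d1 y).const_mul k),
    fun y => (hf.d2 y).add ((hg.d2 y).const_mul k), add_nonneg hf.C_nonneg hg.C_nonneg, fun y => ?_, fun y => ?_,
    fun y => key (hf.b1 y) (hg.b1 y), fun y => key (hf.b2 y) (hg.b2 y), fun y => key (hf.b3 y) (hg.b3 y), fun y => ?_, fun y => ?_⟩
  · have := key (q := 1) (by simpa using hf.b0 y) (by simpa using hg.b0 y); simpa using this
  · rw [show α * (f0 y + k * g0 y) = α * f0 y + k * (α * g0 y) by ring]; exact key (hf.b0' y) (hg.b0' y)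
  · rw [show y * (f1 y + k * g1 y) = y * f1 y + k * (y * g1 y) by ring]; exact key (hf.c1 y) (hg.c1 y)
  · rw [show y^2 * (f2 y + k * g2 y) = y^2 * f2 y + k * (y^2 * g2 y) by ring]; exact key (hf.c2 y) (hg.c2 y)

noncomputable def kap (ρ : ℝ) : ℝ := (1-ρ)*Real.exp (-(15/2))/2

lemma kap_pos {ρ : ℝ} (h1 : ρ < 1) : 0 < kap ρ := by
  unfold kap; have := Real.exp_pos (-(15/2)); have : 0 < 1-ρ := by linarith
  positivity
lemma kap_le {ρ : ℝ} (h0 : 0 < ρ) (h1 : ρ < 1) : kap ρ ≤ 1 := by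
  unfold kap; have h := Real.exp_le_one_iff.2 (by norm_num : (-(15/2):ℝ) ≤ 0)
  have := Real.exp_pos (-(15/2)); nlinarith

/-- supersolution inequality -/
lemma super {ρ : ℝ} (h0 : 0 < ρ) (h1 : ρ < 1) (y : ℝ) :
    ((y^2-1)*ge y + kap ρ * (6*qq y^2 - 8*qq y^3)) + (ρ * (ge y + kap ρ * qq y) + y * (-(y*ge y) + kap ρ * (-(2*y*qq y^2))))
      ≤ -(kap ρ/2) * qq y := by
  have hk := kap_pos h1
  have hq := qq_pos y
  have hq1 := qq_le_one y
  have hg := ge_pos y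
  have e : ((y^2-1)*ge y + kap ρ * (6*qq y^2 - 8*qq y^3)) + (ρ * (ge y + kap ρ * qq y) + y * (-(y*ge y) + kap ρ * (-(2*y*qq y^2))))
     = -(1-ρ)*ge y + kap ρ * (qq y * (ρ - 2 + 8*qq y - 8*qq y^2)) := by
    linear_combination (-2*kap ρ*qq y) * qq_id y
  rw [e]
  rcases le_or_gt (qq y) (1/16) with h | h
  · have : qq y * (ρ - 2 + 8*qq y - 8*qq y^2) ≤ qq y * (-(1/2)) := by
      apply mul_le_mul_of_nonneg_left _ hq.le
      nlinarith
    nlinarith [mul_le_mul_of_nonneg_left this hk.le]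
  · have hy : y^2 < 15 := by
      have h3 := qq_id y
      nlinarith
    have hge : Real.exp (-(15/2)) ≤ ge y := by
      unfold ge; apply Real.exp_le_exp.2; linarith
    have h4 : kap ρ * 2 ≤ (1-ρ) * ge y := by
      unfold kap; nlinarith
    have h5 : qq y * (ρ - 2 + 8*qq y - 8*qq y^2) ≤ 1 := by
      have : ρ - 2 + 8*qq y - 8*qq y^2 ≤ 1 := by nlinarith [sq_nonneg (2*qq y - 1)]
      nlinarith
    nlinarith [mul_le_mul_of_nonneg_left h5 hk.le]

end SNM

namespace SNM

/-- A potential which propagates along a weighted system. -/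
structure Pot (ρ γ a r0 r1 : ℝ) (G B1 B2 E : ℝ → ℝ → ℝ) : Prop where
  mG : Measurable (fun p : ℝ × ℝ => G p.1 p.2)
  mB1 : Measurable (fun p : ℝ × ℝ => B1 p.1 p.2)
  mB2 : Measurable (fun p : ℝ × ℝ => B2 p.1 p.2)
  mE : Measurable (fun p : ℝ × ℝ => E p.1 p.2)
  bdd : ∃ K, ∀ z R, r0 ≤ R → R ≤ r1 → |G z R| ≤ K ∧ |B1 z R| ≤ K ∧ |B2 z R| ≤ K ∧ |E z R| ≤ K
  Enn : ∀ z R, r0 ≤ R → R ≤ r1 → 0 ≤ E z R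
  step : ∀ z h R d, r0 ≤ R → 0 ≤ d → d ≤ γ^2 → R + d ≤ r1 →
    G z (R+d) + B1 z R * h + B2 z R * (h^2 - d) + (|B2 z R| * a + E z R * γ^ρ) * d - E z R * |h|^(2+ρ) ≤ G (z+h) R

lemma comp_meas (α : ℝ) {g : ℝ → ℝ} (hg : Measurable g) : Measurable (fun p : ℝ × ℝ => comp α g p.1 p.2) := by
  unfold comp
  have h2 : Measurable (fun p : ℝ × ℝ => p.1 / Real.sqrt p.2) := measurable_fst.div (Real.continuous_sqrt.measurable.comp measurable_snd)
  have h1 : Measurable (fun p : ℝ × ℝ => p.2^(-α/2)) := measurable_snd.pow_const _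
  exact h1.mul (hg.comp h2)

lemma comp_bdd {α C r0 z R : ℝ} {g : ℝ → ℝ} (ha : 0 ≤ α) (hr : 0 < r0) (hR : r0 ≤ R) (hg : ∀ y, |g y| ≤ C) :
    |comp α g z R| ≤ r0^(-α/2) * C := by
  unfold comp
  have hp : 0 ≤ R^(-α/2) := Real.rpow_nonneg (by linarith) _
  have : R^(-α/2) ≤ r0^(-α/2) := Real.rpow_le_rpow_of_nonpos hr hR (by linarith)
  rw [abs_mul, abs_of_nonneg hp]
  have := hg (z / Real.sqrt R)
  have := abs_nonneg (g (z / Real.sqrt R))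
  gcongr

lemma Nice.bd1 {α C : ℝ} {g0 g1 g2 g3 : ℝ → ℝ} (H : Nice α C g0 g1 g2 g3) (y : ℝ) : |g1 y| ≤ C := by
  have h1 := H.b1 y; have h2 := qq_le_one y; have := H.C_nonneg; nlinarith
lemma Nice.bd2 {α C : ℝ} {g0 g1 g2 g3 : ℝ → ℝ} (H : Nice α C g0 g1 g2 g3) (y : ℝ) : |g2 y| ≤ C := by
  have h1 := H.b2 y; have h2 := qq_le_one y; have := H.C_nonneg; nlinarith
lemma meas_of_deriv {g g' : ℝ → ℝ} (h : ∀ y, HasDerivAt g (g' y) y) : Measurable g :=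
  (continuous_iff_continuousAt.2 fun y => (h y).continuousAt).measurable

lemma comp_abs {α C z R : ℝ} {g : ℝ → ℝ} (hR : 0 < R) (hg : ∀ y, |g y| ≤ C * qq y) :
    |comp α g z R| ≤ C * comp α qq z R := by
  unfold comp
  have hp : 0 ≤ R^(-α/2) := Real.rpow_nonneg hR.le _
  rw [abs_mul, abs_of_nonneg hp]
  have := hg (z / Real.sqrt R)
  nlinarith

lemma qq_meas : Measurable qq := meas_of_deriv qq_deriv

/-- crude potential -/
lemma pot_crude {ρ γ a s c' ζ r1 : ℝ} (h0 : 0 < ρ) (h1 : ρ < 1) (hγ : 0 < γ) (ha : 0 ≤ a) (hs : 1 ≤ s) (hγs : γ ≤ s)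
    (hc : CG * a / s^3 + 40 * CG * (γ/s)^ρ / s^3 ≤ c') :
    Pot ρ γ a (s^2) r1 (fun z R => comp 1 ge (z - ζ) R - c' * (R - s^2))
      (fun z R => comp 1 (fun y => -(y * ge y)) (z-ζ) R / Real.sqrt R)
      (fun z R => (1/2) * (comp 1 (fun y => (y^2-1) * ge y) (z-ζ) R / R))
      (fun z R => 20 * CG * comp 1 qq (z-ζ) R / (Real.sqrt R)^(2+ρ)) := by
  have N := nice_gauss (α := 1) (by norm_num) le_rfl
  have hsh : Measurable (fun p : ℝ × ℝ => (p.1 - ζ, p.2)) := (measurable_fst.sub_const ζ).prodMk measurable_snd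
  have hsq : Measurable (fun p : ℝ × ℝ => Real.sqrt p.2) := Real.continuous_sqrt.measurable.comp measurable_snd
  have hs0 : 0 < s := by linarith
  have hs2 : 0 < s^2 := by positivity
  have hCG : 0 < CG := by norm_num [CG]
  have hR12 : ∀ R, s^2 ≤ R → R^(-1/2 : ℝ) ≤ 1/s := by
    intro R hR
    have : R^(-1/2:ℝ) = 1 / Real.sqrt R := by
      rw [Real.sqrt_eq_rpow, show (-1/2:ℝ) = -(1/2) by ring, Real.rpow_neg (by linarith)]; simp
    rw [this]
    apply one_div_le_one_div_of_le hs0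
    exact Real.le_sqrt_of_sq_le hR
  have hsqrt : ∀ R, s^2 ≤ R → s ≤ Real.sqrt R := fun R hR => Real.le_sqrt_of_sq_le hR
  refine ⟨?_, ?_, ?_, ?_, ?_, ?_, ?_⟩
  · exact ((comp_meas 1 (meas_of_deriv N.d0)).comp hsh).sub ((measurable_snd.sub_const _).const_mul _)
  · exact ((comp_meas 1 (meas_of_deriv N.d1)).comp hsh).div hsq
  · exact (((comp_meas 1 (meas_of_deriv N.d2)).comp hsh).div measurable_snd).const_mul _
  · exact (((comp_meas 1 qq_meas).comp hsh).const_mul _).div (hsq.pow_const _)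
  · refine ⟨20 * CG * (s^2)^(-1/2:ℝ) + |c'| * |r1| + 20*CG, fun z R hR hR1 => ?_⟩
    have hR0 : 0 < R := by linarith
    have hk : (s^2)^(-1/2:ℝ) ≤ 1 := (hR12 _ le_rfl).trans (by rw [div_le_one hs0]; exact hs)
    have hk0 : 0 ≤ (s^2)^(-1/2:ℝ) := by positivity
    have b0 := comp_bdd (z := z - ζ) (by norm_num : (0:ℝ) ≤ 1) hs2 hR N.b0
    have b1 := comp_bdd (z := z - ζ) (by norm_num : (0:ℝ) ≤ 1) hs2 hR N.bd1
    have b2 := comp_bdd (z := z - ζ) (by norm_num : (0:ℝ) ≤ 1) hs2 hR N.bd2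
    have b3 := comp_bdd (C := 1) (g := qq) (z := z - ζ) (by norm_num : (0:ℝ) ≤ 1) hs2 hR (fun y => by rw [abs_of_pos (qq_pos y)]; exact qq_le_one y)
    have hcr : 0 ≤ |c'| * |r1| := by positivity
    have hS1 : 1 ≤ Real.sqrt R := hs.trans (hsqrt R hR)
    have hR1' : 1 ≤ R := by nlinarith
    have hkC : (s^2)^(-1/2:ℝ) * CG ≤ CG := by nlinarith
    have hkC0 : 0 ≤ (s^2)^(-1/2:ℝ) * CG := by positivity
    refine ⟨?_, ?_, ?_, ?_⟩
    · refine (abs_sub _ _).trans ?_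
      have : |c' * (R - s^2)| ≤ |c'| * |r1| := by
        rw [abs_mul]
        gcongr
        · linarith
      linarith
    · rw [abs_div, abs_of_pos (by linarith : 0 < Real.sqrt R)]
      have := div_le_self (abs_nonneg (comp 1 (fun y => -(y * ge y)) (z - ζ) R)) hS1
      linarith
    · rw [abs_mul, abs_div _ R, abs_of_pos hR0]
      have := div_le_self (abs_nonneg (comp 1 (fun y => (y^2-1) * ge y) (z - ζ) R)) hR1'
      have : |(1/2:ℝ)| = 1/2 := by norm_num
      rw [this]
      linarith
    · have hp1 : 1 ≤ (Real.sqrt R)^(2+ρ) := Real.one_le_rpow hS1 (by linarith)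
      rw [abs_div, abs_of_pos (by linarith : 0 < (Real.sqrt R)^(2+ρ)), abs_mul, abs_of_pos (by positivity : 0 < 20*CG)]
      have := div_le_self (by positivity : 0 ≤ 20 * CG * |comp 1 qq (z - ζ) R|) hp1
      nlinarith
  · intro z R hR _
    have hR0 : 0 < R := by linarith
    unfold comp
    have := qq_pos ((z-ζ)/Real.sqrt R)
    positivity
  · intro z h R d hR hd hdγ hRd
    have hR0 : 0 < R := by linarith
    have hdR : d ≤ R := by nlinarith
    have os := one_step N (by norm_num) le_rfl h0 h1 (z-ζ) h hR0 hd hdR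
    have S0 : 0 < Real.sqrt R := Real.sqrt_pos.2 hR0
    rw [Real.div_rpow (abs_nonneg h) S0.le] at os
    have os' := (abs_le.1 os).1
    have e3 : comp 1 (fun y => 1 * ge y + y * (-(y * ge y))) (z-ζ) R = - comp 1 (fun y => (y^2-1)*ge y) (z-ζ) R := by
      unfold comp; ring
    rw [e3] at os'
    have e4 : z + h - ζ = z - ζ + h := by ring
    rw [e4]
    -- bounds
    have q1 : comp 1 qq (z-ζ) R ≤ 1/s := by
      unfold comp
      have h5 := hR12 R hR
      have h6 := qq_le_one ((z-ζ)/Real.sqrt R)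
      have h7 := qq_pos ((z-ζ)/Real.sqrt R)
      have : 0 ≤ R^(-1/2:ℝ) := by positivity
      nlinarith
    have q0 : 0 ≤ comp 1 qq (z-ζ) R := by
      unfold comp
      have h7 := qq_pos ((z-ζ)/Real.sqrt R)
      positivity
    have Sp : 0 < (Real.sqrt R)^(2+ρ) := by positivity
    have hb2 : |(1/2) * (comp 1 (fun y => (y^2-1) * ge y) (z-ζ) R / R)| ≤ CG / s^3 := by
      have := comp_abs (α := 1) (z := z - ζ) hR0 N.b2
      have h12 : |(1/2:ℝ)| = 1/2 := by norm_num
      rw [abs_mul, abs_div _ R, abs_of_pos hR0, h12]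
      calc 1/2 * (|comp 1 (fun y => (y^2-1) * ge y) (z-ζ) R| / R) ≤ 1/2 * ((CG * (1/s)) / s^2) := by
            gcongr
            exact this.trans (by gcongr)
        _ = 1/2 * (CG / s^3) := by field_simp
        _ ≤ _ := by
          have : 0 ≤ CG / s^3 := by positivity
          linarith
    have hE : 20 * CG * comp 1 qq (z-ζ) R / (Real.sqrt R)^(2+ρ) * γ^ρ ≤ 20 * CG * (γ/s)^ρ / s^3 := by
      have hle : s^(2+ρ) ≤ (Real.sqrt R)^(2+ρ) := Real.rpow_le_rpow hs0.le (hsqrt R hR) (by linarith)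
      have e5 : s^(2+ρ) = s^2 * s^ρ := by rw [Real.rpow_add hs0]; norm_num
      calc _ ≤ 20 * CG * (1/s) / s^(2+ρ) * γ^ρ := by gcongr
        _ = 20 * CG * (γ/s)^ρ / s^3 := by
          rw [e5, Real.div_rpow hγ.le hs0.le]; field_simp
    have hT : 20 * CG * comp 1 qq (z-ζ) R * (d/R)^2 ≤ 20 * CG * (γ/s)^ρ / s^3 * d := by
      have h8 : (d/R)^2 ≤ d * ((γ/s)^ρ / s^2) := by
        have h9 : γ/s ≤ 1 := by rw [div_le_one hs0]; exact hγs
        have h10 : (γ/s)^2 ≤ (γ/s)^ρ := by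
          have := Real.rpow_le_rpow_of_exponent_ge (by positivity : 0 < γ/s) h9 (by linarith : ρ ≤ 2)
          rwa [Real.rpow_two] at this
        calc (d/R)^2 = d * (d / R / R) := by field_simp
          _ ≤ d * (γ^2/s^2/s^2) := by gcongr
          _ = d * ((γ/s)^2/s^2) := by rw [div_pow]
          _ ≤ _ := by gcongr
      calc _ ≤ 20 * CG * (1/s) * (d * ((γ/s)^ρ / s^2)) := by gcongr
        _ = _ := by field_simp
    set b2 := (1/2) * (comp 1 (fun y => (y^2-1) * ge y) (z-ζ) R / R) with hb2d
    set Ee := 20 * CG * comp 1 qq (z-ζ) R / (Real.sqrt R)^(2+ρ) with hEe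
    have e6 : 20 * CG * comp 1 qq (z - ζ) R * (|h| ^ (2 + ρ) / √R ^ (2 + ρ) + (d / R) ^ 2) = Ee * |h|^(2+ρ) + 20 * CG * comp 1 qq (z-ζ) R * (d/R)^2 := by
      rw [hEe]; ring
    rw [e6] at os'
    have hfin : (|b2| * a + Ee * γ^ρ) * d + 20 * CG * (γ/s)^ρ / s^3 * d ≤ c' * d := by
      rw [← add_mul]
      apply mul_le_mul_of_nonneg_right _ hd
      have : |b2| * a ≤ CG * a / s^3 := by
        calc |b2| * a ≤ CG / s^3 * a := by gcongr
          _ = _ := by ring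
      have e7 : 40 * CG * (γ / s) ^ ρ / s ^ 3 = 20 * CG * (γ / s) ^ ρ / s ^ 3 + 20 * CG * (γ / s) ^ ρ / s ^ 3 := by ring
      linarith
    have e8 : h ^ 2 / 2 * (comp 1 (fun y => (y^2-1) * ge y) (z-ζ) R / R) = b2 * h^2 := by rw [hb2d]; ring
    have e9 : d * (1 / 2) * (-comp 1 (fun y => (y^2-1) * ge y) (z-ζ) R / R) = -(b2 * d) := by rw [hb2d]; ring
    rw [e8, e9] at os'
    have hT' := hT
    linarith

end SNM

namespace SNM

def CM : ℝ := CG + 100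

lemma Nice.mono {α C C' : ℝ} {g0 g1 g2 g3 : ℝ → ℝ} (H : Nice α C g0 g1 g2 g3) (h : C ≤ C') : Nice α C' g0 g1 g2 g3 := by
  have k : ∀ {x : ℝ} (y : ℝ), x ≤ C * qq y → x ≤ C' * qq y := by
    intro x y hx; have := qq_pos y; nlinarith
  exact ⟨H.d0, H.d1, H.d2, H.C_nonneg.trans h, fun y => (H.b0 y).trans h, fun y => k y (H.b0' y), fun y => k y (H.b1 y),
    fun y => k y (H.b2 y), fun y => k y (H.b3 y), fun y => k y (H.c1 y), fun y => k y (H.c2 y)⟩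

noncomputable def mm0 (ρ y : ℝ) : ℝ := ge y + kap ρ * qq y
noncomputable def mm1 (ρ y : ℝ) : ℝ := -(y * ge y) + kap ρ * (-(2*y*qq y^2))
noncomputable def mm2 (ρ y : ℝ) : ℝ := (y^2-1) * ge y + kap ρ * (6*qq y^2 - 8*qq y^3)
noncomputable def mm3 (ρ y : ℝ) : ℝ := (y*(3-y^2)) * ge y + kap ρ * ((12*qq y - 24*qq y^2) * (-(2*y*qq y^2)))

lemma nice_mm {ρ : ℝ} (h0 : 0 < ρ) (h1 : ρ < 1) : Nice ρ CM (mm0 ρ) (mm1 ρ) (mm2 ρ) (mm3 ρ) :=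
  (nice_gauss h0.le h1.le).lin (nice_qq h0.le h1.le) (kap_pos h1).le (kap_le h0 h1)

lemma CG_le_CM : CG ≤ CM := by unfold CM; linarith
lemma CM_pos : 0 < CM := by norm_num [CM, CG]

noncomputable def beG (ρ s Λ z R : ℝ) : ℝ := comp 0 stdNormalCDF z R - 2*s*comp 1 ge z R - Λ * comp ρ (mm0 ρ) z R
noncomputable def beB1 (ρ s Λ z R : ℝ) : ℝ := (comp 0 gphi z R - 2*s*comp 1 (fun y => -(y * ge y)) z R - Λ * comp ρ (mm1 ρ) z R) / Real.sqrt R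
noncomputable def beB2 (ρ s Λ z R : ℝ) : ℝ := (1/2)*((comp 0 (fun y => -(y * gphi y)) z R - 2*s*comp 1 (fun y => (y^2-1)*ge y) z R - Λ * comp ρ (mm2 ρ) z R) / R)
noncomputable def beT (ρ s Λ z R : ℝ) : ℝ := comp 0 qq z R + 2*s*comp 1 qq z R + Λ * comp ρ qq z R
noncomputable def beE (ρ s Λ z R : ℝ) : ℝ := 20 * CM * beT ρ s Λ z R / (Real.sqrt R)^(2+ρ)

lemma three_bd {s Λ a b c A B C : ℝ} (hs : 0 ≤ s) (hΛ : 0 ≤ Λ) (ha : |a| ≤ A) (hb : |b| ≤ B) (hc : |c| ≤ C) :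
    |a - 2*s*b - Λ*c| ≤ A + 2*s*B + Λ*C := by
  have e1 := abs_sub (a - 2*s*b) (Λ*c)
  have e2 := abs_sub a (2*s*b)
  rw [abs_mul Λ, abs_of_nonneg hΛ] at e1
  rw [abs_mul (2*s), abs_of_nonneg (by linarith : 0 ≤ 2*s)] at e2
  nlinarith [mul_le_mul_of_nonneg_left hb hs, mul_le_mul_of_nonneg_left hc hΛ]

set_option maxHeartbeats 1600000 in
lemma pot_be {ρ γ a s Λ : ℝ} (h0 : 0 < ρ) (h1 : ρ < 1) (hγ : 0 < γ) (ha : 0 ≤ a) (hs : 0 < s) (hγs : γ ≤ s)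
    (hsm : CM * (a/2 + 40*(γ/s)^ρ) ≤ kap ρ/8) (hΛ : 960 * CM / kap ρ * (a + γ^ρ) ≤ Λ) :
    Pot ρ γ a (s^2) 4 (beG ρ s Λ) (beB1 ρ s Λ) (beB2 ρ s Λ) (beE ρ s Λ) := by
  have N0 := nice_cdf.mono CG_le_CM
  have N1 := (nice_gauss (α := 1) (by norm_num) le_rfl).mono CG_le_CM
  have N2 := nice_mm h0 h1
  have hk := kap_pos h1
  have hCM := CM_pos
  have hsq : Measurable (fun p : ℝ × ℝ => Real.sqrt p.2) := Real.continuous_sqrt.measurable.comp measurable_snd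
  have hs2 : 0 < s^2 := by positivity
  have hγρ : 0 < γ^ρ := by positivity
  have hΛ0 : 0 ≤ Λ := le_trans (by positivity) hΛ
  have hsqrt : ∀ R, s^2 ≤ R → s ≤ Real.sqrt R := fun R hR => Real.le_sqrt_of_sq_le hR
  have qb : ∀ y, |qq y| ≤ 1 := fun y => by rw [abs_of_pos (qq_pos y)]; exact qq_le_one y
  have T0 : ∀ z R, s^2 ≤ R → 0 ≤ beT ρ s Λ z R := by
    intro z R hR
    have hR0 : 0 < R := by linarith
    unfold beT comp
    have := qq_pos (z/Real.sqrt R)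
    positivity
  refine ⟨?_, ?_, ?_, ?_, ?_, ?_, ?_⟩
  · exact ((comp_meas 0 (meas_of_deriv N0.d0)).sub ((comp_meas 1 (meas_of_deriv N1.d0)).const_mul _)).sub ((comp_meas ρ (meas_of_deriv N2.d0)).const_mul _)
  · exact (((comp_meas 0 (meas_of_deriv N0.d1)).sub ((comp_meas 1 (meas_of_deriv N1.d1)).const_mul _)).sub ((comp_meas ρ (meas_of_deriv N2.d1)).const_mul _)).div hsq
  · exact ((((comp_meas 0 (meas_of_deriv N0.d2)).sub ((comp_meas 1 (meas_of_deriv N1.d2)).const_mul _)).sub ((comp_meas ρ (meas_of_deriv N2.d2)).const_mul _)).div measurable_snd).const_mul _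
  · exact ((((comp_meas 0 qq_meas).add ((comp_meas 1 qq_meas).const_mul _)).add ((comp_meas ρ qq_meas).const_mul _)).const_mul _).div (hsq.pow_const _)
  · set Q := (s^2)^(-(0:ℝ)/2) + 2*s*(s^2)^(-(1:ℝ)/2) + Λ*(s^2)^(-ρ/2) with hQ
    have hQ0 : 0 ≤ Q := by positivity
    have hD : 0 < s ∧ 0 < s^2 ∧ 0 < s^(2+ρ) := ⟨hs, hs2, by positivity⟩
    refine ⟨CM*Q + CM*Q/s + CM*Q/s^2 + 20*CM*Q/s^(2+ρ), fun z R hR hR1 => ?_⟩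
    have hR0 : 0 < R := by linarith
    have S0 := hsqrt R hR
    have Spos : 0 < Real.sqrt R := by linarith
    have p1 : 0 ≤ CM*Q := by positivity
    have p2 : 0 ≤ CM*Q/s := by positivity
    have p3 : 0 ≤ CM*Q/s^2 := by positivity
    have p4 : 0 ≤ 20*CM*Q/s^(2+ρ) := by positivity
    have bb : ∀ {f g h : ℝ → ℝ} {K : ℝ}, (∀ y, |f y| ≤ K) → (∀ y, |g y| ≤ K) → (∀ y, |h y| ≤ K) →
        |comp 0 f z R - 2*s*comp 1 g z R - Λ*comp ρ h z R| ≤ K * Q := by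
      intro f g h K hf hg hh
      have := three_bd hs.le hΛ0 (comp_bdd (z := z) (α := 0) le_rfl hs2 hR hf) (comp_bdd (z := z) (α := 1) (by norm_num) hs2 hR hg)
        (comp_bdd (z := z) (α := ρ) h0.le hs2 hR hh)
      refine this.trans (le_of_eq ?_)
      rw [hQ]; ring
    have c0 := bb N0.b0 N1.b0 N2.b0
    have c1 := bb N0.bd1 N1.bd1 N2.bd1
    have c2 := bb N0.bd2 N1.bd2 N2.bd2
    refine ⟨?_, ?_, ?_, ?_⟩
    · unfold beG; linarith
    · unfold beB1
      rw [abs_div, abs_of_pos Spos]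
      have : |comp 0 gphi z R - 2*s*comp 1 (fun y => -(y * ge y)) z R - Λ * comp ρ (mm1 ρ) z R| / Real.sqrt R ≤ CM*Q/s := by
        gcongr
      linarith
    · unfold beB2
      have h12 : |(1/2:ℝ)| = 1/2 := by norm_num
      rw [abs_mul, abs_div _ R, abs_of_pos hR0, h12]
      have : |comp 0 (fun y => -(y * gphi y)) z R - 2*s*comp 1 (fun y => (y^2-1)*ge y) z R - Λ * comp ρ (mm2 ρ) z R| / R ≤ CM*Q/s^2 := by
        gcongr
      linarith
    · have hT : beT ρ s Λ z R ≤ Q := by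
        have a1 := comp_bdd (z := z) (α := 0) le_rfl hs2 hR qb
        have a2 := comp_bdd (z := z) (α := 1) (by norm_num) hs2 hR qb
        have a3 := comp_bdd (z := z) (α := ρ) h0.le hs2 hR qb
        have a1 := (le_abs_self _).trans a1
        have a2 := (le_abs_self _).trans a2
        have a3 := (le_abs_self _).trans a3
        rw [mul_one] at a1 a2 a3
        rw [hQ]; unfold beT
        gcongr
      have := T0 z R hR
      unfold beE
      rw [abs_of_nonneg (by positivity)]
      have : 20 * CM * beT ρ s Λ z R / (Real.sqrt R)^(2+ρ) ≤ 20*CM*Q/s^(2+ρ) := by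
        gcongr
      linarith
  · intro z R hR _
    have := T0 z R hR
    unfold beE
    positivity
  · intro z h R d hR hd hdγ hRd
    have hR0 : 0 < R := by linarith
    have hR4 : R ≤ 4 := by linarith
    have hdR : d ≤ R := by nlinarith
    have S0 : 0 < Real.sqrt R := Real.sqrt_pos.2 hR0
    have o0 := one_step N0 le_rfl (by norm_num) h0 h1 z h hR0 hd hdR
    have o1 := one_step N1 (by norm_num) le_rfl h0 h1 z h hR0 hd hdR
    have o2 := one_step N2 h0.le h1.le h0 h1 z h hR0 hd hdR
    rw [Real.div_rpow (abs_nonneg h) S0.le] at o0 o1 o2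
    have o0 := (abs_le.1 o0).1
    have o1 := (abs_le.1 o1).2
    have o2 := (abs_le.1 o2).2
    have e0 : comp 0 (fun y => 0 * stdNormalCDF y + y * gphi y) z R = - comp 0 (fun y => -(y*gphi y)) z R := by
      unfold comp; ring
    have e1 : comp 1 (fun y => 1 * ge y + y * (-(y * ge y))) z R = - comp 1 (fun y => (y^2-1)*ge y) z R := by
      unfold comp; ring
    have e2 : comp ρ (fun y => ρ * mm0 ρ y + y * mm1 ρ y) z R ≤ - comp ρ (mm2 ρ) z R - kap ρ/2 * comp ρ qq z R := by
      unfold comp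
      have hp : 0 ≤ R^(-ρ/2) := Real.rpow_nonneg hR0.le _
      have hsup := super h0 h1 (z/Real.sqrt R)
      have : (ρ * mm0 ρ (z/Real.sqrt R) + (z/Real.sqrt R) * mm1 ρ (z/Real.sqrt R)) ≤ - mm2 ρ (z/Real.sqrt R) - kap ρ/2 * qq (z/Real.sqrt R) := by
        unfold mm0 mm1 mm2; linarith
      nlinarith [mul_le_mul_of_nonneg_left this hp]
    rw [e0] at o0
    rw [e1] at o1
    set P := |h|^(2+ρ) / Real.sqrt R^(2+ρ) + (d/R)^2 with hP
    -- basic quantities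
    set q := qq (z/Real.sqrt R) with hq
    have hqpos : 0 < q := qq_pos _
    set u := R^(-ρ/2) with hu
    have hu0 : 0 < u := Real.rpow_pos_of_pos hR0 _
    have hu1 : 1/2 ≤ u := by
      have f1 : (4:ℝ)^(-ρ/2) ≤ u := Real.rpow_le_rpow_of_nonpos hR0 hR4 (by linarith)
      have f2 : (4:ℝ)^(-(1/2):ℝ) ≤ (4:ℝ)^(-ρ/2) := Real.rpow_le_rpow_of_exponent_le (by norm_num) (by linarith)
      have f3 : (4:ℝ)^(-(1/2):ℝ) = 1/2 := by
        rw [Real.rpow_neg (by norm_num), ← Real.sqrt_eq_rpow, show (4:ℝ) = 2^2 by norm_num, Real.sqrt_sq (by norm_num)]; norm_num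
      linarith
    have hSu : Real.sqrt R ^ ρ = u⁻¹ := by
      rw [hu, Real.sqrt_eq_rpow, ← Real.rpow_mul hR0.le, ← Real.rpow_neg hR0.le]; congr 1; ring
    have hS2 : Real.sqrt R ^ (2+ρ) = R * u⁻¹ := by
      rw [Real.rpow_add S0, hSu, Real.rpow_two, Real.sq_sqrt hR0.le]
    have hg : (γ/Real.sqrt R)^ρ = γ^ρ * u := by rw [Real.div_rpow hγ.le S0.le, hSu, div_inv_eq_mul]
    have hgle : γ^ρ * u ≤ (γ/s)^ρ := by
      rw [← hg]; have := hsqrt R hR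
      gcongr
    have hqρ : comp ρ qq z R = u * q := rfl
    have hTle : beT ρ s Λ z R ≤ q * (3 + Λ*u) := by
      unfold beT
      have t0 : comp 0 qq z R = q := by unfold comp; simp [hq]
      have t1 : s * comp 1 qq z R ≤ q := by
        unfold comp
        have : s * R^(-(1:ℝ)/2) ≤ 1 := by
          have : R^(-(1:ℝ)/2) = 1 / Real.sqrt R := by
            rw [Real.sqrt_eq_rpow, show (-1/2:ℝ) = -(1/2) by ring, Real.rpow_neg (by linarith)]; simp
          rw [this, mul_one_div, div_le_one S0]; exact hsqrt R hR
        calc s * (R^(-(1:ℝ)/2) * q) = s * R^(-(1:ℝ)/2) * q := by ring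
          _ ≤ 1 * q := by gcongr
          _ = q := one_mul q
      rw [t0, hqρ]
      linarith
    have hTnn := T0 z R hR
    have hB2 : |beB2 ρ s Λ z R| ≤ CM * beT ρ s Λ z R / R * (1/2) := by
      have a0 := comp_abs (α := 0) (z := z) hR0 N0.b2
      have a1 := comp_abs (α := 1) (z := z) hR0 N1.b2
      have a2 := comp_abs (α := ρ) (z := z) hR0 N2.b2
      have := three_bd hs.le hΛ0 a0 a1 a2
      unfold beB2
      have h12 : |(1/2:ℝ)| = 1/2 := by norm_num
      rw [abs_mul, abs_div _ R, abs_of_pos hR0, h12, mul_comm (1/2 : ℝ)]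
      gcongr
      unfold beT
      linarith
    have hEt : beE ρ s Λ z R * γ^ρ = CM * beT ρ s Λ z R / R * (20 * (γ^ρ*u)) := by
      unfold beE; rw [hS2]; field_simp
    have hTd : 20 * CM * beT ρ s Λ z R * (d/R)^2 ≤ CM * beT ρ s Λ z R / R * (20 * (γ^ρ*u)) * d := by
      have h9 : γ/Real.sqrt R ≤ 1 := by rw [div_le_one S0]; exact hγs.trans (hsqrt R hR)
      have h10 : γ^2/R ≤ γ^ρ * u := by
        have := Real.rpow_le_rpow_of_exponent_ge (by positivity : 0 < γ/Real.sqrt R) h9 (by linarith : ρ ≤ 2)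
        rw [Real.rpow_two, div_pow, Real.sq_sqrt hR0.le, hg] at this
        exact this
      have h11 : (d/R)^2 ≤ d / R * (γ^ρ*u) := by
        rw [sq]
        gcongr
        exact le_trans (by gcongr) h10
      calc _ ≤ 20 * CM * beT ρ s Λ z R * (d / R * (γ^ρ*u)) := by gcongr
        _ = _ := by ring
    have hmain : CM * beT ρ s Λ z R / R * (a/2 + 40 * (γ^ρ*u)) ≤ Λ * (kap ρ/4) * (u*q) / R := by
      rw [div_mul_eq_mul_div]
      gcongr ?_ / R
      have m1 : CM * (a/2 + 40*(γ^ρ*u)) ≤ kap ρ/8 := le_trans (by gcongr) hsm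
      have m2 : 3 * (CM * (a/2 + 40*(γ^ρ*u))) ≤ Λ * u * (kap ρ/8) := by
        have m3 : 960 * CM * (a + γ^ρ) ≤ Λ * kap ρ := by
          calc 960 * CM * (a + γ^ρ) = 960 * CM / kap ρ * (a + γ^ρ) * kap ρ := by field_simp
            _ ≤ _ := by gcongr
        have m4 : a/2 ≤ a * u := by nlinarith
        have m5 : a/2 + 40*(γ^ρ*u) ≤ 40 * ((a+γ^ρ)*u) := by nlinarith [mul_nonneg ha hu0.le]
        calc 3 * (CM * (a/2 + 40*(γ^ρ*u))) ≤ 3 * (CM * (40 * ((a+γ^ρ)*u))) := by gcongr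
          _ = (960 * CM * (a+γ^ρ)) * u / 8 := by ring
          _ ≤ (Λ * kap ρ) * u / 8 := by gcongr
          _ = _ := by ring
      have m6 : Λ * u * (CM * (a/2 + 40*(γ^ρ*u))) ≤ Λ * u * (kap ρ/8) := by gcongr
      calc CM * beT ρ s Λ z R * (a/2 + 40*(γ^ρ*u)) ≤ CM * (q * (3 + Λ*u)) * (a/2 + 40*(γ^ρ*u)) := by gcongr
        _ = q * (3 * (CM * (a/2 + 40*(γ^ρ*u))) + Λ * u * (CM * (a/2 + 40*(γ^ρ*u)))) := by ring
        _ ≤ q * (Λ * u * (kap ρ/8) + Λ * u * (kap ρ/8)) := by gcongr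
        _ = _ := by ring
    -- combine
    have hfin : (|beB2 ρ s Λ z R| * a + beE ρ s Λ z R * γ^ρ) * d + 20 * CM * beT ρ s Λ z R * (d/R)^2 ≤ Λ * (kap ρ/4) * (u*q) / R * d := by
      have : |beB2 ρ s Λ z R| * a ≤ CM * beT ρ s Λ z R / R * (1/2) * a := by gcongr
      calc _ ≤ (CM * beT ρ s Λ z R / R * (1/2) * a + CM * beT ρ s Λ z R / R * (20 * (γ^ρ*u))) * d + CM * beT ρ s Λ z R / R * (20 * (γ^ρ*u)) * d := by
            rw [hEt]; gcongr
        _ = CM * beT ρ s Λ z R / R * (a/2 + 40 * (γ^ρ*u)) * d := by ring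
        _ ≤ _ := by gcongr
    have hEP : 20 * CM * beT ρ s Λ z R * P = beE ρ s Λ z R * |h|^(2+ρ) + 20 * CM * beT ρ s Λ z R * (d/R)^2 := by
      rw [hP]; unfold beE; ring
    have o1' := mul_le_mul_of_nonneg_left o1 (by positivity : 0 ≤ 2*s)
    have o2' := mul_le_mul_of_nonneg_left o2 hΛ0
    have e2' : Λ * (d * (1/2) * (comp ρ (fun y => ρ * mm0 ρ y + y * mm1 ρ y) z R / R)) ≤ Λ * (d * (1/2) * ((- comp ρ (mm2 ρ) z R - kap ρ/2 * (u*q)) / R)) := by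
      rw [hqρ] at e2
      gcongr
    have hT3 : 20 * CM * comp 0 qq z R * P + 2*s*(20 * CM * comp 1 qq z R * P) + Λ*(20 * CM * comp ρ qq z R * P) = 20 * CM * beT ρ s Λ z R * P := by
      unfold beT; ring
    have e3 : beB2 ρ s Λ z R * (h^2 - d) = (h^2/2 * (comp 0 (fun y => -(y * gphi y)) z R / R) + d*(1/2)*(- comp 0 (fun y => -(y*gphi y)) z R / R))
       - 2*s*(h^2/2 * (comp 1 (fun y => (y^2-1)*ge y) z R / R) + d*(1/2)*(- comp 1 (fun y => (y^2-1)*ge y) z R / R))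
       - Λ*(h^2/2 * (comp ρ (mm2 ρ) z R/R)) - Λ * (d * (1/2) * ((- comp ρ (mm2 ρ) z R - kap ρ/2 * (u*q)) / R)) - Λ * (kap ρ/4) * (u*q) / R * d := by
      unfold beB2; ring
    have e4 : beB1 ρ s Λ z R * h = h * (comp 0 gphi z R / Real.sqrt R) - 2*s*(h * (comp 1 (fun y => -(y*ge y)) z R / Real.sqrt R)) - Λ * (h * (comp ρ (mm1 ρ) z R / Real.sqrt R)) := by
      unfold beB1; ring
    rw [e3, e4]
    unfold beG
    linarith

end SNM

namespace SNM

lemma pull {Ω : Type} {m mΩ : MeasurableSpace Ω} {P : Measure Ω} [IsProbabilityMeasure P] (hm : m ≤ mΩ) {u v : Ω → ℝ} {c : ℝ}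
    (hu : StronglyMeasurable[m] u) (hb : ∀ᵐ ω ∂P, |u ω| ≤ c) (hv : Integrable v P) :
    Integrable (fun ω => u ω * v ω) P ∧ Integrable (fun ω => u ω * (P[v|m]) ω) P ∧
      ∫ ω, u ω * v ω ∂P = ∫ ω, u ω * (P[v|m]) ω ∂P := by
  have hu' : AEStronglyMeasurable u P := (hu.mono hm).aestronglyMeasurable
  refine ⟨hv.bdd_mul hu' hb, integrable_condExp.bdd_mul hu' hb, ?_⟩
  have h1 := condExp_stronglyMeasurable_mul_of_bound hm hu hv c hb
  have h2 := integral_condExp (μ := P) (f := u * v) hm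
  rw [integral_congr_ae h1] at h2
  exact h2.symm

lemma integ4 {Ω : Type} [MeasurableSpace Ω] {P : Measure Ω} {f0 f1 f2 f3 : Ω → ℝ} (h0 : Integrable f0 P) (h1 : Integrable f1 P)
    (h2 : Integrable f2 P) (h3 : Integrable f3 P) :
    ∫ ω, (f0 ω + f1 ω + f2 ω - f3 ω) ∂P = ∫ ω, f0 ω ∂P + ∫ ω, f1 ω ∂P + ∫ ω, f2 ω ∂P - ∫ ω, f3 ω ∂P := by
  have a1 : Integrable (fun ω => f0 ω + f1 ω) P := h0.add h1
  have a2 : Integrable (fun ω => f0 ω + f1 ω + f2 ω) P := a1.add h2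
  rw [integral_sub a2 h3, integral_add a1 h2, integral_add h0 h1]

/-- Weighted (tilted) martingale system. -/
structure WSys {Ω : Type} [mΩ : MeasurableSpace Ω] (P : Measure Ω) (ρ γ a δ : ℝ) where
  n : ℕ
  F : ℕ → MeasurableSpace Ω
  F_mono : Monotone F
  F_le : ∀ i, F i ≤ mΩ
  w : ℕ → Ω → ℝ
  ξ : ℕ → Ω → ℝ
  d : ℕ → Ω → ℝ
  L : ℝ
  w_meas : ∀ i < n, StronglyMeasurable[F (i+1)] (w i)
  ξ_meas : ∀ i < n, StronglyMeasurable[F (i+1)] (ξ i)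
  d_meas : ∀ i < n, StronglyMeasurable[F i] (d i)
  w_nonneg : ∀ i < n, ∀ᵐ ω ∂P, 0 ≤ w i ω
  w_le : ∀ i < n, ∀ᵐ ω ∂P, w i ω ≤ L
  wξ_le : ∀ i < n, ∀ᵐ ω ∂P, w i ω * |ξ i ω|^3 ≤ L
  e0 : ∀ i < n, P[w i|F i] =ᵐ[P] 1
  e1 : ∀ i < n, P[fun ω => w i ω * ξ i ω|F i] =ᵐ[P] 0
  e2 : ∀ i < n, ∀ᵐ ω ∂P, |(P[fun ω => w i ω * ξ i ω^2|F i]) ω - d i ω| ≤ a * d i ω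
  e3 : ∀ i < n, ∀ᵐ ω ∂P, (P[fun ω => w i ω * |ξ i ω|^(2+ρ)|F i]) ω ≤ γ^ρ * d i ω
  d_nonneg : ∀ i < n, ∀ᵐ ω ∂P, 0 ≤ d i ω
  d_le : ∀ i < n, ∀ᵐ ω ∂P, d i ω ≤ γ^2
  ds : ∀ᵐ ω ∂P, |∑ i ∈ Finset.range n, d i ω - 1| ≤ δ^2

namespace WSys
variable {Ω : Type} [mΩ : MeasurableSpace Ω] {P : Measure Ω} {ρ γ a δ : ℝ}

noncomputable def M (A : WSys P ρ γ a δ) (k : ℕ) (ω : Ω) : ℝ := ∏ i ∈ Finset.range k, A.w i ω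
noncomputable def Z (A : WSys P ρ γ a δ) (k : ℕ) (ω : Ω) : ℝ := ∑ i ∈ Finset.range k, A.ξ i ω
noncomputable def D (A : WSys P ρ γ a δ) (k : ℕ) (ω : Ω) : ℝ := ∑ i ∈ Finset.range k, A.d i ω

lemma M_meas (A : WSys P ρ γ a δ) {k : ℕ} (hk : k ≤ A.n) : Measurable[A.F k] (A.M k) := by
  unfold M
  refine Finset.measurable_prod _ fun i hi => ?_
  have hi := Finset.mem_range.1 hi
  exact (A.w_meas i (by omega)).measurable.mono (A.F_mono (by omega)) le_rfl
lemma Z_meas (A : WSys P ρ γ a δ) {k : ℕ} (hk : k ≤ A.n) : Measurable[A.F k] (A.Z k) := by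
  unfold Z
  refine Finset.measurable_sum _ fun i hi => ?_
  have hi := Finset.mem_range.1 hi
  exact (A.ξ_meas i (by omega)).measurable.mono (A.F_mono (by omega)) le_rfl
lemma D_meas (A : WSys P ρ γ a δ) {k j : ℕ} (hk : k ≤ A.n) (hj : k ≤ j + 1) : Measurable[A.F j] (A.D k) := by
  unfold D
  refine Finset.measurable_sum _ fun i hi => ?_
  have hi := Finset.mem_range.1 hi
  exact (A.d_meas i (by omega)).measurable.mono (A.F_mono (by omega)) le_rfl

lemma M_nonneg (A : WSys P ρ γ a δ) {k : ℕ} (hk : k ≤ A.n) : ∀ᵐ ω ∂P, 0 ≤ A.M k ω := by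
  have : ∀ᵐ ω ∂P, ∀ i ∈ Finset.range k, 0 ≤ A.w i ω := by
    rw [Finset.eventually_all]
    intro i hi
    exact A.w_nonneg i (by have := Finset.mem_range.1 hi; omega)
  filter_upwards [this] with ω h
  exact Finset.prod_nonneg h

lemma M_le (A : WSys P ρ γ a δ) {k : ℕ} (hk : k ≤ A.n) : ∀ᵐ ω ∂P, A.M k ω ≤ A.L^k := by
  have : ∀ᵐ ω ∂P, ∀ i ∈ Finset.range k, 0 ≤ A.w i ω ∧ A.w i ω ≤ A.L := by
    rw [Finset.eventually_all]
    intro i hi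
    exact (A.w_nonneg i (by have := Finset.mem_range.1 hi; omega)).and (A.w_le i (by have := Finset.mem_range.1 hi; omega))
  filter_upwards [this] with ω h
  have := Finset.prod_le_prod (fun i hi => (h i hi).1) (fun i hi => (h i hi).2)
  rw [Finset.prod_const, Finset.card_range] at this
  exact this

lemma D_le (A : WSys P ρ γ a δ) {k : ℕ} (hk : k ≤ A.n) : ∀ᵐ ω ∂P, 0 ≤ A.D k ω ∧ A.D k ω ≤ 1 + δ^2 := by
  have : ∀ᵐ ω ∂P, ∀ i ∈ Finset.range A.n, 0 ≤ A.d i ω := by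
    rw [Finset.eventually_all]
    intro i hi
    exact A.d_nonneg i (by have := Finset.mem_range.1 hi; omega)
  filter_upwards [this, A.ds] with ω h hd
  have hsub : Finset.range k ⊆ Finset.range A.n := Finset.range_mono hk
  refine ⟨Finset.sum_nonneg fun i hi => h i (hsub hi), ?_⟩
  have : A.D k ω ≤ ∑ i ∈ Finset.range A.n, A.d i ω := Finset.sum_le_sum_of_subset_of_nonneg hsub (fun i hi _ => h i hi)
  have := (abs_le.1 hd).2
  linarith

lemma L_nonneg [IsProbabilityMeasure P] (A : WSys P ρ γ a δ) {i : ℕ} (hi : i < A.n) : 0 ≤ A.L := by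
  obtain ⟨ω, h1, h2⟩ := ((A.w_nonneg i hi).and (A.w_le i hi)).exists
  linarith

lemma pw_int [IsProbabilityMeasure P] (A : WSys P ρ γ a δ) {i : ℕ} (hi : i < A.n) {f : ℝ → ℝ} (hf : Measurable f) (hb : ∀ x, |f x| ≤ 1 + |x|^3) :
    Integrable (fun ω => A.w i ω * f (A.ξ i ω)) P := by
  have hw := (A.w_meas i hi).measurable.mono (A.F_le (i+1)) le_rfl
  have hx := (A.ξ_meas i hi).measurable.mono (A.F_le (i+1)) le_rfl
  refine Integrable.of_bound (hw.mul (hf.comp hx)).aestronglyMeasurable (A.L + A.L) ?_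
  filter_upwards [A.w_nonneg i hi, A.w_le i hi, A.wξ_le i hi] with ω h1 h2 h3
  rw [Real.norm_eq_abs, abs_mul, abs_of_nonneg h1]
  nlinarith [hb (A.ξ i ω)]

lemma w_int [IsProbabilityMeasure P] (A : WSys P ρ γ a δ) {i : ℕ} (hi : i < A.n) : Integrable (A.w i) P := by
  have := A.pw_int hi (f := fun _ => 1) measurable_const (fun x => by rw [abs_one]; have : 0 ≤ |x|^3 := by positivity
                                                                      linarith)
  simpa using this
lemma w1_int [IsProbabilityMeasure P] (A : WSys P ρ γ a δ) {i : ℕ} (hi : i < A.n) : Integrable (fun ω => A.w i ω * A.ξ i ω) P := by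
  refine A.pw_int hi (f := fun x => x) measurable_id (fun x => ?_)
  rcases le_total |x| 1 with h | h
  · have : 0 ≤ |x|^3 := by positivity
    linarith
  · have := le_self_pow₀ h (by norm_num : 3 ≠ 0); linarith
lemma w2_int [IsProbabilityMeasure P] (A : WSys P ρ γ a δ) {i : ℕ} (hi : i < A.n) : Integrable (fun ω => A.w i ω * A.ξ i ω^2) P := by
  refine A.pw_int hi (f := fun x => x^2) (by fun_prop) (fun x => ?_)
  rw [abs_pow]
  rcases le_total |x| 1 with h | h
  · have : 0 ≤ |x|^3 := by positivity
    have := pow_le_one₀ (abs_nonneg x) h (n := 2); linarith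
  · have := pow_le_pow_right₀ h (by norm_num : 2 ≤ 3); linarith
lemma w3_int [IsProbabilityMeasure P] (A : WSys P ρ γ a δ) (h0 : 0 < ρ) (h1 : ρ < 1) {i : ℕ} (hi : i < A.n) : Integrable (fun ω => A.w i ω * |A.ξ i ω|^(2+ρ)) P := by
  refine A.pw_int hi (f := fun x => |x|^(2+ρ)) (by fun_prop) (fun x => ?_)
  rw [abs_of_nonneg (by positivity)]
  rcases le_total |x| 1 with h | h
  · have : 0 ≤ |x|^3 := by positivity
    have := Real.rpow_le_one (abs_nonneg x) h (by linarith : 0 ≤ 2+ρ); linarith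
  · have := Real.rpow_le_rpow_of_exponent_le h (by push_cast; linarith : 2 + ρ ≤ ((3:ℕ):ℝ))
    rw [Real.rpow_natCast] at this
    linarith

variable [IsProbabilityMeasure P]

set_option maxHeartbeats 800000 in
lemma propagate (A : WSys P ρ γ a δ) (h0 : 0 < ρ) (h1 : ρ < 1) (hγ : 0 < γ) (ha : 0 ≤ a) {r0 r1 : ℝ} {G B1 B2 E : ℝ → ℝ → ℝ}
    (H : Pot ρ γ a r0 r1 G B1 B2 E) (hr : r0 + 1 + δ^2 ≤ r1) (t : ℝ) (k : ℕ) (hk : k ≤ A.n) :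
    G (-t) (r0 + 1 + δ^2) ≤ ∫ ω, A.M k ω * G (A.Z k ω - t) (r0 + 1 + δ^2 - A.D k ω) ∂P := by
  induction k with
  | zero => simp [M, Z, D]
  | succ k ih =>
    have hkn : k < A.n := by omega
    have hk' : k ≤ A.n := by omega
    refine (ih hk').trans ?_
    obtain ⟨K, hK⟩ := H.bdd
    have hL := A.L_nonneg hkn
    have hF := A.F_le k
    set R1 : Ω → ℝ := fun ω => r0 + 1 + δ^2 - A.D (k+1) ω with hR1
    set R0 : Ω → ℝ := fun ω => r0 + 1 + δ^2 - A.D k ω with hR0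
    have mM := A.M_meas hk'
    have mZ : Measurable[A.F k] (fun ω => A.Z k ω - t) := (A.Z_meas hk').sub_const t
    have mR0 : Measurable[A.F k] R0 := (A.D_meas hk' (by omega)).const_sub _
    have mR1 : Measurable[A.F k] R1 := (A.D_meas hk (by omega)).const_sub _
    have md : Measurable[A.F k] (A.d k) := (A.d_meas k hkn).measurable
    set uG : Ω → ℝ := fun ω => A.M k ω * G (A.Z k ω - t) (R0 ω) with huG
    set u1 : Ω → ℝ := fun ω => A.M k ω * B1 (A.Z k ω - t) (R1 ω) with hu1
    set u2 : Ω → ℝ := fun ω => A.M k ω * B2 (A.Z k ω - t) (R1 ω) with hu2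
    set uE : Ω → ℝ := fun ω => A.M k ω * E (A.Z k ω - t) (R1 ω) with huE
    have muG : Measurable[A.F k] uG := mM.mul (H.mG.comp (mZ.prodMk mR0))
    have mu1 : Measurable[A.F k] u1 := mM.mul (H.mB1.comp (mZ.prodMk mR1))
    have mu2 : Measurable[A.F k] u2 := mM.mul (H.mB2.comp (mZ.prodMk mR1))
    have muE : Measurable[A.F k] uE := mM.mul (H.mE.comp (mZ.prodMk mR1))
    set cW : Ω → ℝ := fun ω => uG ω - u2 ω * A.d k ω + (|u2 ω| * a + uE ω * γ^ρ) * A.d k ω with hcW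
    have mcW : Measurable[A.F k] cW := by
      have m3 : Measurable[A.F k] (fun ω => |u2 ω|) := measurable_norm.comp mu2
      exact (muG.sub (mu2.mul md)).add (((m3.mul_const a).add (muE.mul_const _)).mul md)
    -- a.e. range
    have hrange : ∀ᵐ ω ∂P, (r0 ≤ R0 ω ∧ R0 ω ≤ r1) ∧ (r0 ≤ R1 ω ∧ R1 ω ≤ r1) := by
      filter_upwards [A.D_le hk', A.D_le hk] with ω h2 h3
      simp only [hR0, hR1]
      refine ⟨⟨?_, ?_⟩, ?_, ?_⟩ <;> linarith [h2.1, h2.2, h3.1, h3.2]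
    have hKnn : 0 ≤ K := by
      obtain ⟨ω, h⟩ := hrange.exists
      exact (abs_nonneg _).trans (hK 0 _ h.1.1 h.1.2).1
    set K' := A.L^k * K with hK'
    have hbd : ∀ᵐ ω ∂P, |uG ω| ≤ K' ∧ |u1 ω| ≤ K' ∧ |u2 ω| ≤ K' ∧ |uE ω| ≤ K' := by
      filter_upwards [hrange, A.M_nonneg hk', A.M_le hk'] with ω h2 h3 h4
      have p := hK (A.Z k ω - t) (R0 ω) h2.1.1 h2.1.2
      have q := hK (A.Z k ω - t) (R1 ω) h2.2.1 h2.2.2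
      have key : ∀ x, |x| ≤ K → |A.M k ω * x| ≤ K' := by
        intro x hx
        rw [abs_mul, abs_of_nonneg h3]
        have := abs_nonneg x
        rw [hK']; gcongr
      exact ⟨key _ p.1, key _ q.2.1, key _ q.2.2.1, key _ q.2.2.2⟩
    have hcWb : ∀ᵐ ω ∂P, |cW ω| ≤ K' + K'*γ^2 + (K'*a + K'*γ^ρ)*γ^2 := by
      filter_upwards [hbd, A.d_nonneg k hkn, A.d_le k hkn] with ω h2 h3 h4
      have hK'0 : 0 ≤ K' := (abs_nonneg _).trans h2.1
      have s1 : |u2 ω * A.d k ω| ≤ K' * γ^2 := by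
        rw [abs_mul, abs_of_nonneg h3]
        have := h2.2.2.1
        gcongr
      have s2 : |(|u2 ω| * a + uE ω * γ^ρ) * A.d k ω| ≤ (K'*a + K'*γ^ρ)*γ^2 := by
        rw [abs_mul, abs_of_nonneg h3]
        have hγρ : 0 ≤ γ^ρ := by positivity
        have : |(|u2 ω| * a + uE ω * γ^ρ)| ≤ K'*a + K'*γ^ρ := by
          refine (abs_add_le _ _).trans ?_
          rw [abs_mul _ a, abs_mul _ (γ^ρ), abs_abs, abs_of_nonneg ha, abs_of_nonneg hγρ]
          have := h2.2.2.1
          have := h2.2.2.2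
          gcongr
        gcongr
      have s3 := abs_add_le (uG ω - u2 ω * A.d k ω) ((|u2 ω| * a + uE ω * γ^ρ) * A.d k ω)
      have s4 := abs_sub (uG ω) (u2 ω * A.d k ω)
      simp only [hcW]
      linarith [h2.1]
    obtain ⟨i0, j0, q0⟩ := pull hF mcW.stronglyMeasurable hcWb (A.w_int hkn)
    obtain ⟨i1, j1, q1⟩ := pull hF mu1.stronglyMeasurable (hbd.mono fun ω h => h.2.1) (A.w1_int hkn)
    obtain ⟨i2, j2, q2⟩ := pull hF mu2.stronglyMeasurable (hbd.mono fun ω h => h.2.2.1) (A.w2_int hkn)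
    obtain ⟨i3, j3, q3⟩ := pull hF muE.stronglyMeasurable (hbd.mono fun ω h => h.2.2.2) (A.w3_int h0 h1 hkn)
    have eqI : ∫ ω, (cW ω * A.w k ω + u1 ω * (A.w k ω * A.ξ k ω) + u2 ω * (A.w k ω * A.ξ k ω^2) - uE ω * (A.w k ω * |A.ξ k ω|^(2+ρ))) ∂P
      = ∫ ω, (cW ω * (P[A.w k|A.F k]) ω + u1 ω * (P[fun ω => A.w k ω * A.ξ k ω|A.F k]) ω + u2 ω * (P[fun ω => A.w k ω * A.ξ k ω^2|A.F k]) ω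
          - uE ω * (P[fun ω => A.w k ω * |A.ξ k ω|^(2+ρ)|A.F k]) ω) ∂P := by
      rw [integ4 i0 i1 i2 i3, integ4 j0 j1 j2 j3, q0, q1, q2, q3]
    have iG : Integrable uG P := Integrable.of_bound (muG.mono hF le_rfl).aestronglyMeasurable K' (hbd.mono fun ω h => h.1)
    have lower : ∫ ω, uG ω ∂P ≤ ∫ ω, (cW ω * (P[A.w k|A.F k]) ω + u1 ω * (P[fun ω => A.w k ω * A.ξ k ω|A.F k]) ω + u2 ω * (P[fun ω => A.w k ω * A.ξ k ω^2|A.F k]) ω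
          - uE ω * (P[fun ω => A.w k ω * |A.ξ k ω|^(2+ρ)|A.F k]) ω) ∂P := by
      refine integral_mono_ae iG (((j0.add j1).add j2).sub j3) ?_
      filter_upwards [A.e0 k hkn, A.e1 k hkn, A.e2 k hkn, A.e3 k hkn, A.M_nonneg hk', hrange] with ω f0 f1 f2 f3 f4 f5
      rw [f0, f1]
      simp only [Pi.one_apply, Pi.zero_apply, hcW]
      have uEn : 0 ≤ uE ω := mul_nonneg f4 (H.Enn _ _ f5.2.1 f5.2.2)
      have g1 := mul_le_mul_of_nonneg_left f3 uEn
      have g2 : -(|u2 ω| * (a * A.d k ω)) ≤ u2 ω * ((P[fun ω => A.w k ω * A.ξ k ω^2|A.F k]) ω - A.d k ω) := by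
        have := neg_abs_le (u2 ω * ((P[fun ω => A.w k ω * A.ξ k ω^2|A.F k]) ω - A.d k ω))
        rw [abs_mul] at this
        have := mul_le_mul_of_nonneg_left f2 (abs_nonneg (u2 ω))
        linarith
      linarith
    refine lower.trans ?_
    rw [← eqI]
    have mG' : Measurable (fun ω => A.M (k+1) ω * G (A.Z (k+1) ω - t) (R1 ω)) := by
      have a1 := (A.M_meas hk).mono (A.F_le (k+1)) le_rfl
      have a2 := ((A.Z_meas hk).mono (A.F_le (k+1)) le_rfl).sub_const t
      have a3 := mR1.mono (A.F_le k) le_rfl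
      exact a1.mul (H.mG.comp (a2.prodMk a3))
    have iG' : Integrable (fun ω => A.M (k+1) ω * G (A.Z (k+1) ω - t) (R1 ω)) P := by
      refine Integrable.of_bound mG'.aestronglyMeasurable (A.L^(k+1) * K) ?_
      filter_upwards [A.M_nonneg hk, A.M_le hk, hrange] with ω f1 f2 f3
      rw [Real.norm_eq_abs, abs_mul, abs_of_nonneg f1]
      have := (hK (A.Z (k+1) ω - t) (R1 ω) f3.2.1 f3.2.2).1
      gcongr
    refine integral_mono_ae (((i0.add i1).add i2).sub i3) iG' ?_
    filter_upwards [A.M_nonneg hk', A.w_nonneg k hkn, hrange, A.d_nonneg k hkn, A.d_le k hkn] with ω f1 f2 f3 f4 f5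
    have eM : A.M (k+1) ω = A.M k ω * A.w k ω := Finset.prod_range_succ _ _
    have eZ : A.Z (k+1) ω - t = (A.Z k ω - t) + A.ξ k ω := by
      unfold Z; rw [Finset.sum_range_succ]; ring
    have eR : R0 ω = R1 ω + A.d k ω := by
      simp only [hR0, hR1]; unfold D; rw [Finset.sum_range_succ]; ring
    have st := H.step (A.Z k ω - t) (A.ξ k ω) (R1 ω) (A.d k ω) f3.2.1 f4 f5 (by rw [← eR]; exact f3.1.2)
    rw [← eR] at st
    have st' := mul_le_mul_of_nonneg_left st (mul_nonneg f1 f2)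
    have habs : |u2 ω| = A.M k ω * |B2 (A.Z k ω - t) (R1 ω)| := by
      simp only [hu2]; rw [abs_mul, abs_of_nonneg f1]
    rw [eM, eZ]
    refine le_trans (le_of_eq ?_) st'
    simp only [hcW]
    rw [habs]
    simp only [huG, hu1, hu2, huE]
    ring

end WSys
end SNM

namespace SNM
namespace WSys
variable {Ω : Type} [mΩ : MeasurableSpace Ω] {P : Measure Ω} {ρ γ a δ : ℝ} [IsProbabilityMeasure P]

lemma M_aem (A : WSys P ρ γ a δ) : Measurable (A.M A.n) := (A.M_meas le_rfl).mono (A.F_le _) le_rfl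
lemma Z_aem (A : WSys P ρ γ a δ) : Measurable (A.Z A.n) := (A.Z_meas le_rfl).mono (A.F_le _) le_rfl

lemma M_intble (A : WSys P ρ γ a δ) {f : Ω → ℝ} (hf : Measurable f) {K : ℝ} (hb : ∀ᵐ ω ∂P, |f ω| ≤ K) :
    Integrable (fun ω => A.M A.n ω * f ω) P := by
  refine Integrable.of_bound (A.M_aem.mul hf).aestronglyMeasurable (A.L^A.n * K) ?_
  filter_upwards [A.M_nonneg le_rfl, A.M_le le_rfl, hb] with ω h1 h2 h3
  rw [Real.norm_eq_abs, abs_mul, abs_of_nonneg h1]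
  gcongr
  exact h1.trans h2

/-- tilted law of the terminal value -/
noncomputable def law (A : WSys P ρ γ a δ) : Measure ℝ :=
  (P.withDensity (fun ω => ENNReal.ofReal (A.M A.n ω))).map (A.Z A.n)

lemma law_integral (A : WSys P ρ γ a δ) {f : ℝ → ℝ} (hf : Measurable f) :
    ∫ z, f z ∂A.law = ∫ ω, A.M A.n ω * f (A.Z A.n ω) ∂P := by
  unfold law
  rw [integral_map A.Z_aem.aemeasurable hf.aestronglyMeasurable,
    integral_withDensity_eq_integral_toReal_smul₀ (A.M_aem.ennreal_ofReal.aemeasurable) (Eventually.of_forall fun _ => ENNReal.ofReal_lt_top)]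
  refine integral_congr_ae ?_
  filter_upwards [A.M_nonneg le_rfl] with ω h
  rw [ENNReal.toReal_ofReal h, smul_eq_mul]

lemma pot_const (c r0 r1 : ℝ) : Pot ρ γ a r0 r1 (fun _ _ => c) (fun _ _ => 0) (fun _ _ => 0) (fun _ _ => 0) where
  mG := measurable_const
  mB1 := measurable_const
  mB2 := measurable_const
  mE := measurable_const
  bdd := ⟨|c|, fun z R _ _ => by simp⟩
  Enn := by simp
  step := by simp

lemma M_total (A : WSys P ρ γ a δ) (h0 : 0 < ρ) (h1 : ρ < 1) (hγ : 0 < γ) (ha : 0 ≤ a) : ∫ ω, A.M A.n ω ∂P = 1 := by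
  have p := A.propagate h0 h1 hγ ha (pot_const 1 1 (1+1+δ^2)) le_rfl 0 A.n le_rfl
  have q := A.propagate h0 h1 hγ ha (pot_const (-1) 1 (1+1+δ^2)) le_rfl 0 A.n le_rfl
  simp only [mul_one, mul_neg, integral_neg] at p q
  linarith

lemma law_prob (A : WSys P ρ γ a δ) (h0 : 0 < ρ) (h1 : ρ < 1) (hγ : 0 < γ) (ha : 0 ≤ a) : IsProbabilityMeasure A.law := by
  have : IsProbabilityMeasure (P.withDensity (fun ω => ENNReal.ofReal (A.M A.n ω))) := by
    refine ⟨?_⟩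
    rw [withDensity_apply _ MeasurableSet.univ, Measure.restrict_univ, ← ofReal_integral_eq_lintegral_ofReal, A.M_total h0 h1 hγ ha]
    · simp
    · have := A.M_intble (f := fun _ => 1) measurable_const (K := 1) (by simp)
      simpa using this
    · exact A.M_nonneg le_rfl
  exact Measure.isProbabilityMeasure_map A.Z_aem.aemeasurable

lemma law_real (A : WSys P ρ γ a δ) {s : Set ℝ} (hs : MeasurableSet s) :
    A.law.real s = ∫ ω, A.M A.n ω * s.indicator 1 (A.Z A.n ω) ∂P := by
  rw [← A.law_integral (measurable_one.indicator hs), integral_indicator_one hs]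

lemma ind_bd (s : Set ℝ) (z : ℝ) : |s.indicator (1 : ℝ → ℝ) z| ≤ 1 := by
  by_cases h : z ∈ s <;> simp [h]

lemma law_ge (A : WSys P ρ γ a δ) (h0 : 0 < ρ) (h1 : ρ < 1) (hγ : 0 < γ) (ha : 0 ≤ a) {r0 r1 : ℝ} {G B1 B2 E : ℝ → ℝ → ℝ}
    (H : Pot ρ γ a r0 r1 G B1 B2 E) (hr : r0 + 1 + δ^2 ≤ r1) (t : ℝ) {s : Set ℝ} (hs : MeasurableSet s) {b K : ℝ}
    (hb : ∀ z R, r0 ≤ R → R ≤ r0 + 2*δ^2 → G (z - t) R ≤ b + K * s.indicator 1 z) :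
    G (-t) (r0 + 1 + δ^2) - b ≤ K * A.law.real s := by
  have p := A.propagate h0 h1 hγ ha H hr t A.n le_rfl
  have mi : Measurable (fun ω => s.indicator (1 : ℝ → ℝ) (A.Z A.n ω)) := (measurable_one.indicator hs).comp A.Z_aem
  have i1 : Integrable (fun ω => A.M A.n ω * (b + K * s.indicator 1 (A.Z A.n ω))) P := by
    refine A.M_intble (measurable_const.add (mi.const_mul K)) (K := |b| + |K|) (Eventually.of_forall fun ω => ?_)
    refine (abs_add_le _ _).trans ?_
    rw [abs_mul]
    have := ind_bd s (A.Z A.n ω)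
    nlinarith [abs_nonneg K]
  have hD : Measurable (A.D A.n) := (A.D_meas (j := A.n) le_rfl (by omega)).mono (A.F_le _) le_rfl
  have hrange : ∀ᵐ ω ∂P, r0 ≤ r0 + 1 + δ^2 - A.D A.n ω ∧ r0 + 1 + δ^2 - A.D A.n ω ≤ r0 + 2*δ^2 := by
    filter_upwards [A.ds] with ω h
    have := abs_le.1 h
    unfold D
    constructor <;> linarith
  obtain ⟨K', hK'⟩ := H.bdd
  have hDle := A.D_le le_rfl
  have i2 : Integrable (fun ω => A.M A.n ω * G (A.Z A.n ω - t) (r0 + 1 + δ^2 - A.D A.n ω)) P := by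
    refine A.M_intble (H.mG.comp ((A.Z_aem.sub_const t).prodMk (hD.const_sub _))) (K := K') ?_
    filter_upwards [hrange, hDle] with ω h h'
    exact (hK' _ _ h.1 (by linarith [h'.1])).1
  have le := integral_mono_ae i2 i1 (by
    filter_upwards [hrange, A.M_nonneg le_rfl] with ω h h2
    exact mul_le_mul_of_nonneg_left (hb _ _ h.1 h.2) h2)
  have e : ∫ ω, A.M A.n ω * (b + K * s.indicator 1 (A.Z A.n ω)) ∂P = b + K * A.law.real s := by
    rw [A.law_real hs, ← integral_const_mul]
    have e1 : b = ∫ ω, A.M A.n ω * b ∂P := by rw [integral_mul_const, A.M_total h0 h1 hγ ha, one_mul]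
    nth_rewrite 2 [e1]
    have j1 : Integrable (fun ω => A.M A.n ω * b) P := A.M_intble (K := |b|) measurable_const (by simp)
    have j2 : Integrable (fun ω => K * (A.M A.n ω * s.indicator 1 (A.Z A.n ω))) P :=
      (A.M_intble (K := 1) mi (Eventually.of_forall fun ω => ind_bd _ _)).const_mul K
    rw [← integral_add j1 j2]
    congr 1; funext ω; ring
  rw [e] at le
  linarith

/-- Negated system -/
noncomputable def neg (A : WSys P ρ γ a δ) : WSys P ρ γ a δ where
  n := A.n
  F := A.F
  F_mono := A.F_mono
  F_le := A.F_le
  w := A.w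
  ξ := fun i ω => - A.ξ i ω
  d := A.d
  L := A.L
  w_meas := A.w_meas
  ξ_meas := fun i hi => (A.ξ_meas i hi).neg
  d_meas := A.d_meas
  w_nonneg := A.w_nonneg
  w_le := A.w_le
  wξ_le := by simpa using A.wξ_le
  e0 := A.e0
  e1 := fun i hi => by
    have h := condExp_neg (μ := P) (fun ω => A.w i ω * A.ξ i ω) (A.F i)
    have e : (fun ω => A.w i ω * -A.ξ i ω) = -(fun ω => A.w i ω * A.ξ i ω) := by funext ω; simp
    rw [e]
    filter_upwards [h, A.e1 i hi] with ω h1 h2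
    rw [h1, Pi.neg_apply, h2]; simp
  e2 := by simpa using A.e2
  e3 := by simpa using A.e3
  d_nonneg := A.d_nonneg
  d_le := A.d_le
  ds := A.ds

lemma neg_law (A : WSys P ρ γ a δ) (t : ℝ) : A.neg.law.real (Set.Ici (-t)) = A.law.real (Set.Iic t) := by
  rw [law_real _ measurableSet_Ici, law_real _ measurableSet_Iic]
  congr 1
  funext ω
  have e1 : A.neg.M A.neg.n ω = A.M A.n ω := rfl
  have e2 : A.neg.Z A.neg.n ω = - A.Z A.n ω := by
    unfold Z neg; simp
  rw [e1, e2]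
  congr 1
  simp only [Set.indicator, Set.mem_Ici, Set.mem_Iic, neg_le_neg_iff, Pi.one_apply]

end WSys

lemma cdf_scale (z : ℝ) {R : ℝ} (hR : 1 ≤ R) : |comp 0 stdNormalCDF z R - stdNormalCDF z| ≤ CG * (R - 1) := by
  have := mvt (f := fun r => comp 0 stdNormalCDF z r) (f' := fun r => -(1/2) * comp (0+2) (fun y => 0 * stdNormalCDF y + y * gphi y) z r)
    (a := 1) (b := R) (K := CG)
    (fun x hx => by
      rw [Set.uIcc_of_le hR] at hx
      exact comp_deriv 0 nice_cdf.d0 z (by linarith [hx.1]))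
    (fun x hx => by
      rw [Set.uIcc_of_le hR] at hx
      have h2 := comp_bdd (z := z) (α := 0+2) (r0 := 1) (R := x) (C := CG) (g := (fun y => 0 * stdNormalCDF y + y * gphi y)) (by norm_num) one_pos hx.1 (fun y => by
        simp only [zero_mul, zero_add]
        have h1 := nice_cdf.c1 y; have h2 := qq_le_one y; have := nice_cdf.C_nonneg; nlinarith)
      rw [Real.one_rpow, one_mul] at h2
      rw [abs_mul]
      have : |(-(1/2):ℝ)| = 1/2 := by rw [abs_neg]; norm_num
      rw [this]
      have hCG0 : 0 < CG := by norm_num [CG]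
      refine (mul_le_mul_of_nonneg_left h2 (by norm_num)).trans ?_
      linarith)
  rw [abs_of_nonneg (by linarith : 0 ≤ R - 1)] at this
  have e : comp 0 stdNormalCDF z 1 = stdNormalCDF z := by unfold comp; simp
  simpa only [e] using this

set_option maxHeartbeats 1600000 in
/-- Berry–Esseen lower bound, one-sided. -/
lemma be_lower (ρ : ℝ) (h0 : 0 < ρ) (h1 : ρ < 1) : ∃ a0 C : ℝ, 0 < a0 ∧ 0 < C ∧
    ∀ {Ω : Type} [MeasurableSpace Ω] {P : Measure Ω} [IsProbabilityMeasure P] {γ a δ : ℝ} (A : WSys P ρ γ a δ),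
      0 < γ → 0 ≤ a → a ≤ a0 → 0 ≤ δ → δ ≤ 1/4 → ∀ t, 1 - stdNormalCDF t - C * (γ^ρ + a + δ) ≤ A.law.real (Set.Ici t) := by
  have hk := kap_pos h1
  have hk1 := kap_le h0 h1
  have hCM := CM_pos
  have hCM1 : 1 ≤ CM := by norm_num [CM, CG]
  have hCG : 0 < CG := by norm_num [CG]
  set θ := kap ρ / (640 * CM) with hθ
  have hθ0 : 0 < θ := by positivity
  have hθ1 : θ ≤ 1 := by rw [hθ, div_le_one (by positivity)]; linarith
  set K1 := θ^(-(1/ρ)) with hK1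
  have hK0 : 0 < K1 := by positivity
  have hK11 : 1 ≤ K1 := by
    rw [hK1]; exact Real.one_le_rpow_of_pos_of_le_one_of_nonpos hθ0 hθ1 (by have : 0 < 1/ρ := by positivity
                                                                            linarith)
  have hKρ : (1/K1)^ρ = θ := by
    rw [hK1, Real.rpow_neg hθ0.le, one_div, inv_inv, ← Real.rpow_mul hθ0.le, one_div, inv_mul_cancel₀ h0.ne', Real.rpow_one]
  set CΛ := 960 * CM / kap ρ with hCΛ
  have hCΛ0 : 0 < CΛ := by positivity
  refine ⟨kap ρ / (8 * CM), CG * (K1+1) + 2*K1 + CΛ * CM, by positivity, by positivity, ?_⟩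
  intro Ω _ P _ γ a δ A hγ ha ha0 hδ hδ4 t
  have hγρ : 0 < γ^ρ := by positivity
  set s := K1 * (γ + δ) with hs
  have hs0 : 0 < s := by positivity
  rcases le_or_gt s 1 with hs1 | hs1
  · have hγs : γ ≤ s := by nlinarith
    have hδs : δ ≤ s := by nlinarith
    have hγle : γ ≤ γ^ρ := by
      have := Real.rpow_le_rpow_of_exponent_ge hγ (hγs.trans hs1) h1.le
      rwa [Real.rpow_one] at this
    have hgs : (γ/s)^ρ ≤ θ := by
      rw [← hKρ]
      have : γ/s ≤ 1/K1 := by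
        rw [div_le_div_iff₀ hs0 hK0, hs]; nlinarith
      gcongr
    have hsm : CM * (a/2 + 40*(γ/s)^ρ) ≤ kap ρ/8 := by
      have e1 : CM * a ≤ kap ρ / 8 := by
        calc CM * a ≤ CM * (kap ρ / (8*CM)) := by gcongr
          _ = _ := by field_simp
      have e2 : CM * (γ/s)^ρ ≤ kap ρ / 640 := by
        calc CM * (γ/s)^ρ ≤ CM * θ := by gcongr
          _ = _ := by rw [hθ]; field_simp
      linarith
    set Λ := CΛ * (a + γ^ρ) with hΛ
    have hΛ0 : 0 ≤ Λ := by positivity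
    have H := pot_be (a := a) h0 h1 hγ ha hs0 hγs hsm (le_refl Λ)
    have hδ2 : δ^2 ≤ δ := by nlinarith
    have hs2 : s^2 ≤ s := by nlinarith
    have hmm : ∀ y, 0 ≤ mm0 ρ y := fun y => by
      unfold mm0; have := ge_pos y; have := qq_pos y; positivity
    have := A.law_ge h0 h1 hγ ha H (by nlinarith) t (s := Set.Ici t) measurableSet_Ici (b := 0) (K := 1) (by
      intro z R hR1 hR2
      have hR0 : 0 < R := by nlinarith
      have S0 : 0 < Real.sqrt R := Real.sqrt_pos.2 hR0
      have hmc : 0 ≤ Λ * comp ρ (mm0 ρ) (z-t) R := by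
        unfold comp; have := hmm ((z-t)/Real.sqrt R); positivity
      have hgc : 0 ≤ 2*s*comp 1 ge (z-t) R := by
        unfold comp; have := ge_pos ((z-t)/Real.sqrt R); positivity
      have ecdf : comp 0 stdNormalCDF (z-t) R = stdNormalCDF ((z-t)/Real.sqrt R) := by unfold comp; simp
      unfold beG
      rw [ecdf]
      by_cases hz : t ≤ z
      · have : Set.indicator (Set.Ici t) (1 : ℝ → ℝ) z = 1 := by simp [hz]
        rw [this]
        linarith [cdf_le_one ((z-t)/Real.sqrt R)]
      · have : Set.indicator (Set.Ici t) (1 : ℝ → ℝ) z = 0 := by simp [hz]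
        rw [this]
        have htail := cdf_tail (u := -((z-t)/Real.sqrt R)) (by
          rw [← neg_div]; apply div_nonneg _ S0.le; linarith [not_le.1 hz])
        rw [neg_neg, neg_sq] at htail
        have : 1/2 * Real.exp (-((z-t)/Real.sqrt R)^2/2) ≤ 2*s*comp 1 ge (z-t) R := by
          unfold comp ge
          have e2 : R^(-(1:ℝ)/2) = 1 / Real.sqrt R := by
            rw [Real.sqrt_eq_rpow, show (-1/2:ℝ) = -(1/2) by ring, Real.rpow_neg (by linarith)]; simp
          rw [e2, ← mul_assoc]
          gcongr
          have h4 : Real.sqrt R ≤ 4*s := by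
            rw [Real.sqrt_le_left (by positivity)]; nlinarith
          rw [mul_one_div, div_le_div_iff₀ two_pos S0]; linarith
        linarith)
    rw [sub_zero, one_mul] at this
    refine le_trans ?_ this
    have hR1 : 1 ≤ s^2 + 1 + δ^2 := by nlinarith [sq_nonneg δ]
    have c1 := (abs_le.1 (cdf_scale (-t) hR1)).1
    rw [cdf_neg] at c1
    have c2 : comp 1 ge (-t) (s^2+1+δ^2) ≤ 1 := by
      have := comp_bdd (z := -t) (α := 1) (C := 1) (by norm_num) one_pos hR1 (g := ge) (fun y => by rw [abs_of_pos (ge_pos y)]; exact ge_le_one y)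
      rw [Real.one_rpow, one_mul] at this
      exact (le_abs_self _).trans this
    have c3 : comp ρ (mm0 ρ) (-t) (s^2+1+δ^2) ≤ CM := by
      have := comp_bdd (z := -t) h0.le one_pos hR1 (nice_mm h0 h1).b0
      rw [Real.one_rpow, one_mul] at this
      exact (le_abs_self _).trans this
    unfold beG
    have d2 : 2*s*comp 1 ge (-t) (s^2+1+δ^2) ≤ 2*s := by nlinarith
    have d3 : Λ * comp ρ (mm0 ρ) (-t) (s^2+1+δ^2) ≤ Λ * CM := by gcongr
    have d4 : s ≤ K1 * (γ^ρ + a + δ) := by rw [hs]; gcongr; linarith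
    have d5 : CG * (s^2+1+δ^2-1) ≤ CG * ((K1+1)*(γ^ρ + a + δ)) := by
      gcongr
      have : δ ≤ γ^ρ + a + δ := by linarith
      linarith
    have d6 : Λ * CM ≤ CΛ * CM * (γ^ρ+a+δ) := by
      have : CΛ * CM * (a + γ^ρ) ≤ CΛ * CM * (γ^ρ+a+δ) := by gcongr ?_ * ?_ ; linarith
      rw [hΛ]; linarith
    linarith
  · have key : 1 ≤ 2*K1*(γ^ρ + a + δ) := by
      rcases le_or_gt γ 1 with hg | hg
      · have hγle : γ ≤ γ^ρ := by
          have := Real.rpow_le_rpow_of_exponent_ge hγ hg h1.le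
          rwa [Real.rpow_one] at this
        nlinarith
      · have : 1 ≤ γ^ρ := Real.one_le_rpow hg.le h0.le
        nlinarith
    have h2 := cdf_nonneg t
    have h3 : 0 ≤ A.law.real (Set.Ici t) := measureReal_nonneg
    have h4 : 2*K1*(γ^ρ+a+δ) ≤ (CG * (K1+1) + 2*K1 + CΛ * CM) * (γ^ρ+a+δ) := by
      gcongr
      have : 0 ≤ CG*(K1+1) := by positivity
      have : 0 ≤ CΛ*CM := by positivity
      linarith
    linarith

end SNM

namespace SNM

lemma gauss_incr {s R1 R2 : ℝ} (hs : 2 ≤ s) (h1 : s^2 ≤ R1) (h12 : R1 ≤ R2) (h2 : R2 ≤ 3/2*s^2) :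
    7/500 / s^3 * (R2 - R1) ≤ comp 1 ge (-(2*s)) R2 - comp 1 ge (-(2*s)) R1 := by
  have hs0 : 0 < s := by linarith
  have hs2 : 0 < s^2 := by positivity
  have N := nice_gauss (α := 1) (by norm_num) le_rfl
  have hd : ∀ R, 0 < R → HasDerivAt (fun r => comp 1 ge (-(2*s)) r)
      (-(1/2) * comp (1+2) (fun y => 1 * ge y + y * (-(y * ge y))) (-(2*s)) R) R := fun R hR => comp_deriv 1 N.d0 _ hR
  refine (convex_Icc R1 R2).mul_sub_le_image_sub_of_le_deriv (f := fun r => comp 1 ge (-(2*s)) r) ?_ ?_ ?_ R1 ⟨le_rfl, h12⟩ R2 ⟨h12, le_rfl⟩ h12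
  · intro R hR
    exact (hd R (by linarith [hR.1])).continuousAt.continuousWithinAt
  · intro R hR
    rw [interior_Icc] at hR
    exact (hd R (by linarith [hR.1])).differentiableAt.differentiableWithinAt
  · intro R hR
    rw [interior_Icc] at hR
    have hR0 : 0 < R := by linarith [hR.1]
    rw [(hd R hR0).deriv]
    unfold comp
    set y := -(2*s)/Real.sqrt R with hy
    have hy2 : y^2 = 4*s^2/R := by
      rw [hy, div_pow, Real.sq_sqrt hR0.le]; ring
    have y1 : 8/3 ≤ y^2 := by rw [hy2, le_div_iff₀ hR0]; linarith [hR.2]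
    have y2 : y^2 ≤ 4 := by rw [hy2, div_le_iff₀ hR0]; linarith [hR.1]
    have hg : 27/200 ≤ ge y := by
      unfold ge
      have e1 : Real.exp (-2) ≤ Real.exp (-(y^2)/2) := by gcongr; linarith
      have e2 : Real.exp (-2) = Real.exp (-1) * Real.exp (-1) := by rw [← Real.exp_add]; norm_num
      have := Real.exp_neg_one_gt_d9
      nlinarith
    have hp : 1/(8*s^3) ≤ R^(-(1+2)/2:ℝ) := by
      have : ((2*s)^2)^(-(1+2)/2:ℝ) ≤ R^(-(1+2)/2:ℝ) :=
        Real.rpow_le_rpow_of_nonpos hR0 (by nlinarith [hR.2]) (by norm_num)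
      refine le_trans (le_of_eq ?_) this
      rw [← Real.rpow_natCast (2*s) 2, ← Real.rpow_mul (by positivity), show ((2:ℕ):ℝ) * (-(1+2)/2) = -((3:ℕ):ℝ) by norm_num, Real.rpow_neg (by positivity),
        Real.rpow_natCast, one_div]
      congr 1; ring
    have e : -(1/2) * (R^(-(1+2)/2:ℝ) * (1 * ge y + y * (-(y*ge y)))) = 1/2 * R^(-(1+2)/2:ℝ) * ((y^2-1)*ge y) := by ring
    rw [e]
    have q1 : 5/3 * (27/200) ≤ (y^2-1)*ge y := by
      apply mul_le_mul <;> linarith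
    calc 7/500 / s^3 ≤ 1/2 * (1/(8*s^3)) * (5/3*(27/200)) := by
          rw [show 1/2 * (1/(8*s^3)) * (5/3*(27/200)) = (1/2*(1/8)*(5/3)*(27/200))/s^3 by field_simp]
          gcongr; norm_num
      _ ≤ _ := by gcongr

/-- Crude lower bound on the mass near the origin on the positive side. -/
lemma crude (ρ : ℝ) (h0 : 0 < ρ) (h1 : ρ < 1) (Γ0 : ℝ) (hΓ : 0 < Γ0) : ∃ a1 κ0 c0 : ℝ, 0 < a1 ∧ 0 < κ0 ∧ 0 < c0 ∧
    ∀ {Ω : Type} [MeasurableSpace Ω] {P : Measure Ω} [IsProbabilityMeasure P] {γ a δ : ℝ} (A : WSys P ρ γ a δ),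
      0 < γ → γ ≤ Γ0 → 0 ≤ a → a ≤ a1 → 0 ≤ δ → δ ≤ 1/4 → c0 ≤ A.law.real (Set.Icc 0 κ0) := by
  have hCG : 0 < CG := by norm_num [CG]
  set θ := 1/(20000*CG) with hθ
  have hθ0 : 0 < θ := by positivity
  set K1 := θ^(-(1/ρ)) with hK1
  have hK0 : 0 < K1 := by positivity
  have hKρ : (1/K1)^ρ = θ := by
    rw [hK1, Real.rpow_neg hθ0.le, one_div, inv_inv, ← Real.rpow_mul hθ0.le, one_div, inv_mul_cancel₀ h0.ne', Real.rpow_one]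
  set s := 2 + Γ0 + K1 * Γ0 with hs
  have hKG : 0 < K1 * Γ0 := by positivity
  have hs2 : 2 ≤ s := by linarith
  have hs0 : 0 < s := by linarith
  refine ⟨1/(500*CG), 4*s, 8/1000/s^2, by positivity, by positivity, by positivity, ?_⟩
  intro Ω _ P _ γ a δ A hγ hγΓ ha ha1 hδ hδ4
  have hgs : (γ/s)^ρ ≤ θ := by
    rw [← hKρ]
    have : γ/s ≤ 1/K1 := by
      rw [div_le_div_iff₀ hs0 hK0]; nlinarith
    gcongr
  set c' := 4/1000/s^3 with hc'
  have H := pot_crude (ρ := ρ) (γ := γ) (a := a) (s := s) (c' := c') (ζ := 2*s) (r1 := s^2+1+δ^2) h0 h1 hγ ha (by linarith) (by linarith) (by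
    rw [← add_div, hc']
    gcongr
    have e1 : CG * a ≤ 1/500 := by
      calc CG * a ≤ CG * (1/(500*CG)) := by gcongr
        _ = _ := by field_simp
    have e2 : CG * (γ/s)^ρ ≤ 1/20000 := by
      calc CG * (γ/s)^ρ ≤ CG * θ := by gcongr
        _ = _ := by rw [hθ]; field_simp
    linarith)
  set β := comp 1 ge (-(2*s)) (s^2+1/8) with hβ
  have hβ0 : 0 ≤ β := by
    rw [hβ]; unfold comp; have := ge_pos (-(2*s)/Real.sqrt (s^2+1/8)); positivity
  have hδ2 : δ^2 ≤ 1/16 := by nlinarith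
  have hδ20 : 0 ≤ δ^2 := sq_nonneg δ
  have hs4 : 4 ≤ s^2 := by nlinarith
  have L := A.law_ge h0 h1 hγ ha H le_rfl 0 (s := Set.Icc 0 (4*s)) measurableSet_Icc (b := β) (K := 1/s) (by
    intro z R hR1 hR2
    have hR0 : 0 < R := by linarith
    have S0 : 0 < Real.sqrt R := Real.sqrt_pos.2 hR0
    have hc0 : 0 ≤ c' * (R - s^2) := mul_nonneg (by positivity) (by linarith)
    simp only [sub_zero]
    by_cases hz : z ∈ Set.Icc 0 (4*s)
    · rw [Set.indicator_of_mem hz, Pi.one_apply, mul_one]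
      have : comp 1 ge (z - 2*s) R ≤ 1/s := by
        have h := comp_bdd (z := z - 2*s) (α := 1) (C := 1) (r0 := s^2) (by norm_num) (by positivity) hR1 (g := ge) (fun y => by rw [abs_of_pos (ge_pos y)]; exact ge_le_one y)
        rw [mul_one, ← Real.rpow_natCast, ← Real.rpow_mul hs0.le, show ((2:ℕ):ℝ) * (-1/2) = -1 by norm_num, Real.rpow_neg_one] at h
        rw [one_div]
        exact (le_abs_self _).trans h
      linarith
    · rw [Set.indicator_of_notMem hz, mul_zero, add_zero]
      have m1 : comp 1 ge (z - 2*s) R ≤ comp 1 ge (-(2*s)) R := by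
        unfold comp ge
        have : (-(2*s))^2 ≤ (z-2*s)^2 := by
          simp only [Set.mem_Icc, not_and_or, not_le] at hz
          rcases hz with hz | hz <;> nlinarith
        rw [div_pow, div_pow]
        gcongr
      have m2 := gauss_incr hs2 hR1 (R2 := s^2+1/8) (by linarith) (by linarith)
      have : 0 ≤ 7/500/s^3 * (s^2+1/8 - R) := mul_nonneg (by positivity) (by linarith)
      linarith)
  have inc := gauss_incr hs2 (R1 := s^2+1/8) (R2 := s^2+1+δ^2) (by linarith) (by linarith) (by linarith)
  simp only [neg_zero, zero_sub] at L
  have hs3 : 0 < 1/s^3 := by positivity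
  have e1 : 7/500/s^3 * (s^2+1+δ^2-(s^2+1/8)) = 1/s^3 * (7/500 * (7/8+δ^2)) := by ring
  have e2 : c' * (s^2+1+δ^2-s^2) = 1/s^3*(4/1000*(1+δ^2)) := by rw [hc']; ring
  rw [e1] at inc; rw [e2] at L
  have h3 : 1/s^3*(8/1000) ≤ 1/s * A.law.real (Set.Icc 0 (4*s)) := by
    have : 1/s^3*(8/1000) ≤ 1/s^3 * (7/500 * (7/8+δ^2)) - 1/s^3*(4/1000*(1+δ^2)) := by
      rw [← mul_sub]; gcongr; linarith
    linarith
  calc 8/1000/s^2 = s * (1/s^3*(8/1000)) := by field_simp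
    _ ≤ s * (1/s * A.law.real (Set.Icc 0 (4*s))) := by gcongr
    _ = _ := by field_simp

end SNM

namespace SNM

lemma is2pi_ge : 1/3 ≤ (Real.sqrt (2 * Real.pi))⁻¹ := by
  rw [one_div]
  apply inv_anti₀ sq2pi_pos
  rw [Real.sqrt_le_left (by norm_num)]
  linarith [Real.pi_lt_d2]

lemma is2pi_le_one : (Real.sqrt (2 * Real.pi))⁻¹ ≤ 1 := by
  apply inv_le_one_of_one_le₀
  rw [Real.one_le_sqrt]
  linarith [Real.pi_gt_three]

lemma mills_lower {x : ℝ} (hx : 0 ≤ x) : Real.exp (-(3/2)) / 3 / (1+x) ≤ mills x := by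
  have hI : ∫ t in Set.Ioc (0:ℝ) (1/(1+x)), Real.exp (-(x*t) - t^2/2) ≤ ∫ t in Set.Ioi (0:ℝ), Real.exp (-(x*t) - t^2/2) := by
    apply setIntegral_mono_set (mills_int x).integrableOn
    · exact Eventually.of_forall fun t => (Real.exp_pos _).le
    · exact Eventually.of_forall fun t ht => ht.1
  have hc : ∫ t in Set.Ioc (0:ℝ) (1/(1+x)), Real.exp (-(3/2)) ≤ ∫ t in Set.Ioc (0:ℝ) (1/(1+x)), Real.exp (-(x*t) - t^2/2) := by
    apply setIntegral_mono_on (integrableOn_const (by simp)) (mills_int x).integrableOn measurableSet_Ioc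
    intro t ht
    gcongr
    have h1 : t * (1+x) ≤ 1 := by
      have := ht.2; rwa [le_div_iff₀ (by linarith)] at this
    have ht0 := ht.1
    have : t ≤ 1 := by nlinarith
    nlinarith
  rw [setIntegral_const, Real.volume_real_Ioc_of_le (by positivity), smul_eq_mul, sub_zero] at hc
  unfold mills
  calc Real.exp (-(3/2)) / 3 / (1+x) = 1/3 * (1/(1+x) * Real.exp (-(3/2))) := by field_simp
    _ ≤ _ := mul_le_mul is2pi_ge (hc.trans hI) (by positivity) (by positivity)

lemma mills_le_half {x : ℝ} (hx : 0 ≤ x) : mills x ≤ 1/2 := by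
  rw [← mills_zero]; exact mills_anti hx

lemma mills_upper {x : ℝ} (hx : 0 ≤ x) : mills x ≤ 2 / (1+x) := by
  rcases le_or_gt x 1 with h | h
  · refine (mills_le_half hx).trans ?_
    rw [div_le_div_iff₀ two_pos (by linarith)]; linarith
  · have hx0 : 0 < x := by linarith
    have hI : ∫ t in Set.Ioi (0:ℝ), Real.exp (-(x*t) - t^2/2) ≤ ∫ t in Set.Ioi (0:ℝ), Real.exp (-x*t) := by
      apply setIntegral_mono_on (mills_int x).integrableOn (integrableOn_exp_mul_Ioi (by linarith) 0) measurableSet_Ioi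
      intro t ht
      gcongr
      nlinarith [sq_nonneg t]
    rw [integral_exp_mul_Ioi (by linarith : -x < 0) 0] at hI
    simp only [mul_zero, Real.exp_zero] at hI
    have : mills x ≤ 1 * (-1 / -x) := by
      unfold mills
      exact mul_le_mul is2pi_le_one hI (setIntegral_nonneg measurableSet_Ioi fun t _ => (Real.exp_pos _).le) (by norm_num)
    refine this.trans ?_
    rw [one_mul, neg_div_neg_eq, div_le_div_iff₀ hx0 (by linarith)]; linarith

/-- one-sided exponential -/
noncomputable def Ef (l z : ℝ) : ℝ := Set.indicator (Set.Ici 0) (fun z => Real.exp (-(l*z))) z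

lemma Ef_meas (l : ℝ) : Measurable (Ef l) :=
  Measurable.indicator (by fun_prop) measurableSet_Ici

lemma Ef_nonneg (l z : ℝ) : 0 ≤ Ef l z := Set.indicator_nonneg (fun _ _ => (Real.exp_pos _).le) z

lemma Ef_le {l : ℝ} (hl : 0 ≤ l) (z : ℝ) : Ef l z ≤ 1 := by
  unfold Ef
  apply Set.indicator_le' _ (fun _ _ => zero_le_one) z
  intro z hz
  rw [Real.exp_le_one_iff]
  have : 0 ≤ l*z := mul_nonneg hl hz
  linarith

lemma Ef_int {l : ℝ} (hl : 0 ≤ l) (ν : Measure ℝ) [IsProbabilityMeasure ν] : Integrable (Ef l) ν :=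
  Integrable.of_bound (Ef_meas l).aestronglyMeasurable 1 (Eventually.of_forall fun z => by
    rw [Real.norm_eq_abs, abs_of_nonneg (Ef_nonneg l z)]; exact Ef_le hl z)

lemma Ef_set {l : ℝ} (hl : 0 < l) {t : ℝ} (ht : 0 < t) : {z | t ≤ Ef l z} = Set.Icc 0 (-Real.log t / l) := by
  ext z
  simp only [Set.mem_ofPred_eq, Set.mem_Icc, Ef, Set.indicator, Set.mem_Ici]
  split_ifs with h
  · rw [← Real.log_le_iff_le_exp ht, le_div_iff₀ hl]
    constructor
    · intro h'; exact ⟨h, by linarith⟩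
    · intro h'; linarith [h'.2]
  · simp [h]; exact ht

lemma gauss_mills (l : ℝ) : ∫ z, Ef l z ∂(ProbabilityTheory.gaussianReal 0 1) = mills l := by
  rw [ProbabilityTheory.integral_gaussianReal_eq_integral_smul one_ne_zero]
  have : (fun x => ProbabilityTheory.gaussianPDFReal 0 1 x • Ef l x) =
      Set.indicator (Set.Ici 0) (fun t => (Real.sqrt (2 * Real.pi))⁻¹ * Real.exp (-(l*t) - t^2/2)) := by
    funext x
    unfold Ef ProbabilityTheory.gaussianPDFReal
    by_cases h : x ∈ Set.Ici (0:ℝ)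
    · rw [Set.indicator_of_mem h, Set.indicator_of_mem h]
      simp only [NNReal.coe_one, mul_one, sub_zero, smul_eq_mul]
      rw [mul_assoc, ← Real.exp_add]
      congr 2; ring
    · rw [Set.indicator_of_notMem h, Set.indicator_of_notMem h]; simp
  rw [this, integral_indicator measurableSet_Ici, integral_Ici_eq_integral_Ioi, integral_const_mul]
  rfl

lemma gauss_Icc {u : ℝ} (hu : 0 ≤ u) : (ProbabilityTheory.gaussianReal 0 1).real (Set.Icc 0 u) = stdNormalCDF u - 1/2 := by
  rw [← integral_indicator_one measurableSet_Icc, ProbabilityTheory.integral_gaussianReal_eq_integral_smul one_ne_zero]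
  have : (fun x => ProbabilityTheory.gaussianPDFReal 0 1 x • (Set.Icc 0 u).indicator (1 : ℝ → ℝ) x) =
      Set.indicator (Set.Icc 0 u) (fun t => (Real.sqrt (2 * Real.pi))⁻¹ * Real.exp (-(t^2)/2)) := by
    funext x
    unfold ProbabilityTheory.gaussianPDFReal
    by_cases h : x ∈ Set.Icc 0 u
    · rw [Set.indicator_of_mem h, Set.indicator_of_mem h]
      simp
    · rw [Set.indicator_of_notMem h, Set.indicator_of_notMem h]; simp
  rw [this, integral_indicator measurableSet_Icc, integral_Icc_eq_integral_Ioc, integral_const_mul, ← cdf_zero]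
  unfold stdNormalCDF
  rw [← mul_sub, intervalIntegral.integral_Iic_sub_Iic exp_int.integrableOn exp_int.integrableOn, intervalIntegral.integral_of_le hu]

lemma real_Icc_ge (ν : Measure ℝ) [IsProbabilityMeasure ν] {b u : ℝ} (h1 : ∀ t, 1 - stdNormalCDF t - b ≤ ν.real (Set.Ici t))
    (h2 : ∀ t, stdNormalCDF t - b ≤ ν.real (Set.Iic t)) (hu : 0 ≤ u) : stdNormalCDF u - 1/2 - 2*b ≤ ν.real (Set.Icc 0 u) := by
  have e : ν.real (Set.Ici 0 ∪ Set.Iic u) + ν.real (Set.Ici 0 ∩ Set.Iic u) = ν.real (Set.Ici 0) + ν.real (Set.Iic u) :=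
    measureReal_union_add_inter measurableSet_Iic
  have : Set.Ici 0 ∩ Set.Iic u = Set.Icc 0 u := rfl
  rw [this] at e
  have h3 : ν.real (Set.Ici 0 ∪ Set.Iic u) ≤ 1 := measureReal_le_one
  have := h1 0; have := h2 u
  rw [cdf_zero] at *
  linarith

lemma layer (ν : Measure ℝ) [IsProbabilityMeasure ν] {b l : ℝ} (hl : 0 < l) (hb : 0 ≤ b) (h1 : ∀ t, 1 - stdNormalCDF t - b ≤ ν.real (Set.Ici t))
    (h2 : ∀ t, stdNormalCDF t - b ≤ ν.real (Set.Iic t)) : mills l - 2*b ≤ ∫ z, Ef l z ∂ν := by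
  have key : ∀ (μ : Measure ℝ) [IsProbabilityMeasure μ], ∫ z, Ef l z ∂μ = ∫ t in Set.Ioc (0:ℝ) 1, μ.real {z | t ≤ Ef l z} := by
    intro μ _
    rw [(Ef_int hl.le μ).integral_eq_integral_meas_le (Eventually.of_forall fun z => Ef_nonneg l z)]
    refine setIntegral_eq_of_subset_of_forall_sdiff_eq_zero measurableSet_Ioi (fun t ht => ht.1) ?_
    rintro t ⟨ht0, ht1⟩
    have : {z | t ≤ Ef l z} = ∅ := by
      ext z
      simp only [Set.mem_ofPred_eq, Set.mem_empty_iff_false, iff_false, not_le]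
      have := Ef_le hl.le z
      simp only [Set.mem_Ioc, not_and_or, not_le] at ht1
      rcases ht1 with h | h
      · exact absurd ht0 h
      · linarith
    rw [this]; simp
  have hEint : ∀ (μ : Measure ℝ) [IsProbabilityMeasure μ], IntegrableOn (fun t => μ.real {z | t ≤ Ef l z}) (Set.Ioc (0:ℝ) 1) := by
    intro μ _
    refine Integrable.of_bound ?_ 1 (Eventually.of_forall fun t => ?_)
    · have : Antitone (fun t => μ.real {z | t ≤ Ef l z}) := fun s t hst => measureReal_mono (fun z hz => le_trans hst hz)
      exact this.measurable.aestronglyMeasurable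
    · rw [Real.norm_eq_abs, abs_of_nonneg measureReal_nonneg]; exact measureReal_le_one
  rw [← gauss_mills, key, key]
  have : ∫ t in Set.Ioc (0:ℝ) 1, ((ProbabilityTheory.gaussianReal 0 1).real {z | t ≤ Ef l z} - 2*b) ≤ ∫ t in Set.Ioc (0:ℝ) 1, ν.real {z | t ≤ Ef l z} := by
    apply setIntegral_mono_on ((hEint _).sub (integrableOn_const (by simp))) (hEint ν) measurableSet_Ioc
    intro t ht
    have hu : 0 ≤ -Real.log t / l := div_nonneg (by linarith [Real.log_nonpos ht.1.le ht.2]) hl.le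
    have hsub : (ProbabilityTheory.gaussianReal 0 1).real {z | t ≤ Ef l z} - 2*b ≤ ν.real {z | t ≤ Ef l z} := by
      rw [Ef_set hl ht.1, gauss_Icc hu]
      exact real_Icc_ge ν h1 h2 hu
    exact hsub
  rw [integral_sub (hEint _) (integrableOn_const (by simp)), setIntegral_const, Real.volume_real_Ioc_of_le zero_le_one] at this
  simpa using this

lemma absorb {q θ u : ℝ} (hq : 0 < q) (hθ : 0 < θ) (hu : θ ≤ u) : Real.exp (-(|Real.log q| / θ * u)) ≤ q := by
  rw [← Real.le_log_iff_exp_le hq]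
  have : |Real.log q| ≤ |Real.log q| / θ * u := by
    rw [div_mul_eq_mul_div, le_div_iff₀ hθ]; gcongr
  linarith [neg_abs_le (Real.log q)]

lemma Ef_Icc {l κ : ℝ} (hl : 0 ≤ l) (hκ : 0 ≤ κ) (ν : Measure ℝ) [IsProbabilityMeasure ν] :
    Real.exp (-(l*κ)) * ν.real (Set.Icc 0 κ) ≤ ∫ z, Ef l z ∂ν := by
  rw [← integral_indicator_one measurableSet_Icc, ← integral_const_mul]
  apply integral_mono _ (Ef_int hl ν)
  · intro z
    simp only
    by_cases h : z ∈ Set.Icc 0 κ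
    · rw [Set.indicator_of_mem h, Pi.one_apply, mul_one]
      unfold Ef
      rw [Set.indicator_of_mem (show z ∈ Set.Ici 0 from h.1)]
      gcongr
      exact h.2
    · rw [Set.indicator_of_notMem h, mul_zero]; exact Ef_nonneg _ _
  · exact ((integrable_indicator_iff measurableSet_Icc).2 (integrable_const (1:ℝ)).integrableOn).const_mul _

lemma cdf_incr {κ : ℝ} (h0 : 0 ≤ κ) (h1 : κ ≤ 1) : 1/6 * κ ≤ stdNormalCDF κ - 1/2 := by
  have := (convex_Icc (0:ℝ) κ).mul_sub_le_image_sub_of_le_deriv (f := stdNormalCDF) (C := 1/6)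
    (fun y _ => (cdf_hasDeriv y).continuousAt.continuousWithinAt) (fun y _ => (cdf_hasDeriv y).differentiableAt.differentiableWithinAt)
    (fun y hy => by
      rw [interior_Icc] at hy
      rw [(cdf_hasDeriv y).deriv]
      unfold gphi
      have e : 1/2 ≤ Real.exp (-(y^2)/2) := by
        have := Real.add_one_le_exp (-(y^2)/2)
        have : y^2 ≤ 1 := by nlinarith [hy.1, hy.2]
        linarith
      have := is2pi_ge
      nlinarith) 0 ⟨le_rfl, h0⟩ κ ⟨h0, le_rfl⟩ h0
  rw [cdf_zero, sub_zero] at this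
  exact this

/-- The functional lower bound. -/
lemma func {C κ0 c0 : ℝ} (hC : 0 < C) (hκ0 : 0 < κ0) (hc0 : 0 < c0) : ∃ C' : ℝ, 0 < C' ∧ ∀ (ν : Measure ℝ) [IsProbabilityMeasure ν] (l b : ℝ),
    0 < l → 0 ≤ b → (∀ t, 1 - stdNormalCDF t - C*b ≤ ν.real (Set.Ici t)) → (∀ t, stdNormalCDF t - C*b ≤ ν.real (Set.Iic t)) →
    c0 ≤ ν.real (Set.Icc 0 κ0) → mills l * Real.exp (-(C' * ((1+l)*b))) ≤ ∫ z, Ef l z ∂ν := by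
  set cm := Real.exp (-(3/2)) / 3 with hcm
  have hcm0 : 0 < cm := by positivity
  set θ := cm/(4*C) with hθ
  have hθ0 : 0 < θ := by positivity
  set K := 18*C with hK
  have hK0 : 0 < K := by positivity
  set q2 := C*θ/2 with hq2
  have hq20 : 0 < q2 := by positivity
  set q3 := 2*c0 with hq3
  have hq30 : 0 < q3 := by positivity
  set D1 := 4*C/cm with hD1
  set D2 := K + |Real.log q2| / θ with hD2
  set D3 := K*κ0 + |Real.log q3| / (1/K) with hD3
  have d1 : 0 < D1 := by positivity
  have d2 : 0 < D2 := by positivity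
  have d3 : 0 < D3 := by positivity
  refine ⟨D1 + D2 + D3, by positivity, ?_⟩
  intro ν _ l b hl hb h1 h2 h3
  have hlb : 0 ≤ (1+l)*b := by positivity
  have hm := mills_pos l
  have mono : ∀ D, D ≤ D1 + D2 + D3 → mills l * Real.exp (-((D1+D2+D3) * ((1+l)*b))) ≤ mills l * Real.exp (-(D * ((1+l)*b))) := by
    intro D hD; gcongr
  rcases le_or_gt ((1+l)*b) θ with hs | hs
  · refine (mono D1 (by linarith)).trans (le_trans ?_ (layer ν hl (b := C*b) (by positivity) h1 h2))
    set u := 2*C*((1+l)*b)/cm with hu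
    have hu0 : 0 ≤ u := by positivity
    have hu1 : u ≤ 1/2 := by
      rw [hu, div_le_iff₀ hcm0]
      calc 2*C*((1+l)*b) ≤ 2*C*θ := by gcongr
        _ = 1/2*cm := by rw [hθ]; field_simp; norm_num
    have eu : D1 * ((1+l)*b) = 2*u := by rw [hD1, hu]; ring
    rw [eu]
    have hexp : Real.exp (-(2*u)) ≤ 1-u := by
      rw [Real.exp_neg]
      have h4 := Real.add_one_le_exp (2*u)
      have h5 : (Real.exp (2*u))⁻¹ ≤ (2*u+1)⁻¹ := inv_anti₀ (by linarith) h4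
      refine h5.trans ?_
      rw [inv_le_iff_one_le_mul₀ (by linarith)]; nlinarith
    have h6 : 2*(C*b) ≤ mills l * u := by
      calc 2*(C*b) = cm/(1+l) * u := by rw [hu]; field_simp
        _ ≤ _ := by gcongr; exact mills_lower hl.le
    calc mills l * Real.exp (-(2*u)) ≤ mills l * (1-u) := by gcongr
      _ ≤ _ := by linarith
  · rcases le_or_gt (K*b) 1 with hs2 | hs2
    · refine (mono D2 (by linarith)).trans ?_
      have hκ : 0 ≤ K*b := by positivity
      refine le_trans ?_ (Ef_Icc hl.le hκ ν)
      have e1 := real_Icc_ge ν h1 h2 hκ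
      have e2 := cdf_incr hκ hs2
      have e3 : C*b ≤ ν.real (Set.Icc 0 (K*b)) := by rw [hK] at *; linarith
      have e4 := absorb hq20 hθ0 hs.le
      have e5 : mills l * q2 ≤ C * b := by
        calc mills l * q2 ≤ 2/(1+l) * q2 := by gcongr; exact mills_upper hl.le
          _ = C * (θ/(1+l)) := by rw [hq2]; field_simp
          _ ≤ C * b := by
            gcongr
            rw [div_le_iff₀ (by linarith)]; linarith
      have e6 : Real.exp (-(K*((1+l)*b))) ≤ Real.exp (-(l*(K*b))) := by
        apply Real.exp_le_exp.2
        nlinarith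
      calc mills l * Real.exp (-(D2*((1+l)*b))) = Real.exp (-(K*((1+l)*b))) * (mills l * Real.exp (-(|Real.log q2|/θ * ((1+l)*b)))) := by
            rw [hD2, show -((K + |Real.log q2| / θ) * ((1+l)*b)) = -(K*((1+l)*b)) + -(|Real.log q2|/θ * ((1+l)*b)) by ring, Real.exp_add]; ring
        _ ≤ Real.exp (-(l*(K*b))) * (mills l * q2) := by gcongr
        _ ≤ Real.exp (-(l*(K*b))) * ν.real (Set.Icc 0 (K*b)) := by gcongr; linarith
    · refine (mono D3 (by linarith)).trans (le_trans ?_ (Ef_Icc hl.le hκ0.le ν))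
      have hb1 : 1/K ≤ b := by rw [div_le_iff₀ hK0]; linarith
      have hb2 : 1/K ≤ (1+l)*b := by nlinarith
      have e4 := absorb hq30 (by positivity) hb2
      have e6 : Real.exp (-(K*κ0*((1+l)*b))) ≤ Real.exp (-(l*κ0)) := by
        apply Real.exp_le_exp.2
        have : l*κ0*1 ≤ l*κ0*(K*b) := by gcongr
        have : 0 ≤ K*κ0*b := by positivity
        nlinarith
      have e5 : mills l * q3 ≤ c0 := by
        have := mills_le_half hl.le
        rw [hq3]; nlinarith
      calc mills l * Real.exp (-(D3*((1+l)*b))) = Real.exp (-(K*κ0*((1+l)*b))) * (mills l * Real.exp (-(|Real.log q3|/(1/K) * ((1+l)*b)))) := by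
            rw [hD3, show -((K*κ0 + |Real.log q3| / (1/K)) * ((1+l)*b)) = -(K*κ0*((1+l)*b)) + -(|Real.log q3|/(1/K) * ((1+l)*b)) by ring, Real.exp_add]; ring
        _ ≤ Real.exp (-(l*κ0)) * (mills l * q3) := by gcongr
        _ ≤ Real.exp (-(l*κ0)) * ν.real (Set.Icc 0 κ0) := by gcongr; linarith

end SNM

namespace SNM

/-- exponent of the self-normalised tilt -/
noncomputable def YY (y : ℝ) : ℝ := y - y^2/2

lemma YY_le (y : ℝ) : YY y ≤ 1/2 := by unfold YY; nlinarith [sq_nonneg (y-1)]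

lemma expYY_le (y : ℝ) : Real.exp (YY y) ≤ 2 := by
  have h1 : Real.exp (YY y) ≤ Real.exp (1/2) := Real.exp_le_exp.2 (YY_le y)
  have h2 := Real.exp_one_lt_d9
  have h3 : Real.exp (1/2) * Real.exp (1/2) = Real.exp 1 := by rw [← Real.exp_add]; norm_num
  have h4 := Real.exp_pos (1/2)
  nlinarith

lemma expYY_cube (y : ℝ) : Real.exp (YY y) * |YY y|^3 ≤ 6 := by
  have h2 := expYY_le y
  rcases le_or_gt 0 (YY y) with h | h
  · rw [abs_of_nonneg h]
    have h1 := YY_le y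
    have : (YY y)^3 ≤ (1/2)^3 := by gcongr
    nlinarith [Real.exp_pos (YY y)]
  · rw [abs_of_neg h]
    have h3 := Real.pow_div_factorial_le_exp (-(YY y)) (by linarith) 3
    have h4 : Real.exp (YY y) * Real.exp (-(YY y)) = 1 := by rw [← Real.exp_add]; simp
    have h5 : (-(YY y))^3 ≤ 6 * Real.exp (-(YY y)) := by
      have : ((Nat.factorial 3 : ℕ) : ℝ) = 6 := by norm_num [Nat.factorial]
      rw [this, div_le_iff₀ (by norm_num)] at h3; linarith
    nlinarith [Real.exp_pos (YY y)]

lemma expYY_mix (y : ℝ) {v : ℝ} (hv : v ≤ 1 + |YY y|^3) : Real.exp (YY y) * v ≤ 8 := by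
  have := expYY_cube y; have := expYY_le y
  nlinarith [Real.exp_pos (YY y)]

lemma abs_le_cube (z : ℝ) : |z| ≤ 1 + |z|^3 := by
  rcases le_total |z| 1 with h | h
  · have : 0 ≤ |z|^3 := by positivity
    linarith
  · have := le_self_pow₀ h (by norm_num : 3 ≠ 0); linarith
lemma sq_le_cube (z : ℝ) : z^2 ≤ 1 + |z|^3 := by
  rw [← sq_abs]
  rcases le_total |z| 1 with h | h
  · have : 0 ≤ |z|^3 := by positivity
    have := pow_le_one₀ (abs_nonneg z) h (n := 2); linarith
  · have := pow_le_pow_right₀ h (by norm_num : 2 ≤ 3); linarith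
lemma rpow_le_cube (z : ℝ) {ρ : ℝ} (h0 : 0 < ρ) (h1 : ρ < 1) : |z|^(2+ρ) ≤ 1 + |z|^3 := by
  rcases le_total |z| 1 with h | h
  · have : 0 ≤ |z|^3 := by positivity
    have := Real.rpow_le_one (abs_nonneg z) h (by linarith : 0 ≤ 2+ρ); linarith
  · have := Real.rpow_le_rpow_of_exponent_le h (by norm_num; linarith : 2+ρ ≤ ((3:ℕ):ℝ))
    rw [Real.rpow_natCast] at this; linarith

lemma cube_le_rpow {z ρ : ℝ} (h0 : 0 < ρ) (h1 : ρ < 1) (hz : |z| ≤ 1) : |z|^3 ≤ |z|^(2+ρ) := by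
  rcases eq_or_lt_of_le (abs_nonneg z) with h | h
  · rw [← h, Real.zero_rpow (by linarith)]; norm_num
  · have := Real.rpow_le_rpow_of_exponent_ge h hz (by norm_num; linarith : 2+ρ ≤ ((3:ℕ):ℝ))
    rwa [Real.rpow_natCast] at this

lemma big_y {y ρ : ℝ} (h0 : 0 < ρ) (h1 : ρ < 1) (hy : 1/2 ≤ |y|) : 1 ≤ 8*|y|^(2+ρ) ∧ |y| ≤ 8 * |y|^(2+ρ) ∧ y^2 ≤ 8*|y|^(2+ρ) := by
  rw [← sq_abs]
  rcases le_total |y| 1 with h | h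
  · have h3 := cube_le_rpow h0 h1 h
    have h4 : (1/2:ℝ)^3 ≤ |y|^3 := by gcongr
    have h5 := pow_le_one₀ (abs_nonneg y) h (n := 2)
    refine ⟨?_, ?_, ?_⟩ <;> linarith
  · have e1 : 1 ≤ |y|^(2+ρ) := Real.one_le_rpow h (by linarith)
    have e2 : |y|^(1:ℝ) ≤ |y|^(2+ρ) := Real.rpow_le_rpow_of_exponent_le h (by linarith)
    have e3 : |y|^((2:ℕ):ℝ) ≤ |y|^(2+ρ) := Real.rpow_le_rpow_of_exponent_le h (by norm_num; linarith)
    rw [Real.rpow_one] at e2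
    rw [Real.rpow_natCast] at e3
    refine ⟨?_, ?_, ?_⟩ <;> linarith

lemma YY_small {y : ℝ} (hy : |y| ≤ 1/2) : |YY y| ≤ 5/4 * |y| := by
  unfold YY
  have : y - y^2/2 = y * (1 - y/2) := by ring
  have h := abs_le.1 hy
  rw [this, abs_mul, abs_of_nonneg (by linarith : 0 ≤ 1 - y/2)]
  nlinarith [abs_nonneg y, h.1, h.2]

lemma pw1 {ρ : ℝ} (h0 : 0 < ρ) (h1 : ρ < 1) (y : ℝ) : |Real.exp (YY y) - (1 + y)| ≤ 100 * |y|^(2+ρ) := by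
  rcases le_total |y| (1/2) with hy | hy
  · have hY := YY_small hy
    have c := cube_le_rpow h0 h1 (hy.trans (by norm_num))
    have hb := Real.exp_bound (x := YY y) (by linarith) (n := 3) (by norm_num)
    simp only [Finset.sum_range_succ, Finset.sum_range_zero, Nat.factorial] at hb
    norm_num at hb
    have hc : |YY y|^3 ≤ (5/4*|y|)^3 := by gcongr
    have e : Real.exp (YY y) - (1+y) = (Real.exp (YY y) - (1 + YY y + YY y^2/2)) + y^3*(-1/2+y/8) := by
      unfold YY; ring
    have h := abs_le.1 hy
    have e2 : |y^3*(-1/2+y/8)| ≤ |y|^3 * 1 := by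
      rw [abs_mul, abs_pow]; gcongr; rw [abs_le]; constructor <;> linarith
    rw [e]
    refine (abs_add_le _ _).trans ?_
    nlinarith [pow_nonneg (abs_nonneg y) 3]
  · obtain ⟨b1, b2, b3⟩ := big_y h0 h1 hy
    have := expYY_le y
    have := Real.exp_pos (YY y)
    have : |Real.exp (YY y) - (1+y)| ≤ |Real.exp (YY y)| + (1 + |y|) := by
      refine (abs_sub _ _).trans ?_
      have := abs_add_le 1 y
      rw [abs_one] at this
      linarith
    rw [abs_of_pos (Real.exp_pos _)] at this
    linarith

lemma pw2 {ρ : ℝ} (h0 : 0 < ρ) (h1 : ρ < 1) (y : ℝ) : |Real.exp (YY y) * YY y - (y + y^2/2)| ≤ 100 * |y|^(2+ρ) := by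
  rcases le_total |y| (1/2) with hy | hy
  · have hY := YY_small hy
    have c := cube_le_rpow h0 h1 (hy.trans (by norm_num))
    have hb := Real.exp_bound (x := YY y) (by linarith) (n := 2) (by norm_num)
    simp only [Finset.sum_range_succ, Finset.sum_range_zero, Nat.factorial] at hb
    norm_num at hb
    have hc : |YY y|^3 ≤ (5/4*|y|)^3 := by gcongr
    have e : Real.exp (YY y) * YY y - (y+y^2/2) = (Real.exp (YY y) - (1 + YY y)) * YY y + y^3*(-1+y/4) := by
      unfold YY; ring
    have h := abs_le.1 hy
    have e2 : |y^3*(-1+y/4)| ≤ |y|^3 * 2 := by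
      rw [abs_mul, abs_pow]; gcongr; rw [abs_le]; constructor <;> linarith
    have e3 : |(Real.exp (YY y) - (1 + YY y)) * YY y| ≤ |YY y|^3 * (3/4) := by
      rw [abs_mul]
      calc |Real.exp (YY y) - (1 + YY y)| * |YY y| ≤ (YY y^2*(3/4)) * |YY y| := by gcongr
        _ = _ := by rw [← sq_abs]; ring
    rw [e]
    refine (abs_add_le _ _).trans ?_
    nlinarith [pow_nonneg (abs_nonneg y) 3]
  · obtain ⟨b1, b2, b3⟩ := big_y h0 h1 hy
    have h8 := expYY_mix y (abs_le_cube _)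
    have : |Real.exp (YY y) * YY y - (y+y^2/2)| ≤ |Real.exp (YY y) * YY y| + (|y| + y^2/2) := by
      refine (abs_sub _ _).trans ?_
      have := abs_add_le y (y^2/2)
      rw [abs_of_nonneg (by positivity : 0 ≤ y^2/2)] at this
      linarith
    rw [abs_mul, abs_of_pos (Real.exp_pos _)] at this
    linarith

lemma pw3 {ρ : ℝ} (h0 : 0 < ρ) (h1 : ρ < 1) (y : ℝ) : |Real.exp (YY y) * YY y^2 - y^2| ≤ 100 * |y|^(2+ρ) := by
  rcases le_total |y| (1/2) with hy | hy
  · have hY := YY_small hy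
    have c := cube_le_rpow h0 h1 (hy.trans (by norm_num))
    have hb := Real.exp_bound (x := YY y) (by linarith) (n := 1) (by norm_num)
    simp only [Finset.sum_range_succ, Finset.sum_range_zero, Nat.factorial] at hb
    norm_num at hb
    have hc : |YY y|^3 ≤ (5/4*|y|)^3 := by gcongr
    have e : Real.exp (YY y) * YY y^2 - y^2 = (Real.exp (YY y) - 1) * YY y^2 + y^3*(-1+y/4) := by
      unfold YY; ring
    have h := abs_le.1 hy
    have e2 : |y^3*(-1+y/4)| ≤ |y|^3 * 2 := by
      rw [abs_mul, abs_pow]; gcongr; rw [abs_le]; constructor <;> linarith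
    have e3 : |(Real.exp (YY y) - 1) * YY y^2| ≤ |YY y|^3 * 2 := by
      rw [abs_mul, abs_pow]
      calc |Real.exp (YY y) - 1| * |YY y|^2 ≤ (|YY y| * 2) * |YY y|^2 := by gcongr
        _ = _ := by ring
    rw [e]
    refine (abs_add_le _ _).trans ?_
    nlinarith [pow_nonneg (abs_nonneg y) 3]
  · obtain ⟨b1, b2, b3⟩ := big_y h0 h1 hy
    have h8 := expYY_mix y (sq_le_cube _)
    have : |Real.exp (YY y) * YY y^2 - y^2| ≤ |Real.exp (YY y) * YY y^2| + |y^2| := abs_sub _ _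
    rw [abs_of_nonneg (by positivity : 0 ≤ Real.exp (YY y) * YY y^2), abs_of_nonneg (sq_nonneg y)] at this
    linarith

lemma pw4 {ρ : ℝ} (h0 : 0 < ρ) (h1 : ρ < 1) (y : ℝ) : Real.exp (YY y) * |YY y|^(2+ρ) ≤ 100 * |y|^(2+ρ) := by
  rcases le_total |y| (1/2) with hy | hy
  · have hY := YY_small hy
    have h2 : |YY y|^(2+ρ) ≤ (2*|y|)^(2+ρ) := Real.rpow_le_rpow (abs_nonneg _) (by linarith [abs_nonneg y]) (by linarith)
    rw [Real.mul_rpow (by norm_num) (abs_nonneg _)] at h2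
    have h3 : (2:ℝ)^(2+ρ) ≤ 8 := by
      have := Real.rpow_le_rpow_of_exponent_le (by norm_num : (1:ℝ) ≤ 2) (by norm_num; linarith : 2+ρ ≤ ((3:ℕ):ℝ))
      rw [Real.rpow_natCast] at this; linarith
    have h4 : 0 ≤ |y|^(2+ρ) := by positivity
    have h5 : |YY y|^(2+ρ) ≤ 8*|y|^(2+ρ) := h2.trans (by gcongr)
    have := expYY_le y
    calc Real.exp (YY y) * |YY y|^(2+ρ) ≤ 2 * (8*|y|^(2+ρ)) := by gcongr
      _ ≤ _ := by linarith
  · obtain ⟨b1, b2, b3⟩ := big_y h0 h1 hy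
    have h8 := expYY_mix y (rpow_le_cube (YY y) h0 h1)
    linarith

lemma sub_rpow {ρ : ℝ} (h0 : 0 < ρ) (h1 : ρ < 1) (u v : ℝ) : |u - v|^(2+ρ) ≤ 8*(|u|^(2+ρ) + |v|^(2+ρ)) := by
  have hm : |u - v| ≤ 2 * max |u| |v| := by
    refine (abs_sub _ _).trans ?_
    linarith [le_max_left |u| |v|, le_max_right |u| |v|]
  have h2 := Real.rpow_le_rpow (abs_nonneg _) hm (by linarith : 0 ≤ 2+ρ)
  rw [Real.mul_rpow (by norm_num) (le_max_of_le_left (abs_nonneg _))] at h2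
  have h3 : (2:ℝ)^(2+ρ) ≤ 8 := by
    have := Real.rpow_le_rpow_of_exponent_le (by norm_num : (1:ℝ) ≤ 2) (by norm_num; linarith : 2+ρ ≤ ((3:ℕ):ℝ))
    rw [Real.rpow_natCast] at this; linarith
  have hu : 0 ≤ |u|^(2+ρ) := by positivity
  have hv : 0 ≤ |v|^(2+ρ) := by positivity
  have h4 : (max |u| |v|)^(2+ρ) ≤ |u|^(2+ρ) + |v|^(2+ρ) := by
    rcases max_choice |u| |v| with h | h <;> rw [h] <;> linarith
  calc _ ≤ _ := h2
    _ ≤ 8 * (|u|^(2+ρ) + |v|^(2+ρ)) := by gcongr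

end SNM

namespace SNM

lemma condExp_close {Ω : Type} {m mΩ : MeasurableSpace Ω} {P : Measure Ω} {f g h : Ω → ℝ}
    (hf : Integrable f P) (hg : Integrable g P) (hh : Integrable h P) (H : ∀ ω, |f ω - g ω| ≤ h ω) :
    ∀ᵐ ω ∂P, |(P[f|m]) ω - (P[g|m]) ω| ≤ (P[h|m]) ω := by
  have a1 : P[f|m] ≤ᵐ[P] P[g+h|m] := condExp_mono hf (hg.add hh) (Eventually.of_forall fun ω => by
    have := (abs_le.1 (H ω)).2; simp only [Pi.add_apply]; linarith)
  have a2 : P[g|m] ≤ᵐ[P] P[f+h|m] := condExp_mono hg (hf.add hh) (Eventually.of_forall fun ω => by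
    have := (abs_le.1 (H ω)).1; simp only [Pi.add_apply]; linarith)
  filter_upwards [a1, a2, condExp_add hg hh m, condExp_add hf hh m] with ω b1 b2 b3 b4
  rw [b3, Pi.add_apply] at b1
  rw [b4, Pi.add_apply] at b2
  rw [abs_le]; constructor <;> linarith

lemma condlin {Ω : Type} {m mΩ : MeasurableSpace Ω} {P : Measure Ω} [IsProbabilityMeasure P] (hm : m ≤ mΩ) {u1 u2 u3 v1 v2 v3 f : Ω → ℝ} {c : ℝ}
    (hu1 : StronglyMeasurable[m] u1) (hb1 : ∀ᵐ ω ∂P, |u1 ω| ≤ c) (hv1 : Integrable v1 P)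
    (hu2 : StronglyMeasurable[m] u2) (hb2 : ∀ᵐ ω ∂P, |u2 ω| ≤ c) (hv2 : Integrable v2 P)
    (hu3 : StronglyMeasurable[m] u3) (hb3 : ∀ᵐ ω ∂P, |u3 ω| ≤ c) (hv3 : Integrable v3 P)
    (hf : ∀ ω, f ω = u1 ω * v1 ω + u2 ω * v2 ω + u3 ω * v3 ω) :
    ∀ᵐ ω ∂P, (P[f|m]) ω = u1 ω * (P[v1|m]) ω + u2 ω * (P[v2|m]) ω + u3 ω * (P[v3|m]) ω := by
  have hf' : f = u1 * v1 + u2 * v2 + u3 * v3 := by funext ω; simp [hf]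
  have i1 : Integrable (u1 * v1) P := hv1.bdd_mul (hu1.mono hm).aestronglyMeasurable hb1
  have i2 : Integrable (u2 * v2) P := hv2.bdd_mul (hu2.mono hm).aestronglyMeasurable hb2
  have i3 : Integrable (u3 * v3) P := hv3.bdd_mul (hu3.mono hm).aestronglyMeasurable hb3
  rw [hf']
  filter_upwards [condExp_add (i1.add i2) i3 m, condExp_add i1 i2 m, condExp_stronglyMeasurable_mul_of_bound hm hu1 hv1 c hb1,
    condExp_stronglyMeasurable_mul_of_bound hm hu2 hv2 c hb2, condExp_stronglyMeasurable_mul_of_bound hm hu3 hv3 c hb3] with ω e1 e2 e3 e4 e5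
  rw [e1, Pi.add_apply, e2, Pi.add_apply, e3, e4, e5]
  rfl

section Step
variable {Ω : Type}

noncomputable def tE (l : ℝ) (X : Ω → ℝ) (ω : Ω) : ℝ := Real.exp (YY (l * X ω))
noncomputable def tY (l : ℝ) (X : Ω → ℝ) (ω : Ω) : ℝ := YY (l * X ω)
noncomputable def tp (m : MeasurableSpace Ω) [mΩ : MeasurableSpace Ω] (P : Measure Ω) (l : ℝ) (X : Ω → ℝ) : Ω → ℝ := P[tE l X|m]
noncomputable def tA (m : MeasurableSpace Ω) [mΩ : MeasurableSpace Ω] (P : Measure Ω) (l : ℝ) (X : Ω → ℝ) : Ω → ℝ := P[fun ω => tE l X ω * tY l X ω|m]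
noncomputable def tc (m : MeasurableSpace Ω) [mΩ : MeasurableSpace Ω] (P : Measure Ω) (l : ℝ) (X : Ω → ℝ) (ω : Ω) : ℝ := tA m P l X ω / tp m P l X ω

lemma tY_meas {m : MeasurableSpace Ω} {X : Ω → ℝ} (hX : Measurable[m] X) (l : ℝ) : Measurable[m] (tY l X) := by
  have : Measurable (fun x : ℝ => YY (l*x)) := by unfold YY; fun_prop
  exact this.comp hX
lemma tE_meas {m : MeasurableSpace Ω} {X : Ω → ℝ} (hX : Measurable[m] X) (l : ℝ) : Measurable[m] (tE l X) :=
  Real.measurable_exp.comp (tY_meas hX l)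

variable {m : MeasurableSpace Ω} [mΩ : MeasurableSpace Ω] {P : Measure Ω} [IsProbabilityMeasure P]

lemma tE_f_int {X : Ω → ℝ} (hX : Measurable X) (l : ℝ) {f : ℝ → ℝ} (hf : Measurable f) (hb : ∀ z, |f z| ≤ 1 + |z|^3) :
    Integrable (fun ω => tE l X ω * f (tY l X ω)) P := by
  refine Integrable.of_bound ((tE_meas hX l).mul (hf.comp (tY_meas hX l))).aestronglyMeasurable 8 (Eventually.of_forall fun ω => ?_)
  rw [Real.norm_eq_abs, abs_mul]
  unfold tE tY
  rw [abs_of_pos (Real.exp_pos _)]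
  exact expYY_mix _ (hb _)

lemma tE0_int {X : Ω → ℝ} (hX : Measurable X) (l : ℝ) : Integrable (tE l X) P := by
  have := tE_f_int (P := P) hX l (f := fun _ => 1) measurable_const (fun z => by
    rw [abs_one]; have : 0 ≤ |z|^3 := by positivity
    linarith)
  simpa using this
lemma tE1_int {X : Ω → ℝ} (hX : Measurable X) (l : ℝ) : Integrable (fun ω => tE l X ω * tY l X ω) P :=
  tE_f_int hX l (f := fun z => z) measurable_id abs_le_cube
lemma tE2_int {X : Ω → ℝ} (hX : Measurable X) (l : ℝ) : Integrable (fun ω => tE l X ω * tY l X ω^2) P :=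
  tE_f_int hX l (f := fun z => z^2) (by fun_prop) (fun z => by rw [abs_of_nonneg (sq_nonneg z)]; exact sq_le_cube z)
lemma tEr_int {X : Ω → ℝ} (hX : Measurable X) (l : ℝ) {ρ : ℝ} (h0 : 0 < ρ) (h1 : ρ < 1) : Integrable (fun ω => tE l X ω * |tY l X ω|^(2+ρ)) P :=
  tE_f_int hX l (f := fun z => |z|^(2+ρ)) (by fun_prop) (fun z => by rw [abs_of_nonneg (by positivity)]; exact rpow_le_cube z h0 h1)

/-- Moment bounds for one step. -/
lemma step_raw (hm : m ≤ mΩ) {X : Ω → ℝ} (hX : Measurable X) {ρ : ℝ} (h0 : 0 < ρ) (h1 : ρ < 1)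
    (hX1 : Integrable X P) (hX2 : Integrable (fun ω => X ω^2) P) (hXr : Integrable (fun ω => |X ω|^(2+ρ)) P)
    (hmz : P[X|m] =ᵐ[P] 0) {l : ℝ} (hl : 0 < l) : ∀ᵐ ω ∂P,
      |tp m P l X ω - 1| ≤ 100 * (l^(2+ρ) * (P[fun ω => |X ω|^(2+ρ)|m]) ω) ∧
      |tA m P l X ω - l^2 * (P[fun ω => X ω^2|m]) ω / 2| ≤ 100 * (l^(2+ρ) * (P[fun ω => |X ω|^(2+ρ)|m]) ω) ∧
      |(P[fun ω => tE l X ω * tY l X ω^2|m]) ω - l^2 * (P[fun ω => X ω^2|m]) ω| ≤ 100 * (l^(2+ρ) * (P[fun ω => |X ω|^(2+ρ)|m]) ω) ∧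
      (P[fun ω => tE l X ω * |tY l X ω|^(2+ρ)|m]) ω ≤ 100 * (l^(2+ρ) * (P[fun ω => |X ω|^(2+ρ)|m]) ω) := by
  set h : Ω → ℝ := fun ω => 100 * (l^(2+ρ) * |X ω|^(2+ρ)) with hh
  have hi : Integrable h P := (hXr.const_mul _).const_mul _
  have hpw : ∀ ω, 100 * |l * X ω|^(2+ρ) = h ω := fun ω => by
    rw [hh, abs_mul, abs_of_pos hl, Real.mul_rpow hl.le (abs_nonneg _)]
  have eh : P[h|m] =ᵐ[P] fun ω => 100 * (l^(2+ρ) * (P[fun ω => |X ω|^(2+ρ)|m]) ω) := by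
    have e : h = (100 * l^(2+ρ)) • (fun ω => |X ω|^(2+ρ)) := by funext ω; simp [hh]; ring
    rw [e]
    filter_upwards [condExp_smul (μ := P) (100 * l^(2+ρ)) (fun ω => |X ω|^(2+ρ)) m] with ω e
    rw [e, Pi.smul_apply, smul_eq_mul]; ring
  have g1 : Integrable (fun ω => 1 + l * X ω) P := (integrable_const 1).add (hX1.const_mul l)
  have g2 : Integrable (fun ω => l * X ω + (l*X ω)^2/2) P := (hX1.const_mul l).add (by
    have := hX2.const_mul (l^2/2)
    refine this.congr (Eventually.of_forall fun ω => ?_); simp only; ring)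
  have g3 : Integrable (fun ω => (l*X ω)^2) P := by
    have := hX2.const_mul (l^2)
    refine this.congr (Eventually.of_forall fun ω => ?_); simp only; ring
  have sc : ∀ c : ℝ, StronglyMeasurable[m] (fun _ : Ω => c) := fun c => stronglyMeasurable_const
  have bd : ∀ c : ℝ, |c| ≤ 1 + l + l^2 → ∀ᵐ ω ∂P, |(fun _ : Ω => c) ω| ≤ 1+l+l^2 := fun c hc => Eventually.of_forall fun _ => hc
  have l1 : |l| ≤ 1 + l + l^2 := by rw [abs_of_pos hl]; nlinarith
  have l2 : |l^2| ≤ 1 + l + l^2 := by rw [abs_of_pos (by positivity)]; linarith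
  have l3 : |l^2/2| ≤ 1 + l + l^2 := by rw [abs_of_pos (by positivity)]; nlinarith
  have l0 : |(0:ℝ)| ≤ 1 + l + l^2 := by rw [abs_zero]; positivity
  have l4 : |(1:ℝ)| ≤ 1 + l + l^2 := by rw [abs_one]; nlinarith
  have one : P[fun _ : Ω => (1:ℝ)|m] = fun _ => 1 := condExp_const hm 1
  have eg1 := condlin (P := P) hm (f := fun ω => 1 + l * X ω) (v2 := fun _ => 1) (sc l) (bd _ l1) hX1 (sc 1) (bd _ l4) (integrable_const 1) (sc 0) (bd _ l0) hX2 (fun ω => by ring)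
  have eg2 := condlin (P := P) hm (f := fun ω => l * X ω + (l*X ω)^2/2) (sc l) (bd _ l1) hX1 (sc (l^2/2)) (bd _ l3) hX2 (sc 0) (bd _ l0) hX2 (fun ω => by ring)
  have eg3 := condlin (P := P) hm (f := fun ω => (l*X ω)^2) (sc (l^2)) (bd _ l2) hX2 (sc 0) (bd _ l0) hX2 (sc 0) (bd _ l0) hX2 (fun ω => by ring)
  have c1 := condExp_close (m := m) (P := P) (f := tE l X) (tE0_int hX l) g1 hi (fun ω => by rw [← hpw]; exact pw1 h0 h1 _)
  have c2 := condExp_close (m := m) (P := P) (f := fun ω => tE l X ω * tY l X ω) (tE1_int hX l) g2 hi (fun ω => by rw [← hpw]; exact pw2 h0 h1 _)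
  have c3 := condExp_close (m := m) (P := P) (f := fun ω => tE l X ω * tY l X ω^2) (tE2_int hX l) g3 hi (fun ω => by rw [← hpw]; exact pw3 h0 h1 _)
  have c4 := condExp_mono (m := m) (μ := P) (tEr_int hX l h0 h1) hi (Eventually.of_forall fun ω => by rw [← hpw]; exact pw4 h0 h1 _)
  filter_upwards [eh, eg1, eg2, eg3, c1, c2, c3, c4, hmz] with ω eh eg1 eg2 eg3 c1 c2 c3 c4 hmz
  rw [hmz] at eg1 eg2
  simp only [one, Pi.zero_apply] at eg1 eg2
  rw [eh, eg1] at c1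
  rw [eh, eg2] at c2
  rw [eh, eg3] at c3
  rw [eh] at c4
  refine ⟨?_, ?_, ?_, c4⟩
  · convert c1 using 2; unfold tp; ring
  · convert c2 using 2; unfold tA; ring
  · convert c3 using 2; ring

/-- conditional variance bound -/
lemma cvar_le (hm : m ≤ mΩ) {X : Ω → ℝ} {ρ γ : ℝ} (h0 : 0 < ρ) (hγ : 0 < γ)
    (hX2 : Integrable (fun ω => X ω^2) P) (hXr : Integrable (fun ω => |X ω|^(2+ρ)) P)
    (hmu : ∀ᵐ ω ∂P, (P[fun ω => |X ω|^(2+ρ)|m]) ω ≤ γ^ρ * (P[fun ω => X ω^2|m]) ω) :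
    ∀ᵐ ω ∂P, (P[fun ω => X ω^2|m]) ω ≤ 2*((2:ℝ)^(1/ρ))^2 * γ^2 := by
  set θ := (2:ℝ)^(1/ρ) * γ with hθ
  have hθ0 : 0 < θ := by positivity
  have hθρ : θ^ρ = 2*γ^ρ := by
    rw [hθ, Real.mul_rpow (by positivity) hγ.le, ← Real.rpow_mul (by norm_num), one_div, inv_mul_cancel₀ h0.ne', Real.rpow_one]
  have hγρ : 0 < γ^ρ := by positivity
  have hpw : ∀ ω, X ω^2 ≤ (θ^ρ)⁻¹ * |X ω|^(2+ρ) + θ^2 := by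
    intro ω
    rw [← sq_abs]
    rcases le_total |X ω| θ with h | h
    · have : |X ω|^2 ≤ θ^2 := by gcongr
      have : 0 ≤ (θ^ρ)⁻¹ * |X ω|^(2+ρ) := by positivity
      linarith
    · have hx : 0 < |X ω| := by linarith
      have : |X ω|^2 ≤ (θ^ρ)⁻¹ * |X ω|^(2+ρ) := by
        rw [Real.rpow_add hx, inv_mul_eq_div, le_div_iff₀ (by positivity), Real.rpow_two]
        gcongr
      nlinarith [sq_nonneg θ]
  have i1 : Integrable (fun ω => (θ^ρ)⁻¹ * |X ω|^(2+ρ) + θ^2) P := (hXr.const_mul _).add (integrable_const _)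
  have c := condExp_mono (m := m) (μ := P) hX2 i1 (Eventually.of_forall hpw)
  set Cb := |(θ^ρ)⁻¹| + |θ^2| with hCb
  have e := condlin (P := P) hm (c := Cb) (f := fun ω => (θ^ρ)⁻¹ * |X ω|^(2+ρ) + θ^2) (u1 := fun _ => (θ^ρ)⁻¹) (v1 := fun ω => |X ω|^(2+ρ))
    (u2 := fun _ => θ^2) (v2 := fun _ => 1) (u3 := fun _ => 0) (v3 := fun _ => 1)
    stronglyMeasurable_const (Eventually.of_forall fun _ => by rw [hCb]; simp; positivity) hXr stronglyMeasurable_const (Eventually.of_forall fun _ => by rw [hCb]; simp) (integrable_const 1)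
    stronglyMeasurable_const (Eventually.of_forall fun _ => by rw [abs_zero, hCb]; positivity) (integrable_const 1) (fun ω => by ring)
  have one : P[fun _ : Ω => (1:ℝ)|m] = fun _ => 1 := condExp_const hm 1
  filter_upwards [c, e, hmu] with ω c e hmu
  rw [e] at c
  simp only [one] at c
  rw [hθρ] at c
  have : (2*γ^ρ)⁻¹ * (P[fun ω => |X ω|^(2+ρ)|m]) ω ≤ (2*γ^ρ)⁻¹ * (γ^ρ * (P[fun ω => X ω^2|m]) ω) := by gcongr
  have e2 : (2*γ^ρ)⁻¹ * (γ^ρ * (P[fun ω => X ω^2|m]) ω) = (P[fun ω => X ω^2|m]) ω / 2 := by field_simp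
  have e3 : θ^2 = ((2:ℝ)^(1/ρ))^2*γ^2 := by rw [hθ]; ring
  linarith

end Step
end SNM

namespace SNM

noncomputable def cv (ρ : ℝ) : ℝ := 2*((2:ℝ)^(1/ρ))^2

lemma cv_ge {ρ : ℝ} (h0 : 0 < ρ) : 1 ≤ cv ρ := by
  unfold cv
  have : 1 ≤ (2:ℝ)^(1/ρ) := Real.one_le_rpow (by norm_num) (by positivity)
  nlinarith

lemma arith {p A A2 A3 τ e u c : ℝ} (hτ : 0 ≤ τ) (he : 0 ≤ e) (heu : e ≤ u*τ) (hτu : τ ≤ c*u) (hc : 1 ≤ c) (hu : 0 ≤ u) (hsm : 400*(c*u) ≤ 1)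
    (hp : |p - 1| ≤ 100*e) (hA : |A - τ/2| ≤ 100*e) (hA2 : |A2 - τ| ≤ 100*e) (hA3 : A3 ≤ 100*e) :
    1/2 ≤ p ∧ p ≤ 2 ∧ |A/p - τ/2| ≤ 300*e ∧ |A/p| ≤ 2*τ ∧ 2*τ ≤ 1 ∧ 100*e ≤ 1/4 ∧ |A2/p - (A/p)^2 - τ| ≤ (400+4*c)*u*τ ∧ A3/p ≤ 200*(u*τ) ∧
      (A/p)^2 ≤ 4*c*u*τ := by
  have u1 : 400*u ≤ 1 := by nlinarith
  have t1 : 400*τ ≤ 1 := by linarith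
  have e1 : 400*e ≤ τ := by nlinarith
  have p1 := abs_le.1 hp
  have hp12 : 1/2 ≤ p := by linarith
  have hp0 : 0 < p := by linarith
  set q := 1/p with hq
  have hq0 : 0 < q := by positivity
  have hq2 : q ≤ 2 := by rw [hq, div_le_iff₀ hp0]; linarith
  have hq1 : |q - 1| ≤ 200*e := by
    have : q - 1 = q * (1-p) := by rw [hq]; field_simp
    rw [this, abs_mul, abs_of_pos hq0, abs_sub_comm]
    nlinarith [abs_nonneg (p-1)]
  have dv : ∀ z, z/p = q*z := fun z => by rw [hq]; ring
  rw [dv, dv, dv]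
  have b1 : |q*A - τ/2| ≤ 300*e := by
    have : q*A - τ/2 = q*(A-τ/2) + τ/2*(q-1) := by ring
    rw [this]
    refine (abs_add_le _ _).trans ?_
    rw [abs_mul, abs_mul, abs_of_pos hq0, abs_of_nonneg (by linarith : 0 ≤ τ/2)]
    have x1 : q*|A-τ/2| ≤ 2*(100*e) := by gcongr
    have x2 : τ/2*|q-1| ≤ 1/2*(200*e) := by gcongr; linarith
    linarith
  have b2 : |q*A| ≤ 2*τ := by
    have := abs_le.1 b1
    rw [abs_le]; constructor <;> linarith
  have b3 : (q*A)^2 ≤ 4*c*u*τ := by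
    rw [← sq_abs]
    have : |q*A|^2 ≤ (2*τ)^2 := by gcongr
    nlinarith
  refine ⟨hp12, by linarith, b1, b2, by linarith, by linarith, ?_, ?_, b3⟩
  · have x0 : |q*A2 - τ| ≤ 300*e := by
      have : q*A2 - τ = q*(A2-τ) + τ*(q-1) := by ring
      rw [this]
      refine (abs_add_le _ _).trans ?_
      rw [abs_mul, abs_mul, abs_of_pos hq0, abs_of_nonneg hτ]
      have x1 : q*|A2-τ| ≤ 2*(100*e) := by gcongr
      have x2 : τ*|q-1| ≤ 1/2*(200*e) := by gcongr; linarith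
      linarith
    have x1 := abs_le.1 x0
    have : 0 ≤ u*τ := by positivity
    have := sq_nonneg (q*A)
    rw [abs_le]; constructor <;> nlinarith
  · calc q*A3 ≤ q*(100*e) := by gcongr
      _ ≤ 2*(100*e) := by gcongr
      _ ≤ _ := by linarith

section Step
variable {Ω : Type}

noncomputable def tw (m : MeasurableSpace Ω) [mΩ : MeasurableSpace Ω] (P : Measure Ω) (l : ℝ) (X : Ω → ℝ) (ω : Ω) : ℝ :=
  tE l X ω / tp m P l X ω
noncomputable def tξ (m : MeasurableSpace Ω) [mΩ : MeasurableSpace Ω] (P : Measure Ω) (l : ℝ) (X : Ω → ℝ) (ω : Ω) : ℝ :=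
  (tY l X ω - tc m P l X ω) / l

/-- Data about a single step. -/
structure StepHyp (m : MeasurableSpace Ω) [mΩ : MeasurableSpace Ω] (P : Measure Ω) (ρ γ : ℝ) (X : Ω → ℝ) : Prop where
  hm : m ≤ mΩ
  hX : Measurable X
  hX1 : Integrable X P
  hX2 : Integrable (fun ω => X ω^2) P
  hXr : Integrable (fun ω => |X ω|^(2+ρ)) P
  hmz : P[X|m] =ᵐ[P] 0
  hmu : ∀ᵐ ω ∂P, (P[fun ω => |X ω|^(2+ρ)|m]) ω ≤ γ^ρ * (P[fun ω => X ω^2|m]) ω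

variable {m : MeasurableSpace Ω} [mΩ : MeasurableSpace Ω] {P : Measure Ω} [IsProbabilityMeasure P]

lemma step_basic {X : Ω → ℝ} {ρ γ : ℝ} (H : StepHyp m P ρ γ X) (h0 : 0 < ρ) (h1 : ρ < 1) (hγ : 0 < γ) {l : ℝ} (hl : 0 < l)
    (hlγ : l*γ ≤ 1) (hsm : 400*(cv ρ * (l*γ)^ρ) ≤ 1) : ∀ᵐ ω ∂P,
    0 ≤ (P[fun ω => X ω^2|m]) ω ∧ (P[fun ω => X ω^2|m]) ω ≤ cv ρ * γ^2 ∧ 0 ≤ (P[fun ω => |X ω|^(2+ρ)|m]) ω ∧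
    |tp m P l X ω - 1| ≤ 100 * (l^(2+ρ) * (P[fun ω => |X ω|^(2+ρ)|m]) ω) ∧ 100 * (l^(2+ρ) * (P[fun ω => |X ω|^(2+ρ)|m]) ω) ≤ 1/4 ∧
    1/2 ≤ tp m P l X ω ∧ tp m P l X ω ≤ 2 ∧
    |tc m P l X ω - l^2 * (P[fun ω => X ω^2|m]) ω / 2| ≤ 300 * (l^(2+ρ) * (P[fun ω => |X ω|^(2+ρ)|m]) ω) ∧
    |tc m P l X ω| ≤ 1 ∧ (tc m P l X ω)^2 ≤ 4*cv ρ*((l*γ)^ρ)*(l^2 * (P[fun ω => X ω^2|m]) ω) ∧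
    |(P[fun ω => tE l X ω * tY l X ω^2|m]) ω / tp m P l X ω - (tc m P l X ω)^2 - l^2 * (P[fun ω => X ω^2|m]) ω|
      ≤ (400+4*cv ρ)*((l*γ)^ρ)*(l^2 * (P[fun ω => X ω^2|m]) ω) ∧
    (P[fun ω => tE l X ω * |tY l X ω|^(2+ρ)|m]) ω / tp m P l X ω ≤ 200 * ((l*γ)^ρ * (l^2 * (P[fun ω => X ω^2|m]) ω)) := by
  have hs0 : 0 ≤ᵐ[P] P[fun ω => X ω^2|m] := condExp_nonneg (Eventually.of_forall fun ω => sq_nonneg _)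
  have hm0 : 0 ≤ᵐ[P] P[fun ω => |X ω|^(2+ρ)|m] := condExp_nonneg (Eventually.of_forall fun ω => by simp only [Pi.zero_apply]; positivity)
  filter_upwards [hs0, hm0, cvar_le H.hm h0 hγ H.hX2 H.hXr H.hmu, H.hmu, step_raw H.hm H.hX h0 h1 H.hX1 H.hX2 H.hXr H.hmz hl] with ω s0 m0 sle mle ⟨r1, r2, r3, r4⟩
  simp only [Pi.zero_apply] at s0 m0
  set s := (P[fun ω => X ω^2|m]) ω
  set μ := (P[fun ω => |X ω|^(2+ρ)|m]) ω
  have hcv := cv_ge h0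
  have hlg : 0 < l*γ := by positivity
  have hlr : l^(2+ρ) = l^2*l^ρ := by rw [Real.rpow_add hl, Real.rpow_two]
  have heu : l^(2+ρ)*μ ≤ (l*γ)^ρ * (l^2*s) := by
    rw [Real.mul_rpow hl.le hγ.le, hlr]
    have : l^2*l^ρ*μ ≤ l^2*l^ρ*(γ^ρ*s) := by gcongr
    linarith
  have hτu : l^2*s ≤ cv ρ * (l*γ)^ρ := by
    have x1 : (l*γ)^(2:ℝ) ≤ (l*γ)^ρ := Real.rpow_le_rpow_of_exponent_ge hlg hlγ (by linarith)
    rw [Real.rpow_two] at x1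
    calc l^2*s ≤ l^2*(cv ρ*γ^2) := by gcongr; exact sle
      _ = cv ρ*(l*γ)^2 := by ring
      _ ≤ _ := by gcongr
  have := arith (by positivity) (by positivity) heu hτu hcv (by positivity) hsm r1 r2 r3 r4
  obtain ⟨x1, x2, x3, x4, x5, x6, x7, x8, x9⟩ := this
  exact ⟨s0, sle, m0, r1, x6, x1, x2, x3, x4.trans x5, x9, x7, x8⟩

lemma tp_sm (l : ℝ) (X : Ω → ℝ) : StronglyMeasurable[m] (tp m P l X) := stronglyMeasurable_condExp
lemma tc_sm (l : ℝ) (X : Ω → ℝ) : StronglyMeasurable[m] (tc m P l X) := by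
  have a : StronglyMeasurable[m] (tA m P l X) := stronglyMeasurable_condExp
  exact (a.measurable.div (tp_sm l X).measurable).stronglyMeasurable

set_option maxHeartbeats 2000000 in
lemma step_cond {X : Ω → ℝ} {ρ γ : ℝ} (H : StepHyp m P ρ γ X) (h0 : 0 < ρ) (h1 : ρ < 1) (hγ : 0 < γ) {l : ℝ} (hl : 0 < l)
    (hlγ : l*γ ≤ 1) (hsm : 400*(cv ρ * (l*γ)^ρ) ≤ 1) :
    P[tw m P l X|m] =ᵐ[P] 1 ∧ P[fun ω => tw m P l X ω * tξ m P l X ω|m] =ᵐ[P] 0 ∧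
    (∀ᵐ ω ∂P, |(P[fun ω => tw m P l X ω * tξ m P l X ω^2|m]) ω - (P[fun ω => X ω^2|m]) ω| ≤ (400+4*cv ρ)*(l*γ)^ρ * (P[fun ω => X ω^2|m]) ω) ∧
    (∀ᵐ ω ∂P, (P[fun ω => tw m P l X ω * |tξ m P l X ω|^(2+ρ)|m]) ω ≤ (1600+32*cv ρ)*γ^ρ * (P[fun ω => X ω^2|m]) ω) := by
  have B := step_basic H h0 h1 hγ hl hlγ hsm
  have psm := tp_sm (m := m) (P := P) l X
  have csm := tc_sm (m := m) (P := P) l X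
  have hcv := cv_ge h0
  have qsm : StronglyMeasurable[m] (fun ω => 1 / tp m P l X ω) := (measurable_const.div psm.measurable).stronglyMeasurable
  have qb : ∀ᵐ ω ∂P, 0 < 1 / tp m P l X ω ∧ 1 / tp m P l X ω ≤ 2 ∧ |tc m P l X ω| ≤ 1 ∧ tp m P l X ω ≠ 0 := by
    filter_upwards [B] with ω hB
    obtain ⟨_, _, _, _, _, b1, b2, _, b3, _⟩ := hB
    have : 0 < tp m P l X ω := by linarith
    exact ⟨by positivity, by rw [div_le_iff₀ this]; linarith, b3, this.ne'⟩
  have i0 := tE0_int (P := P) H.hX l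
  have i1 := tE1_int (P := P) H.hX l
  have i2 := tE2_int (P := P) H.hX l
  have ir := tEr_int (P := P) H.hX l h0 h1
  have z0 : StronglyMeasurable[m] (fun _ : Ω => (0:ℝ)) := stronglyMeasurable_const
  set Kb := 4/l + 4/l^2 + 2 + 16*(1/l)^(2+ρ) with hKb
  have hKb0 : 0 ≤ Kb := by positivity
  have hp1 : 0 < 4/l := by positivity
  have hp2 : 0 < 4/l^2 := by positivity
  have hp3 : 0 < 16*(1/l)^(2+ρ) := by positivity
  have zb : ∀ᵐ ω ∂P, |(fun _ : Ω => (0:ℝ)) ω| ≤ Kb := by simp [hKb0]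
  have E0 := condlin (P := P) H.hm (c := Kb) (f := tw m P l X) qsm (by
      filter_upwards [qb] with ω h
      rw [abs_of_pos h.1]; linarith [h.2.1]) i0 z0 zb i0 z0 zb i0 (fun ω => by unfold tw; ring)
  have s1 : StronglyMeasurable[m] (fun ω => 1 / tp m P l X ω / l) := (qsm.measurable.div_const l).stronglyMeasurable
  have s2 : StronglyMeasurable[m] (fun ω => -(1 / tp m P l X ω / l * tc m P l X ω)) := (s1.measurable.mul csm.measurable).neg.stronglyMeasurable
  have bb1 : ∀ᵐ ω ∂P, |1 / tp m P l X ω / l| ≤ 2/l := by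
    filter_upwards [qb] with ω h
    rw [abs_of_pos (div_pos h.1 hl)]
    exact div_le_div_of_nonneg_right h.2.1 hl.le
  have E1 := condlin (P := P) H.hm (c := Kb) (f := fun ω => tw m P l X ω * tξ m P l X ω) s1 (by
      filter_upwards [bb1] with ω h
      refine h.trans ?_
      have : 2/l ≤ 4/l := by gcongr; norm_num
      linarith) i1 s2 (by
      filter_upwards [qb, bb1] with ω h h'
      rw [abs_neg, abs_mul]
      have : 2/l ≤ 4/l := by gcongr; norm_num
      nlinarith [h.2.2.1, abs_nonneg (tc m P l X ω), abs_nonneg (1 / tp m P l X ω / l)]) i0 z0 zb i0 (fun ω => by unfold tw tξ; ring)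
  have s3 : StronglyMeasurable[m] (fun ω => 1 / tp m P l X ω / l^2) := (qsm.measurable.div_const _).stronglyMeasurable
  have s4 : StronglyMeasurable[m] (fun ω => -(2 * (1 / tp m P l X ω / l^2 * tc m P l X ω))) := ((s3.measurable.mul csm.measurable).const_mul 2).neg.stronglyMeasurable
  have s5 : StronglyMeasurable[m] (fun ω => 1 / tp m P l X ω / l^2 * (tc m P l X ω)^2) := (s3.measurable.mul (csm.measurable.pow_const 2)).stronglyMeasurable
  have bb3 : ∀ᵐ ω ∂P, |1 / tp m P l X ω / l^2| ≤ 2/l^2 := by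
    filter_upwards [qb] with ω h
    rw [abs_of_pos (div_pos h.1 (by positivity))]
    exact div_le_div_of_nonneg_right h.2.1 (by positivity)
  have h24 : 2/l^2*2 = 4/l^2 := by ring
  have E2 := condlin (P := P) H.hm (c := Kb) (f := fun ω => tw m P l X ω * tξ m P l X ω^2) s3 (by
      filter_upwards [bb3] with ω h
      refine h.trans ?_
      linarith) i2 s4 (by
      filter_upwards [qb, bb3] with ω h h'
      rw [abs_neg, abs_mul, abs_mul, abs_two]
      nlinarith [h.2.2.1, abs_nonneg (tc m P l X ω), abs_nonneg (1 / tp m P l X ω / l^2)]) i1 s5 (by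
      filter_upwards [qb, bb3] with ω h h'
      rw [abs_mul, abs_pow]
      have : |tc m P l X ω|^2 ≤ 1 := pow_le_one₀ (abs_nonneg _) h.2.2.1
      nlinarith [abs_nonneg (1 / tp m P l X ω / l^2)]) i0 (fun ω => by unfold tw tξ; ring)
  have s6 : StronglyMeasurable[m] (fun ω => 8*(1/l)^(2+ρ) * (1 / tp m P l X ω)) := (qsm.measurable.const_mul _).stronglyMeasurable
  have s7 : StronglyMeasurable[m] (fun ω => 8*(1/l)^(2+ρ) * (1 / tp m P l X ω) * |tc m P l X ω|^(2+ρ)) := by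
    have : Measurable (fun z : ℝ => |z|^(2+ρ)) := by fun_prop
    exact (s6.measurable.mul (this.comp csm.measurable)).stronglyMeasurable
  have b6 : ∀ᵐ ω ∂P, |8*(1/l)^(2+ρ) * (1 / tp m P l X ω)| ≤ 16*(1/l)^(2+ρ) := by
    filter_upwards [qb] with ω h
    rw [abs_of_nonneg (by have := h.1; positivity)]
    have : 0 < 8*(1/l)^(2+ρ) := by positivity
    nlinarith [h.2.1]
  have b7 : ∀ᵐ ω ∂P, |8*(1/l)^(2+ρ) * (1 / tp m P l X ω) * |tc m P l X ω|^(2+ρ)| ≤ 16*(1/l)^(2+ρ) := by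
    filter_upwards [qb, b6] with ω h h'
    rw [abs_mul]
    have x : |tc m P l X ω|^(2+ρ) ≤ 1 := Real.rpow_le_one (abs_nonneg _) h.2.2.1 (by linarith)
    have x' : 0 ≤ |tc m P l X ω|^(2+ρ) := by positivity
    rw [abs_of_nonneg x']
    calc _ ≤ |8*(1/l)^(2+ρ) * (1 / tp m P l X ω)| * 1 := by gcongr
      _ ≤ _ := by rw [mul_one]; exact h'
  set g : Ω → ℝ := fun ω => 8*(1/l)^(2+ρ) * (1 / tp m P l X ω) * (tE l X ω * |tY l X ω|^(2+ρ)) +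
      8*(1/l)^(2+ρ) * (1 / tp m P l X ω) * |tc m P l X ω|^(2+ρ) * tE l X ω with hg
  have Er := condlin (P := P) H.hm (c := Kb) (f := g) s6 (by filter_upwards [b6] with ω h; linarith) ir s7 (by filter_upwards [b7] with ω h; linarith)
    i0 z0 zb i0 (fun ω => by rw [hg]; ring)
  have gint : Integrable g P := (ir.bdd_mul (s6.mono H.hm).aestronglyMeasurable b6).add (i0.bdd_mul (s7.mono H.hm).aestronglyMeasurable b7)
  have hle : ∀ᵐ ω ∂P, 0 ≤ tw m P l X ω * |tξ m P l X ω|^(2+ρ) ∧ tw m P l X ω * |tξ m P l X ω|^(2+ρ) ≤ g ω := by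
    filter_upwards [qb] with ω h
    have hE : 0 < tE l X ω := Real.exp_pos _
    have hw : tw m P l X ω = 1 / tp m P l X ω * tE l X ω := by unfold tw; ring
    have hx : |tξ m P l X ω|^(2+ρ) = (1/l)^(2+ρ) * |tY l X ω - tc m P l X ω|^(2+ρ) := by
      unfold tξ
      rw [abs_div _ l, abs_of_pos hl, ← Real.mul_rpow (by positivity) (abs_nonneg _)]; congr 1; ring
    have hq := h.1
    have := sub_rpow h0 h1 (tY l X ω) (tc m P l X ω)
    refine ⟨by rw [hw]; positivity, ?_⟩
    rw [hw, hx]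
    calc 1 / tp m P l X ω * tE l X ω * ((1/l)^(2+ρ) * |tY l X ω - tc m P l X ω|^(2+ρ))
        ≤ 1 / tp m P l X ω * tE l X ω * ((1/l)^(2+ρ) * (8*(|tY l X ω|^(2+ρ) + |tc m P l X ω|^(2+ρ)))) := by gcongr
      _ = g ω := by rw [hg]; ring
  have wm : Measurable (tw m P l X) := (tE_meas H.hX l).div (psm.measurable.mono H.hm le_rfl)
  have xm : Measurable (tξ m P l X) := ((tY_meas H.hX l).sub (csm.measurable.mono H.hm le_rfl)).div_const l
  have wint : Integrable (fun ω => tw m P l X ω * |tξ m P l X ω|^(2+ρ)) P := by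
    have hxm : Measurable (fun z : ℝ => |z|^(2+ρ)) := by fun_prop
    refine gint.mono' (wm.mul (hxm.comp xm)).aestronglyMeasurable ?_
    filter_upwards [hle] with ω h
    rw [Real.norm_eq_abs, abs_of_nonneg h.1]; exact h.2
  have Em := condExp_mono (m := m) wint gint (hle.mono fun ω h => h.2)
  have htp : ∀ ω, (P[tE l X|m]) ω = tp m P l X ω := fun ω => rfl
  have htA : ∀ ω, (P[fun ω => tE l X ω * tY l X ω|m]) ω = tA m P l X ω := fun ω => rfl
  have htc : ∀ ω, tA m P l X ω / tp m P l X ω = tc m P l X ω := fun ω => rfl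
  refine ⟨?_, ?_, ?_, ?_⟩
  · filter_upwards [E0, qb] with ω e h
    rw [e, htp]
    have := h.2.2.2
    simp; field_simp
  · filter_upwards [E1, qb] with ω e h
    rw [e, htp, htA, ← htc]
    have := h.2.2.2
    simp; field_simp; ring
  · filter_upwards [E2, qb, B] with ω e h hB
    obtain ⟨_, _, _, _, _, _, _, _, _, _, hB, _⟩ := hB
    rw [e, htp, htA]
    have hp := h.2.2.2
    have hA : tA m P l X ω = tc m P l X ω * tp m P l X ω := by rw [← htc]; field_simp
    rw [hA]
    set s := (P[fun ω => X ω^2|m]) ω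
    set A2 := (P[fun ω => tE l X ω * tY l X ω^2|m]) ω
    have eq : 1 / tp m P l X ω / l^2 * A2 + -(2*(1 / tp m P l X ω / l^2 * tc m P l X ω)) * (tc m P l X ω * tp m P l X ω) +
        1 / tp m P l X ω / l^2 * (tc m P l X ω)^2 * tp m P l X ω - s = (A2 / tp m P l X ω - (tc m P l X ω)^2 - l^2*s)/l^2 := by
      field_simp; ring
    rw [eq, abs_div _ (l^2), abs_of_pos (by positivity : 0 < l^2), div_le_iff₀ (by positivity)]
    linarith
  · filter_upwards [Er, Em, qb, B] with ω e hm' h hB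
    obtain ⟨s0, _, _, _, _, b1, b2, _, b3, b4, _, b5⟩ := hB
    refine hm'.trans ?_
    rw [e, htp]
    have hp := h.2.2.2
    set s := (P[fun ω => X ω^2|m]) ω
    set A3 := (P[fun ω => tE l X ω * |tY l X ω|^(2+ρ)|m]) ω
    have hc2 : |tc m P l X ω|^(2+ρ) ≤ (tc m P l X ω)^2 := by
      rw [← sq_abs]
      rcases eq_or_lt_of_le (abs_nonneg (tc m P l X ω)) with hz | hz
      · rw [← hz, Real.zero_rpow (by linarith)]; norm_num
      · have := Real.rpow_le_rpow_of_exponent_ge hz b3 (by linarith : (2:ℝ) ≤ 2+ρ)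
        rwa [Real.rpow_two] at this
    have eq : 8*(1/l)^(2+ρ) * (1 / tp m P l X ω) * A3 + 8*(1/l)^(2+ρ) * (1 / tp m P l X ω) * |tc m P l X ω|^(2+ρ) * tp m P l X ω + 0 * tp m P l X ω
        = 8*(1/l)^(2+ρ) * (A3 / tp m P l X ω + |tc m P l X ω|^(2+ρ)) := by
      field_simp; ring
    rw [eq]
    have hlr : (1/l)^(2+ρ) * ((l*γ)^ρ * (l^2*s)) = γ^ρ*s := by
      rw [Real.mul_rpow hl.le hγ.le, Real.rpow_add (by positivity), Real.rpow_two, Real.div_rpow zero_le_one hl.le, Real.one_rpow]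
      have : l^ρ ≠ 0 := by positivity
      field_simp
    calc 8*(1/l)^(2+ρ) * (A3 / tp m P l X ω + |tc m P l X ω|^(2+ρ))
        ≤ 8*(1/l)^(2+ρ) * (200 * ((l*γ)^ρ * (l^2*s)) + 4*cv ρ*((l*γ)^ρ)*(l^2 * s)) := by gcongr; linarith
      _ = (1600+32*cv ρ) * ((1/l)^(2+ρ) * ((l*γ)^ρ * (l^2*s))) := by ring
      _ = _ := by rw [hlr]; ring

lemma step_bdd {X : Ω → ℝ} {ρ γ : ℝ} (H : StepHyp m P ρ γ X) (h0 : 0 < ρ) (h1 : ρ < 1) (hγ : 0 < γ) {l : ℝ} (hl : 0 < l)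
    (hlγ : l*γ ≤ 1) (hsm : 400*(cv ρ * (l*γ)^ρ) ≤ 1) : ∀ᵐ ω ∂P, 0 ≤ tw m P l X ω ∧ tw m P l X ω ≤ 4 + 200/l^3 ∧
      tw m P l X ω * |tξ m P l X ω|^3 ≤ 4 + 200/l^3 := by
  filter_upwards [step_basic H h0 h1 hγ hl hlγ hsm] with ω hB
  obtain ⟨s0, _, _, _, _, b1, b2, _, b3, _, _, _⟩ := hB
  have hp : 0 < tp m P l X ω := by linarith
  have hE : 0 < tE l X ω := Real.exp_pos _
  have hE2 : tE l X ω ≤ 2 := expYY_le _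
  have hl3 : 0 < 200/l^3 := by positivity
  have hw : tw m P l X ω ≤ 2 * tE l X ω := by
    unfold tw; rw [div_le_iff₀ hp]; nlinarith
  have hw0 : 0 ≤ tw m P l X ω := by unfold tw; positivity
  refine ⟨hw0, by linarith, ?_⟩
  have hY : tE l X ω * |tY l X ω|^3 ≤ 6 := expYY_cube _
  have hx : |tξ m P l X ω|^3 = |tY l X ω - tc m P l X ω|^3 / l^3 := by
    unfold tξ; rw [abs_div _ l, abs_of_pos hl, div_pow]
  have hcu : |tY l X ω - tc m P l X ω|^3 ≤ 4*(|tY l X ω|^3+1) := by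
    have x1 : |tY l X ω - tc m P l X ω| ≤ |tY l X ω| + 1 := by linarith [abs_sub (tY l X ω) (tc m P l X ω)]
    have x2 : |tY l X ω - tc m P l X ω|^3 ≤ (|tY l X ω| + 1)^3 := by gcongr
    have := abs_nonneg (tY l X ω)
    nlinarith [mul_nonneg (by linarith : 0 ≤ |tY l X ω|+1) (sq_nonneg (|tY l X ω|-1))]
  calc tw m P l X ω * |tξ m P l X ω|^3 ≤ (2*tE l X ω) * (4*(|tY l X ω|^3+1)/l^3) := by rw [hx]; gcongr
    _ = 8*(tE l X ω * |tY l X ω|^3 + tE l X ω)/l^3 := by ring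
    _ ≤ 200/l^3 := by gcongr; linarith
    _ ≤ _ := by linarith

end Step
end SNM

namespace SNM

/-- Normalized martingale difference system. -/
structure NSys {Ω : Type} [mΩ : MeasurableSpace Ω] (P : Measure Ω) (ρ γ δ e : ℝ) where
  n : ℕ
  F : ℕ → MeasurableSpace Ω
  F_mono : Monotone F
  F_le : ∀ i, F i ≤ mΩ
  X : ℕ → Ω → ℝ
  meas : ∀ i < n, Measurable[F (i+1)] (X i)
  step : ∀ i < n, StepHyp (F i) P ρ γ (X i)
  hs : ∀ᵐ ω ∂P, |∑ i ∈ Finset.range n, (P[fun ω => X i ω^2|F i]) ω - 1| ≤ δ^2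
  hmu : ∀ᵐ ω ∂P, ∑ i ∈ Finset.range n, (P[fun ω => |X i ω|^(2+ρ)|F i]) ω ≤ e

noncomputable def KK (ρ : ℝ) : ℝ := (1600+32*cv ρ)^(1/ρ) + cv ρ

lemma KK_ge {ρ : ℝ} (h0 : 0 < ρ) : 1 ≤ KK ρ := by
  have := cv_ge h0
  unfold KK
  have : 0 ≤ (1600+32*cv ρ)^(1/ρ) := by positivity
  linarith

lemma KK_rpow {ρ : ℝ} (h0 : 0 < ρ) : 1600+32*cv ρ ≤ KK ρ ^ρ := by
  have hc := cv_ge h0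
  have e : ((1600+32*cv ρ)^(1/ρ))^ρ = 1600+32*cv ρ := by
    rw [← Real.rpow_mul (by positivity)]; field_simp; simp
  rw [← e]
  unfold KK
  apply Real.rpow_le_rpow (by positivity) _ h0.le
  linarith

lemma KK_sq {ρ : ℝ} (h0 : 0 < ρ) : cv ρ ≤ KK ρ ^2 := by
  have hc := cv_ge h0
  have : 0 ≤ (1600+32*cv ρ)^(1/ρ) := by positivity
  unfold KK
  nlinarith

namespace NSys
variable {Ω : Type} [mΩ : MeasurableSpace Ω] {P : Measure Ω} {ρ γ δ e : ℝ} [IsProbabilityMeasure P]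

noncomputable def toW (N : NSys P ρ γ δ e) (h0 : 0 < ρ) (h1 : ρ < 1) (hγ : 0 < γ) {l : ℝ} (hl : 0 < l)
    (hlγ : l*γ ≤ 1) (hsm : 400*(cv ρ * (l*γ)^ρ) ≤ 1) : WSys P ρ (KK ρ * γ) ((400+4*cv ρ)*(l*γ)^ρ) δ where
  n := N.n
  F := N.F
  F_mono := N.F_mono
  F_le := N.F_le
  w i := tw (N.F i) P l (N.X i)
  ξ i := tξ (N.F i) P l (N.X i)
  d i := P[fun ω => N.X i ω^2|N.F i]
  L := 4 + 200/l^3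
  w_meas i hi := by
    have a : Measurable[N.F (i+1)] (tp (N.F i) P l (N.X i)) := (tp_sm l (N.X i)).measurable.mono (N.F_mono (Nat.le_succ i)) le_rfl
    exact ((tE_meas (N.meas i hi) l).div a).stronglyMeasurable
  ξ_meas i hi := by
    have a : Measurable[N.F (i+1)] (tc (N.F i) P l (N.X i)) := (tc_sm l (N.X i)).measurable.mono (N.F_mono (Nat.le_succ i)) le_rfl
    exact (((tY_meas (N.meas i hi) l).sub a).div_const l).stronglyMeasurable
  d_meas i hi := stronglyMeasurable_condExp
  w_nonneg i hi := (step_bdd (N.step i hi) h0 h1 hγ hl hlγ hsm).mono fun ω h => h.1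
  w_le i hi := (step_bdd (N.step i hi) h0 h1 hγ hl hlγ hsm).mono fun ω h => h.2.1
  wξ_le i hi := (step_bdd (N.step i hi) h0 h1 hγ hl hlγ hsm).mono fun ω h => h.2.2
  e0 i hi := (step_cond (N.step i hi) h0 h1 hγ hl hlγ hsm).1
  e1 i hi := (step_cond (N.step i hi) h0 h1 hγ hl hlγ hsm).2.1
  e2 i hi := (step_cond (N.step i hi) h0 h1 hγ hl hlγ hsm).2.2.1
  e3 i hi := by
    filter_upwards [(step_cond (N.step i hi) h0 h1 hγ hl hlγ hsm).2.2.2, step_basic (N.step i hi) h0 h1 hγ hl hlγ hsm] with ω h h'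
    refine h.trans ?_
    rw [Real.mul_rpow (by linarith [KK_ge h0]) hγ.le]
    have := h'.1
    have := KK_rpow h0
    gcongr
  d_nonneg i hi := (step_basic (N.step i hi) h0 h1 hγ hl hlγ hsm).mono fun ω h => h.1
  d_le i hi := by
    filter_upwards [step_basic (N.step i hi) h0 h1 hγ hl hlγ hsm] with ω h
    refine h.2.1.trans ?_
    rw [mul_pow]
    have := KK_sq h0
    gcongr
  ds := N.hs

set_option maxHeartbeats 1000000 in
lemma core (N : NSys P ρ γ δ e) (h0 : 0 < ρ) (h1 : ρ < 1) (hγ : 0 < γ) {l : ℝ} (hl : 0 < l)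
    (hlγ : l*γ ≤ 1) (hsm : 400*(cv ρ * (l*γ)^ρ) ≤ 1) {x : ℝ}
    (hlow : x^2 ≤ l^2*(1-δ^2) - 600*(l^(2+ρ)*e)) :
    Real.exp (-(500*(l^(2+ρ)*e) + l^2*(1+δ^2)/2)) * ∫ z, Ef l z ∂(N.toW h0 h1 hγ hl hlγ hsm).law
      ≤ P.real {ω | x^2/2 ≤ ∑ i ∈ Finset.range N.n, tY l (N.X i) ω} := by
  set A := N.toW h0 h1 hγ hl hlγ hsm with hA
  rw [A.law_integral (Ef_meas l)]
  have mU : Measurable (fun ω => ∑ i ∈ Finset.range N.n, tY l (N.X i) ω) :=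
    Finset.measurable_sum _ fun i hi => tY_meas ((N.step i (Finset.mem_range.1 hi)).hX) l
  have mS : MeasurableSet {ω | x^2/2 ≤ ∑ i ∈ Finset.range N.n, tY l (N.X i) ω} := measurableSet_le measurable_const mU
  rw [← integral_indicator_one mS, ← integral_const_mul]
  have SB := (Finset.eventually_all (Finset.range N.n)).2 (fun i hi => step_basic (N.step i (Finset.mem_range.1 hi)) h0 h1 hγ hl hlγ hsm)
  have hlr : 0 < l^(2+ρ) := by positivity
  refine integral_mono_ae ?_ ?_ ?_
  · refine Integrable.const_mul (A.M_intble ((Ef_meas l).comp A.Z_aem) (K := 1) (Eventually.of_forall fun ω => ?_)) _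
    rw [Function.comp, abs_of_nonneg (Ef_nonneg _ _)]
    exact Ef_le hl.le _
  · exact (integrable_const (1:ℝ)).indicator mS
  filter_upwards [SB, N.hs, N.hmu] with ω B hs hmu
  set μ := fun i => (P[fun ω => |N.X i ω|^(2+ρ)|N.F i]) ω with hμ
  set s := fun i => (P[fun ω => N.X i ω^2|N.F i]) ω with hs'
  have hMn : A.M A.n ω = ∏ i ∈ Finset.range N.n, tw (N.F i) P l (N.X i) ω := rfl
  have hZn : A.Z A.n ω = ∑ i ∈ Finset.range N.n, tξ (N.F i) P l (N.X i) ω := rfl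
  have hsum : ∑ i ∈ Finset.range N.n, tY l (N.X i) ω = l * A.Z A.n ω + ∑ i ∈ Finset.range N.n, tc (N.F i) P l (N.X i) ω := by
    rw [hZn, Finset.mul_sum, ← Finset.sum_add_distrib]
    refine Finset.sum_congr rfl fun i _ => ?_
    unfold tξ; field_simp; ring
  have hE : Real.exp (∑ i ∈ Finset.range N.n, tY l (N.X i) ω) = A.M A.n ω * ∏ i ∈ Finset.range N.n, tp (N.F i) P l (N.X i) ω := by
    rw [hMn, Real.exp_sum, ← Finset.prod_mul_distrib]
    refine Finset.prod_congr rfl fun i hi => ?_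
    obtain ⟨_, _, _, _, _, b1, _⟩ := B i hi
    have : tp (N.F i) P l (N.X i) ω ≠ 0 := by linarith
    unfold tw; rw [div_mul_cancel₀ _ this]; rfl
  have hM0 : 0 ≤ A.M A.n ω := by
    rw [hMn]
    refine Finset.prod_nonneg fun i hi => ?_
    obtain ⟨_, _, _, _, _, b1, _⟩ := B i hi
    unfold tw tE; have : 0 < tp (N.F i) P l (N.X i) ω := by linarith
    positivity
  have hμs : ∑ i ∈ Finset.range N.n, l^(2+ρ) * μ i ≤ l^(2+ρ)*e := by
    rw [← Finset.mul_sum]; gcongr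
  have hp : Real.exp (-(200*(l^(2+ρ)*e))) ≤ ∏ i ∈ Finset.range N.n, tp (N.F i) P l (N.X i) ω := by
    calc Real.exp (-(200*(l^(2+ρ)*e))) ≤ Real.exp (∑ i ∈ Finset.range N.n, -(200*(l^(2+ρ) * μ i))) := by
          apply Real.exp_le_exp.2
          rw [Finset.sum_neg_distrib, ← Finset.mul_sum]; linarith
      _ = ∏ i ∈ Finset.range N.n, Real.exp (-(200*(l^(2+ρ) * μ i))) := Real.exp_sum _ _
      _ ≤ _ := by
          refine Finset.prod_le_prod (fun i _ => (Real.exp_pos _).le) fun i hi => ?_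
          obtain ⟨_, _, m0, b0, b1, _⟩ := B i hi
          have b := (abs_le.1 b0).1
          change 0 ≤ μ i at m0
          change 100*(l^(2+ρ)*μ i) ≤ 1/4 at b1
          change -(100*(l^(2+ρ)*μ i)) ≤ _ at b
          set t := l^(2+ρ)*μ i with ht
          have t0 : 0 ≤ t := by positivity
          have q := Real.add_one_le_exp (200*t)
          have q' : Real.exp (-(200*t)) * Real.exp (200*t) = 1 := by rw [← Real.exp_add]; simp
          have q0 := Real.exp_pos (-(200*t))
          have : Real.exp (-(200*t)) * (1+200*t) ≤ 1 := by nlinarith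
          have : 1 ≤ (1-100*t)*(1+200*t) := by nlinarith
          have : Real.exp (-(200*t)) ≤ 1 - 100*t := by nlinarith
          linarith
  have hc : |∑ i ∈ Finset.range N.n, tc (N.F i) P l (N.X i) ω - l^2/2 * ∑ i ∈ Finset.range N.n, s i| ≤ 300*(l^(2+ρ)*e) := by
    rw [Finset.mul_sum, ← Finset.sum_sub_distrib]
    refine (Finset.abs_sum_le_sum_abs _ _).trans ?_
    calc _ ≤ ∑ i ∈ Finset.range N.n, 300*(l^(2+ρ) * μ i) := by
          refine Finset.sum_le_sum fun i hi => ?_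
          obtain ⟨_, _, _, _, _, _, _, b, _⟩ := B i hi
          have e1 : l^2/2 * s i = l^2 * s i / 2 := by ring
          rw [e1]; exact b
      _ ≤ _ := by rw [← Finset.mul_sum]; linarith
  have hc := abs_le.1 hc
  have hs := abs_le.1 hs
  have s1 : l^2/2 * (1-δ^2) ≤ l^2/2 * ∑ i ∈ Finset.range N.n, s i := by gcongr; linarith
  have s2 : l^2/2 * ∑ i ∈ Finset.range N.n, s i ≤ l^2/2 * (1+δ^2) := by gcongr; linarith
  set T := ∑ i ∈ Finset.range N.n, tc (N.F i) P l (N.X i) ω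
  have T1 : x^2/2 ≤ T := by linarith
  have T2 : T ≤ l^2*(1+δ^2)/2 + 300*(l^(2+ρ)*e) := by linarith
  by_cases hz : 0 ≤ A.Z A.n ω
  · have mem : ω ∈ {ω | x^2/2 ≤ ∑ i ∈ Finset.range N.n, tY l (N.X i) ω} := by
      change x^2/2 ≤ ∑ i ∈ Finset.range N.n, tY l (N.X i) ω; rw [hsum]; have := mul_nonneg hl.le hz; linarith
    rw [Set.indicator_of_mem mem]
    have hEf : Ef l (A.Z A.n ω) = Real.exp (-(l * A.Z A.n ω)) := by
      unfold Ef; rw [Set.indicator_of_mem (by exact hz)]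
    simp only [Pi.one_apply]
    rw [hEf]
    calc _ = A.M A.n ω * Real.exp (-(200*(l^(2+ρ)*e))) * Real.exp (-(l * A.Z A.n ω) - (l^2*(1+δ^2)/2 + 300*(l^(2+ρ)*e))) := by
          rw [mul_left_comm, mul_assoc, ← Real.exp_add, ← Real.exp_add]; congr 2; ring
      _ ≤ A.M A.n ω * (∏ i ∈ Finset.range N.n, tp (N.F i) P l (N.X i) ω) * Real.exp (-(∑ i ∈ Finset.range N.n, tY l (N.X i) ω)) := by
          gcongr
          · rw [← hE]; positivity
          · rw [hsum]; linarith
      _ = 1 := by rw [← hE, ← Real.exp_add]; simp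
  · have hEf : Ef l (A.Z A.n ω) = 0 := by
      unfold Ef; rw [Set.indicator_of_notMem (by exact hz)]
    rw [hEf]
    simp only [mul_zero]
    exact Set.indicator_nonneg (fun _ _ => zero_le_one) _

end NSys
end SNM

namespace SNM

set_option maxHeartbeats 4000000 in
lemma choice {ρ γ δ e E x v η : ℝ} (h0 : 0 < ρ) (h1 : ρ < 1) (hγ : 0 < γ) (hγ4 : γ ≤ 1/4) (hδ : 0 ≤ δ) (hδ4 : δ ≤ 1/4)
    (he : 0 ≤ e) (heg : e ≤ 2*γ^ρ) (heE : e ≤ E) (hx : 0 ≤ x) (hv : v ≤ 1/40000) (hη : 0 < η) (hη1 : η ≤ 1/2) (hηv : η^ρ ≤ v)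
    (hxη : x*γ ≤ η) : ∃ l : ℝ, 0 < l ∧ l*γ ≤ 1 ∧ (l*γ)^ρ ≤ 2*v ∧ x ≤ l ∧ x^2 ≤ l^2*(1-δ^2) - 600*(l^(2+ρ)*e) ∧
      (l*γ)^ρ ≤ 2*(x^ρ*γ^ρ+γ^ρ) ∧ l ≤ 2*x+1 ∧
      500*(l^(2+ρ)*e) + l^2*(1+δ^2)/2 ≤ x^2/2 + 30000*(x^(2+ρ)*E + x^2*δ^2 + (1+x)*(x^ρ*γ^ρ+γ^ρ+δ)) ∧
      l - x ≤ 30000*(x^(2+ρ)*E + x^2*δ^2 + (1+x)*(x^ρ*γ^ρ+γ^ρ+δ)) := by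
  set g := γ^ρ with hg
  have g0 : 0 < g := by positivity
  have hγg : γ ≤ g := by
    have := Real.rpow_le_rpow_of_exponent_ge hγ (by linarith) h1.le
    simpa using this
  have g1 : g ≤ 1 := Real.rpow_le_one hγ.le (by linarith) h0.le
  have E0 : 0 ≤ E := he.trans heE
  set Y := max x (η*γ) with hY
  have Yx : x ≤ Y := le_max_left _ _
  have Ypos : 0 < Y := lt_of_lt_of_le (by positivity) (le_max_right _ _)
  have ηγ : η*γ ≤ γ := by nlinarith
  have Yle : Y ≤ x + γ := max_le (by linarith) (by linarith)
  have Yγ : Y*γ ≤ η := by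
    rw [hY, max_mul_of_nonneg _ _ hγ.le]
    have : γ*γ ≤ 1 := by nlinarith
    exact max_le hxη (by nlinarith)
  set R := Y^ρ with hR
  have R0 : 0 < R := by positivity
  set xr := x^ρ with hxr
  have xr0 : 0 ≤ xr := by positivity
  have Rg : R*g = (Y*γ)^ρ := (Real.mul_rpow Ypos.le hγ.le).symm
  have Rgv : R*g ≤ v := by
    rw [Rg]
    exact (Real.rpow_le_rpow (by positivity) Yγ h0.le).trans hηv
  have x2r : x^(2+ρ) = x^2*xr := by rw [Real.rpow_add_of_nonneg hx (by norm_num) h0.le, Real.rpow_two]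
  have cases2 : R ≤ xr + 1 ∧ Y^2 ≤ x^2 + g ∧ Y^2*R*e ≤ x^2*xr*E + 2*g := by
    rcases le_total x (η*γ) with h | h
    · have hYe : Y = η*γ := max_eq_right h
      have Y1 : Y ≤ 1 := by rw [hYe]; linarith
      have R1 : R ≤ 1 := Real.rpow_le_one Ypos.le Y1 h0.le
      have Y2 : Y^2 ≤ 1 := by nlinarith
      refine ⟨by linarith, ?_, ?_⟩
      · have : Y ≤ γ := by rw [hYe]; exact ηγ
        nlinarith
      · have : Y^2*R ≤ 1 := by nlinarith
        have : Y^2*R*e ≤ 1*e := by gcongr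
        have : 0 ≤ x^2*xr*E := by positivity
        linarith
    · have hYe : Y = x := max_eq_left h
      have hRe : R = xr := by rw [hR, hYe]
      rw [hRe, hYe]
      refine ⟨by linarith, by linarith, ?_⟩
      have : x^2*xr*e ≤ x^2*xr*E := by gcongr
      linarith
  obtain ⟨c1, c2, c3⟩ := cases2
  set q := R*e with hq
  have q0 : 0 ≤ q := by positivity
  have qg : q ≤ 2*(R*g) := by
    have : R*e ≤ R*(2*g) := by gcongr
    linarith
  have qv : q ≤ 1/20000 := by linarith
  have δ2 : δ^2 ≤ 1/16 := by nlinarith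
  have δδ : δ^2 ≤ δ := by nlinarith
  have δ20 : 0 ≤ δ^2 := sq_nonneg _
  set r := Real.sqrt (1+2*δ^2+9600*q) with hr
  have r2 : r^2 = 1+2*δ^2+9600*q := Real.sq_sqrt (by positivity)
  have r0 : 0 ≤ r := Real.sqrt_nonneg _
  have r1 : 1 ≤ r := by rw [hr]; exact Real.one_le_sqrt.2 (by linarith)
  have rle : r ≤ 2 := by nlinarith only [r2, δ2, qv, r0]
  have rr : r^ρ ≤ 2 := (Real.rpow_le_rpow_of_exponent_le r1 h1.le).trans (by simpa using rle)
  have rr0 : 0 < r^ρ := by positivity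
  have l0 : 0 < Y*r := by positivity
  have lr : (Y*r)^(2+ρ) = Y^2*r^2*(R*r^ρ) := by
    rw [Real.rpow_add l0, Real.rpow_two, Real.mul_rpow Ypos.le r0]; ring
  have lr8 : (Y*r)^(2+ρ)*e ≤ 8*(Y^2*q) := by
    rw [lr]
    have a1 : r^2*r^ρ ≤ 4*2 := by
      have : r^2 ≤ 4 := by nlinarith only [rle, r0]
      gcongr
    calc _ = (r^2*r^ρ)*(Y^2*q) := by rw [hq]; ring
      _ ≤ (4*2)*(Y^2*q) := by gcongr
      _ = _ := by ring
  have lrg : (Y*r*γ)^ρ ≤ 2*(R*g) := by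
    have : (Y*r*γ)^ρ = r^ρ*(R*g) := by
      rw [Real.mul_rpow l0.le hγ.le, Real.mul_rpow Ypos.le r0]; ring
    rw [this]; gcongr
  have Y2q : Y^2*q ≤ x^2*xr*E+2*g := by rw [hq, ← mul_assoc]; exact c3
  set T := x^(2+ρ)*E + x^2*δ^2 + (1+x)*(xr*g+g+δ) with hT
  have xg : 0 ≤ xr*g := by positivity
  have T1 : x^2*xr*E + x^2*δ^2 + (xr*g+g+δ) + x*(xr*g+g+δ) = T := by rw [hT, x2r]; ring
  have p1 : 0 ≤ x^2*xr*E := by positivity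
  have p2 : 0 ≤ x^2*δ^2 := by positivity
  have p3 : 0 ≤ x*(xr*g+g+δ) := by positivity
  have Rgx : R*g ≤ xr*g+g := by nlinarith only [c1, g0]
  have z1 : Y*r ≤ 2*Y := by nlinarith only [rle, Ypos]
  have z2 : Y ≤ Y*r := by nlinarith only [r1, Ypos]
  have z3 : Y*r*γ ≤ 1 := by
    have : Y*r*γ ≤ 2*Y*γ := by gcongr
    linarith
  refine ⟨Y*r, l0, z3, by linarith, by linarith, ?_, by linarith, by linarith, ?_, ?_⟩
  · have : Y^2 ≤ (Y*r)^2*(1-δ^2) - 600*(8*(Y^2*q)) := by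
      rw [mul_pow, r2]
      have : 0 ≤ Y^2 * ((1+2*δ^2+9600*q)*(1-δ^2) - 4800*q - 1) := by
        apply mul_nonneg (sq_nonneg _)
        nlinarith only [mul_nonneg q0 (by linarith : 0 ≤ 1/16 - δ^2), mul_nonneg δ20 (by linarith : 0 ≤ 1/16 - δ^2), q0, δ20, δ2]
      linarith
    have : x^2 ≤ Y^2 := by gcongr
    linarith
  · have a1 : (Y*r)^2*(1+δ^2) ≤ Y^2 + 4*(Y^2*δ^2) + 10200*(Y^2*q) := by
      rw [mul_pow, r2]
      have : 0 ≤ Y^2 * (1 + 4*δ^2+10200*q - (1+2*δ^2+9600*q)*(1+δ^2)) := by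
        apply mul_nonneg (sq_nonneg _)
        nlinarith only [mul_nonneg q0 (by linarith : 0 ≤ 1/16 - δ^2), mul_nonneg δ20 (by linarith : 0 ≤ 1/16 - δ^2), q0, δ20, δ2]
      linarith
    have a2 : Y^2*δ^2 ≤ x^2*δ^2 + δ := by
      have : Y^2*δ^2 ≤ (x^2+g)*δ^2 := by gcongr
      nlinarith only [this, g1, δδ, δ20]
    linarith
  · have a1 : r ≤ 1 + δ^2 + 4800*q := by nlinarith only [sq_nonneg (r-1), r2]
    have a2 : Y*r ≤ Y*(1+δ^2+4800*q) := by gcongr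
    have a3 : Y*δ^2 ≤ (x+1)*δ := by
      have : Y ≤ x+1 := by linarith
      gcongr
    have a4 : Y*q ≤ (x+1)*(2*(xr*g+g)) := by
      have : Y ≤ x+1 := by linarith
      have : q ≤ 2*(xr*g+g) := by linarith
      gcongr
    have p4 : 0 ≤ x*(xr*g) := by positivity
    have p5 : 0 ≤ x*g := by positivity
    have p6 : 0 ≤ x*δ := by positivity
    linarith

set_option maxHeartbeats 4000000 in
lemma main_N (ρ : ℝ) (h0 : 0 < ρ) (h1 : ρ < 1) : ∃ η c : ℝ, 0 < η ∧ 0 < c ∧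
    ∀ {Ω : Type} [MeasurableSpace Ω] {P : Measure Ω} [IsProbabilityMeasure P] {γ δ e E x : ℝ} (N : NSys P ρ γ δ e),
      0 < γ → γ ≤ 1/4 → 0 ≤ δ → δ ≤ 1/4 → 0 ≤ e → e ≤ 2*γ^ρ → e ≤ E → 0 ≤ x → x*γ ≤ η →
      ∃ l : ℝ, 0 < l ∧ Real.exp (-(c*(x^(2+ρ)*E + x^2*δ^2 + (1+x)*(x^ρ*γ^ρ+γ^ρ+δ)))) * (1 - stdNormalCDF x) ≤
        P.real {ω | x^2/2 ≤ ∑ i ∈ Finset.range N.n, tY l (N.X i) ω} := by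
  have hcv := cv_ge h0
  have hK := KK_ge h0
  obtain ⟨a0, C, ha0, hC, BE⟩ := be_lower ρ h0 h1
  obtain ⟨a1, κ0, c0, ha1, hκ0, hc0, CR⟩ := crude ρ h0 h1 (KK ρ/4) (by positivity)
  obtain ⟨C', hC', FU⟩ := func hC hκ0 hc0
  set v := min (1/40000) (min (1/(800*cv ρ)) (min a0 a1 / (2*(400+4*cv ρ)))) with hv
  have v0 : 0 < v := by
    refine lt_min (by norm_num) (lt_min (by positivity) (div_pos (lt_min ha0 ha1) (by positivity)))
  have v1 : v ≤ 1/40000 := min_le_left _ _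
  have v2 : v ≤ 1/(800*cv ρ) := (min_le_right _ _).trans (min_le_left _ _)
  have v3 : v ≤ min a0 a1 / (2*(400+4*cv ρ)) := (min_le_right _ _).trans (min_le_right _ _)
  rw [le_div_iff₀ (by positivity)] at v2 v3
  have v4 : min a0 a1 ≤ a0 := min_le_left _ _
  have v5 : min a0 a1 ≤ a1 := min_le_right _ _
  set η := min (1/2) (v^(1/ρ)) with hη
  have η0 : 0 < η := lt_min (by norm_num) (by positivity)
  have η1 : η ≤ 1/2 := min_le_left _ _
  have ηv : η^ρ ≤ v := by
    have : (v^(1/ρ))^ρ = v := by rw [← Real.rpow_mul v0.le]; field_simp; simp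
    rw [← this]
    exact Real.rpow_le_rpow η0.le (min_le_right _ _) h0.le
  set D := KK ρ^ρ + 2*(400+4*cv ρ) + 1 with hD
  have D0 : 0 < D := by positivity
  refine ⟨η, 60000 + 2*C'*D, η0, by positivity, ?_⟩
  intro Ω _ P _ γ δ e E x N hγ hγ4 hδ hδ4 he heg heE hx hxη
  obtain ⟨l, l0, l1, l2, l3, l4, l5, l6, l7, l8⟩ := choice h0 h1 hγ hγ4 hδ hδ4 he heg heE hx v1 η0 η1 ηv hxη
  refine ⟨l, l0, ?_⟩
  have hlp : 0 ≤ (l*γ)^ρ := by positivity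
  have hsm : 400*(cv ρ * (l*γ)^ρ) ≤ 1 := by nlinarith
  set a := (400+4*cv ρ)*(l*γ)^ρ with ha
  obtain ⟨A, core⟩ : ∃ A : WSys P ρ (KK ρ * γ) a δ,
      Real.exp (-(500*(l^(2+ρ)*e) + l^2*(1+δ^2)/2)) * ∫ z, Ef l z ∂A.law
        ≤ P.real {ω | x^2/2 ≤ ∑ i ∈ Finset.range N.n, tY l (N.X i) ω} :=
    ⟨N.toW h0 h1 hγ l0 l1 hsm, N.core h0 h1 hγ l0 l1 hsm l4⟩
  have aa : 0 ≤ a := by positivity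
  have al : a ≤ min a0 a1 := by nlinarith
  have hKγ : 0 < KK ρ*γ := by positivity
  have pr := A.law_prob h0 h1 hKγ aa
  set g := γ^ρ with hg
  have g0 : 0 < g := by positivity
  have hb0 : 0 ≤ (KK ρ*γ)^ρ + a + δ := by positivity
  have F := FU A.law l ((KK ρ*γ)^ρ + a + δ) l0 hb0 (fun t => BE A hKγ aa (al.trans v4) hδ hδ4 t)
    (fun t => by
      have := BE A.neg hKγ aa (al.trans v4) hδ hδ4 (-t)
      rw [A.neg_law, cdf_neg] at this
      linarith)
    (CR A hKγ (by nlinarith) aa (al.trans v5) hδ hδ4)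
  set T := x^(2+ρ)*E + x^2*δ^2 + (1+x)*(x^ρ*g+g+δ) with hT
  have xg : 0 ≤ x^ρ*g := by positivity
  have hE : 0 ≤ E := he.trans heE
  have Tb : (1+x)*(x^ρ*g+g+δ) ≤ T := by
    have : 0 ≤ x^(2+ρ)*E := by positivity
    have : 0 ≤ x^2*δ^2 := by positivity
    linarith
  have b1 : (KK ρ*γ)^ρ + a + δ ≤ D*(x^ρ*g+g+δ) := by
    rw [Real.mul_rpow (by linarith) hγ.le]
    have k0 : 0 ≤ KK ρ^ρ := by positivity
    have : a ≤ (400+4*cv ρ)*(2*(x^ρ*g+g)) := by rw [ha]; gcongr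
    have w1 : 0 ≤ KK ρ^ρ*(x^ρ*g+δ) := by positivity
    have w2 : 0 ≤ 2*(400+4*cv ρ)*δ := by positivity
    rw [hD]
    nlinarith
  have b2 : (1+l)*((KK ρ*γ)^ρ + a + δ) ≤ 2*D*T := by
    calc _ ≤ (2*(1+x))*(D*(x^ρ*g+g+δ)) := by gcongr; linarith
      _ = 2*D*((1+x)*(x^ρ*g+g+δ)) := by ring
      _ ≤ _ := by gcongr
  have m1 : Real.exp (-(l-x)) * mills x ≤ mills l := by
    have := mills_shift hx (by linarith : 0 ≤ l - x)
    simpa using this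
  rw [cdf_compl_mills]
  have mp := mills_pos x
  have b3 := mul_le_mul_of_nonneg_left b2 hC'.le
  calc _ = Real.exp (-((60000 + 2*C'*D)*T) + -(x^2)/2) * mills x := by rw [Real.exp_add]; ring
    _ ≤ Real.exp (-(500*(l^(2+ρ)*e) + l^2*(1+δ^2)/2) + (-(l-x) + -(C'*((1+l)*((KK ρ*γ)^ρ + a + δ))))) * mills x := by
        apply mul_le_mul_of_nonneg_right _ mp.le
        apply Real.exp_le_exp.2
        linarith
    _ = Real.exp (-(500*(l^(2+ρ)*e) + l^2*(1+δ^2)/2)) * ((Real.exp (-(l-x)) * mills x) * Real.exp (-(C'*((1+l)*((KK ρ*γ)^ρ + a + δ))))) := by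
        rw [Real.exp_add, Real.exp_add]; ring
    _ ≤ Real.exp (-(500*(l^(2+ρ)*e) + l^2*(1+δ^2)/2)) * (mills l * Real.exp (-(C'*((1+l)*((KK ρ*γ)^ρ + a + δ))))) := by gcongr
    _ ≤ Real.exp (-(500*(l^(2+ρ)*e) + l^2*(1+δ^2)/2)) * ∫ z, Ef l z ∂A.law := by gcongr
    _ ≤ _ := core

end SNM

namespace SNM

lemma sum_shift (f : ℕ → ℝ) (n : ℕ) : ∑ i ∈ Finset.Icc 1 n, f i = ∑ i ∈ Finset.range n, f (i+1) := by
  induction n with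
  | zero => simp
  | succ k ih => rw [Finset.sum_Icc_succ_top (by omega), Finset.sum_range_succ, ih]

section
variable {Ω : Type} [mΩ : MeasurableSpace Ω] {P : Measure Ω}

lemma Bsq_pos (A : MDS Ω P) : 0 < A.Bsq := by
  refine Finset.sum_pos (fun i hi => ?_) ⟨1, Finset.mem_Icc.2 ⟨le_rfl, A.npos⟩⟩
  have := Finset.mem_Icc.1 hi
  exact A.var_pos i this.1 this.2

variable [IsProbabilityMeasure P]

lemma ce_scale (m : MeasurableSpace Ω) (f g : Ω → ℝ) (c : ℝ) (h : ∀ ω, g ω = c * f ω) :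
    ∀ᵐ ω ∂P, (P[g|m]) ω = c * (P[f|m]) ω := by
  have : g = c • f := by funext ω; simp [h]
  rw [this]
  filter_upwards [condExp_smul c f m (μ := P)] with ω h
  rw [h]; rfl

set_option maxHeartbeats 1000000 in
noncomputable def toN (A : MDS Ω P) {ρ δ ε γ : ℝ} (h0 : 0 < ρ) (H1 : A.CondA1 δ) (H2 : A.CondA2 ρ ε) (H4 : A.CondA4 ρ γ) :
    NSys P ρ γ δ (min (ε^ρ) (2*γ^ρ)) := by
  have hB := Bsq_pos A
  set b := Real.sqrt A.Bsq with hb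
  have b0 : 0 < b := Real.sqrt_pos.2 hB
  have bsq : b^2 = A.Bsq := Real.sq_sqrt hB.le
  have eb : A.Bsq^((2+ρ)/2) = b^(2+ρ) := by
    rw [← bsq, ← Real.rpow_natCast b 2, ← Real.rpow_mul b0.le]; congr 1; push_cast; ring
  have eb2 : b^(2+ρ) = A.Bsq * b^ρ := by
    rw [Real.rpow_add b0, Real.rpow_two, bsq]
  have E2 : ∀ i, ∀ᵐ ω ∂P, (P[fun ω => (A.X (i+1) ω/b)^2|A.F i]) ω = (A.Bsq)⁻¹ * (P[fun ω => (A.X (i+1) ω)^2|A.F i]) ω :=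
    fun i => ce_scale _ _ _ _ fun ω => by rw [div_pow, bsq]; ring
  have Er : ∀ i, ∀ᵐ ω ∂P, (P[fun ω => |A.X (i+1) ω/b|^(2+ρ)|A.F i]) ω = (b^(2+ρ))⁻¹ * (P[fun ω => |A.X (i+1) ω|^(2+ρ)|A.F i]) ω :=
    fun i => ce_scale _ _ _ _ fun ω => by
      rw [abs_div _ b, abs_of_pos b0, Real.div_rpow (abs_nonneg _) b0.le]; ring
  have E2' := ae_all_iff.2 E2
  have Er' := ae_all_iff.2 Er
  have ST : ∀ i < A.n, ∀ᵐ ω ∂P, (P[fun ω => |A.X (i+1) ω/b|^(2+ρ)|A.F i]) ω ≤ γ^ρ * (P[fun ω => (A.X (i+1) ω/b)^2|A.F i]) ω := by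
    intro i hi
    have h4 := H4.2.2.2 (i+1) (by omega) (by omega)
    simp only [Nat.add_sub_cancel] at h4
    filter_upwards [h4, E2 i, Er i] with ω h h2 hr
    rw [h2, hr, eb2]
    rw [← hb, Real.mul_rpow H4.1.le b0.le] at h
    have bρ : 0 < b^ρ := by positivity
    calc _ ≤ (A.Bsq*b^ρ)⁻¹ * (γ^ρ*b^ρ*(P[fun ω => (A.X (i+1) ω)^2|A.F i]) ω) := by gcongr
      _ = _ := by field_simp
  have HS : ∀ᵐ ω ∂P, |∑ i ∈ Finset.range A.n, (P[fun ω => (A.X (i+1) ω/b)^2|A.F i]) ω - 1| ≤ δ^2 := by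
    filter_upwards [E2', H1.2.2] with ω h2 h
    have : A.CV ω = ∑ i ∈ Finset.range A.n, (P[fun ω => (A.X (i+1) ω)^2|A.F i]) ω := by
      unfold MDS.CV; rw [sum_shift]; rfl
    rw [Finset.sum_congr rfl (fun i _ => h2 i), ← Finset.mul_sum, ← this]
    have e : (A.Bsq)⁻¹ * A.CV ω - 1 = (A.Bsq)⁻¹ * (A.CV ω - A.Bsq) := by field_simp
    rw [e, abs_mul, abs_of_pos (inv_pos.2 hB), inv_mul_le_iff₀ hB]
    linarith
  refine
  { n := A.n
    F := A.F
    F_mono := A.F_mono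
    F_le := A.F_le
    X := fun i ω => A.X (i+1) ω / b
    meas := fun i hi => ((A.meas (i+1) (by omega) (by omega)).measurable.div_const b)
    step := ?_
    hs := HS
    hmu := ?_ }
  · intro i hi
    have mX : Measurable (A.X (i+1)) := (A.meas (i+1) (by omega) (by omega)).measurable.mono (A.F_le _) le_rfl
    have s2 := A.sq_int (i+1) (by omega) (by omega)
    have iX : Integrable (A.X (i+1)) P :=
      ((memLp_two_iff_integrable_sq mX.aestronglyMeasurable).2 s2).integrable (by norm_num)
    refine ⟨A.F_le i, mX.div_const b, iX.div_const b, ?_, ?_, ?_, ST i hi⟩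
    · simp only [div_pow]; exact s2.div_const _
    · have : (fun ω => |A.X (i+1) ω/b|^(2+ρ)) = fun ω => |A.X (i+1) ω|^(2+ρ) / b^(2+ρ) := by
        funext ω; rw [abs_div _ b, abs_of_pos b0, Real.div_rpow (abs_nonneg _) b0.le]
      rw [this]
      exact (H4.2.2.1 (i+1) (by omega) (by omega)).div_const _
    · have mz := A.mean_zero (i+1) (by omega) (by omega)
      simp only [Nat.add_sub_cancel] at mz
      filter_upwards [mz, ce_scale (P := P) (A.F i) (A.X (i+1)) (fun ω => A.X (i+1) ω / b) b⁻¹ (fun ω => by ring)] with ω h1 h2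
      rw [h2, h1]; simp
  · have ST' := (Finset.eventually_all (Finset.range A.n)).2 (fun i hi => ST i (Finset.mem_range.1 hi))
    filter_upwards [Er', H2.2.2.2, ST', HS] with ω hr h st hs
    refine le_min ?_ ?_
    · rw [sum_shift] at h
      simp only [Nat.add_sub_cancel] at h
      rw [Finset.sum_congr rfl (fun i _ => hr i), ← Finset.mul_sum, inv_mul_le_iff₀ (by positivity), ← eb]
      linarith
    · refine (Finset.sum_le_sum st).trans ?_
      rw [← Finset.mul_sum]
      have := (abs_le.1 hs).2
      have h' := H1.2.1
      have h'' := H1.1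
      have gp : 0 < γ^ρ := Real.rpow_pos_of_pos H4.1 _
      have : δ^2 ≤ 1 := by nlinarith only [h', h'']
      rw [mul_comm (2:ℝ)]
      gcongr
      linarith

lemma toN_n (A : MDS Ω P) {ρ δ ε γ : ℝ} (h0 : 0 < ρ) (H1 : A.CondA1 δ) (H2 : A.CondA2 ρ ε) (H4 : A.CondA4 ρ γ) :
    (toN A h0 H1 H2 H4).n = A.n := rfl
lemma toN_X (A : MDS Ω P) {ρ δ ε γ : ℝ} (h0 : 0 < ρ) (H1 : A.CondA1 δ) (H2 : A.CondA2 ρ ε) (H4 : A.CondA4 ρ γ) (i : ℕ) (ω : Ω) :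
    (toN A h0 H1 H2 H4).X i ω = A.X (i+1) ω / Real.sqrt A.Bsq := rfl

lemma W_ge (A : MDS Ω P) {l x : ℝ} (hl : 0 < l) (hx : 0 ≤ x) (ω : Ω)
    (h : x^2/2 ≤ ∑ i ∈ Finset.range A.n, YY (l * (A.X (i+1) ω / Real.sqrt A.Bsq))) : x ≤ A.W ω := by
  set b := Real.sqrt A.Bsq with hb
  have b0 : 0 < b := Real.sqrt_pos.2 (Bsq_pos A)
  have e : ∑ i ∈ Finset.range A.n, YY (l * (A.X (i+1) ω / b)) = (l/b) * A.S ω - (l/b)^2 * A.QV ω/2 := by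
    unfold MDS.S MDS.QV YY
    rw [sum_shift, sum_shift, Finset.mul_sum, Finset.mul_sum, Finset.sum_div, ← Finset.sum_sub_distrib]
    refine Finset.sum_congr rfl fun i _ => ?_
    ring
  rw [e] at h
  have k0 : 0 < l/b := by positivity
  set k := l/b
  have Q0 : 0 ≤ A.QV ω := Finset.sum_nonneg fun i _ => sq_nonneg _
  have W : A.W ω = A.S ω / Real.sqrt (A.QV ω) := rfl
  rcases Q0.eq_or_lt with hQ | hQ
  · have : ∀ i ∈ Finset.Icc 1 A.n, A.X i ω ^2 = 0 :=
      (Finset.sum_eq_zero_iff_of_nonneg fun i _ => sq_nonneg _).1 hQ.symm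
    have hS : A.S ω = 0 := Finset.sum_eq_zero fun i hi => by simpa using this i hi
    rw [W, hS]
    rw [hS, ← hQ] at h
    have : x = 0 := by nlinarith
    simp [this]
  · rw [W, le_div_iff₀ (Real.sqrt_pos.2 hQ)]
    set s := Real.sqrt (A.QV ω)
    have hs : s^2 = A.QV ω := Real.sq_sqrt Q0
    rw [← hs] at h
    have : k*(x*s) ≤ k*A.S ω := by nlinarith [sq_nonneg (x - k*s)]
    exact le_of_mul_le_mul_left this k0

lemma neg_ex (A : MDS Ω P) : ∃ A' : MDS Ω P, (∀ ω, A'.W ω = - A.W ω) ∧ (∀ δ, A.CondA1 δ → A'.CondA1 δ) ∧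
    (∀ ρ ε, A.CondA2 ρ ε → A'.CondA2 ρ ε) ∧ (∀ ρ γ, A.CondA4 ρ γ → A'.CondA4 ρ γ) := by
  refine ⟨{ A with
    X := fun i ω => - A.X i ω
    meas := fun i h1 h2 => (A.meas i h1 h2).neg
    sq_int := fun i h1 h2 => by simpa only [neg_sq] using A.sq_int i h1 h2
    mean_zero := fun i h1 h2 => by
      have := condExp_neg (A.X i) (A.F (i-1)) (μ := P)
      refine EventuallyEq.trans this ?_
      filter_upwards [A.mean_zero i h1 h2] with ω h
      simp [h]
    var_pos := fun i h1 h2 => by simpa only [neg_sq] using A.var_pos i h1 h2 }, ?_, ?_, ?_, ?_⟩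
  · intro ω
    simp only [MDS.W, MDS.S, MDS.QV, neg_sq, Finset.sum_neg_distrib, neg_div]
  · intro δ h
    simpa only [MDS.CondA1, MDS.CV, MDS.Bsq, neg_sq] using h
  · intro ρ ε h
    simpa only [MDS.CondA2, MDS.Bsq, neg_sq, abs_neg] using h
  · intro ρ γ h
    simpa only [MDS.CondA4, MDS.Bsq, neg_sq, abs_neg] using h
end

lemma main_A (ρ : ℝ) (h0 : 0 < ρ) (h1 : ρ < 1) : ∃ η c : ℝ, 0 < η ∧ 0 < c ∧
    ∀ {Ω : Type} [MeasurableSpace Ω] {P : Measure Ω} [IsProbabilityMeasure P] {γ δ ε x : ℝ} (A : MDS Ω P),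
      A.CondA1 δ → A.CondA2 ρ ε → A.CondA4 ρ γ → 0 ≤ x → x*γ ≤ η →
      Real.exp (-(c*(x^(2+ρ)*ε^ρ + x^2*δ^2 + (1+x)*(x^ρ*γ^ρ+γ^ρ+δ)))) ≤
        (P {ω | x ≤ A.W ω}).toReal / (1 - stdNormalCDF x) := by
  obtain ⟨η, c, hη, hc, H⟩ := main_N ρ h0 h1
  refine ⟨η, c, hη, hc, ?_⟩
  intro Ω _ P _ γ δ ε x A H1 H2 H4 hx hxη
  have gp : 0 < γ^ρ := Real.rpow_pos_of_pos H4.1 _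
  have ep : 0 < ε^ρ := Real.rpow_pos_of_pos H2.1 _
  obtain ⟨l, hl, h⟩ := H (toN A h0 H1 H2 H4) H4.1 H4.2.1 H1.1 H1.2.1 (le_min ep.le (by positivity)) (min_le_right _ _)
    (min_le_left _ _) hx hxη
  have tp : 0 < 1 - stdNormalCDF x := by
    rw [cdf_compl_mills]; exact mul_pos (Real.exp_pos _) (mills_pos x)
  rw [le_div_iff₀ tp]
  refine h.trans ?_
  exact measureReal_mono (fun ω hω => W_ge A hl hx ω hω)

end SNM

/-- Theorem 2.2 [i]: lower bound under (A1), (A2), (A4), for `ρ ∈ (0,1)`. -/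
theorem lower_bound_A1A2A4_rho_lt_one (ρ : ℝ) (hρ : 0 < ρ) (hρ' : ρ < 1) :
    ∃ c : ℝ, 0 < c ∧
      ∀ (Ω : Type) [MeasurableSpace Ω] (P : Measure Ω), IsProbabilityMeasure P →
        ∀ (A : ℕ → MDS Ω P) (δ ε γ x : ℕ → ℝ),
          (∀ n, (A n).CondA1 (δ n)) →
          (∀ n, (A n).CondA2 ρ (ε n)) →
          (∀ n, (A n).CondA4 ρ (γ n)) →
          (∀ n, 0 ≤ x n) →
          Tendsto (fun n => x n * γ n) atTop (nhds 0) →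
          ∀ᶠ n in atTop,
            Real.exp (-(c * (x n ^ (2 + ρ) * ε n ^ ρ + x n ^ 2 * δ n ^ 2 + (1 + x n) * (x n ^ ρ * γ n ^ ρ + γ n ^ ρ + δ n)))) ≤
                (P {ω | x n ≤ (A n).W ω}).toReal / (1 - stdNormalCDF (x n)) ∧
              Real.exp (-(c * (x n ^ (2 + ρ) * ε n ^ ρ + x n ^ 2 * δ n ^ 2 + (1 + x n) * (x n ^ ρ * γ n ^ ρ + γ n ^ ρ + δ n)))) ≤
                (P {ω | (A n).W ω ≤ -x n}).toReal / stdNormalCDF (-x n) := by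
  obtain ⟨η, c, hη, hc, H⟩ := SNM.main_A ρ hρ hρ'
  refine ⟨c, hc, ?_⟩
  intro Ω _ P hP A δ ε γ x H1 H2 H4 hx hlim
  filter_upwards [hlim.eventually (ge_mem_nhds hη)] with n hn
  refine ⟨H (A n) (H1 n) (H2 n) (H4 n) (hx n) hn, ?_⟩
  obtain ⟨A', hW, K1, K2, K4⟩ := SNM.neg_ex (A n)
  have := H A' (K1 _ (H1 n)) (K2 _ _ (H2 n)) (K4 _ _ (H4 n)) (hx n) hn
  rw [SNM.cdf_neg]
  have e : {ω | x n ≤ A'.W ω} = {ω | (A n).W ω ≤ -x n} := by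
    ext ω
    change x n ≤ A'.W ω ↔ (A n).W ω ≤ -x n
    rw [hW]
    constructor <;> intro h <;> linarith
  rw [e] at this
  exact this
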